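/- Let f : Y → X be a finite étale Galois morphism of projective geometrically irreducible varieties over a number field k. Then there exist finitely many projective geometrically irreducible varieties Y₁, …, Y_m over k together with finite morphisms f_i : Y_i → X over k such that: (i) each f_i : Y_i → X is a twist of f : Y → X, i.e., after base change to an algebraic closure ℚ̄ there is an isomorphism (Y_i)_{ℚ̄} ≅ Y_{ℚ̄} commuting with the maps to X_{ℚ̄}; and (ii) X(k) = ⋃_{i=1}^m f_i(Y_i(k)). -/

import Mathlib

noncomputable section

open MvPolynomial
open MvPolynomial

def vecHeight {K : Type} [Field K] [NumberField K] {N : ℕ} (x : Fin N → K) : ℝ :=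
  (((FractionalIdeal.absNorm
        (∑ i, FractionalIdeal.spanSingleton
          (nonZeroDivisors (NumberField.RingOfIntegers K)) (x i)) : ℚ) : ℝ)⁻¹ *
      ∏ w : NumberField.InfinitePlace K, (⨆ i, w (x i)) ^ w.mult) ^
    ((Module.finrank ℚ K : ℝ)⁻¹)

def projHeight {K : Type} [Field K] [NumberField K] {n : ℕ}
    (x : Projectivization K (Fin (n + 1) → K)) : ℝ :=
  vecHeight x.rep

/-! ### Projective zero loci, counting, sparsity -/

/-- The set of `L`-rational points of the Zariski closed subset of `ℙⁿ` cut out by the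
set `S` of (homogeneous) polynomials with coefficients in `k`. -/
def projZeroLocus (k : Type) [CommRing k] {n : ℕ} (S : Set (MvPolynomial (Fin (n + 1)) k))
    (L : Type) [Field L] [Algebra k L] : Set (Projectivization L (Fin (n + 1) → L)) :=
  {x | ∀ f ∈ S, eval x.rep (map (algebraMap k L) f) = 0}

/-- A set `S` of points (of projective space over a number field, say) is *sparse* with
respect to a height function `H` if for every `ε > 0` the number of points of `S` of
height at most `T` is `O_ε(T ^ ε)`. -/
def IsSparseWrt {P : Type} (S : Set P) (H : P → ℝ) : Prop :=
  ∀ ε : ℝ, 0 < ε → ∃ C : ℝ, 0 < C ∧ ∀ T : ℝ, 1 ≤ T →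
    {x | x ∈ S ∧ H x ≤ T}.Finite ∧ ({x | x ∈ S ∧ H x ≤ T}.ncard : ℝ) ≤ C * T ^ ε

/-- Sparsity with respect to the standard projective Weil height. -/
def IsSparse {L : Type} [Field L] [NumberField L] {n : ℕ}
    (S : Set (Projectivization L (Fin (n + 1) → L))) : Prop :=
  IsSparseWrt S projHeight

/-- The closed subset of `ℙⁿ` over a number field `k` cut out by `S` is *xeric* if its set
of `L`-rational points is sparse for every finite extension `L/k`. -/
def IsXeric (k : Type) [Field k] [NumberField k] {n : ℕ}
    (S : Set (MvPolynomial (Fin (n + 1)) k)) : Prop :=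
  ∀ (L : Type) [Field L] [NumberField L] [Algebra k L] [FiniteDimensional k L],
    IsSparse (projZeroLocus k S L)

/-! ### Geometric irreducibility and smoothness, via equations -/

/-- The closed subvariety of `ℙⁿ` cut out by `S` is geometrically integral (a
"geometrically irreducible variety"), expressed over a given algebraically closed
extension `K` of the ground field: the radical of the homogeneous ideal generated by `S`
is prime, and the corresponding cone has a nonzero point. -/
def GeomIntegralOver (k K : Type) [Field k] [Field K] [Algebra k K] {n : ℕ}
    (S : Set (MvPolynomial (Fin (n + 1)) k)) : Prop :=
  (Ideal.span ((map (algebraMap k K)) '' S)).radical.IsPrime ∧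
    ∃ x : Fin (n + 1) → K, x ≠ 0 ∧ ∀ f ∈ S, eval x (map (algebraMap k K) f) = 0

/-- Smoothness (of pure dimension `d`) of the closed subvariety of `ℙⁿ` cut out by `S`,
via the Jacobian criterion: at every nonzero point `x` of the affine cone over an
algebraically closed extension `K`, the space spanned by the gradients of the elements of
the homogeneous ideal of `X` has rank `n - d`. -/
def SmoothOfDimOver (k K : Type) [Field k] [Field K] [Algebra k K] {n : ℕ}
    (S : Set (MvPolynomial (Fin (n + 1)) k)) (d : ℕ) : Prop :=
  ∀ x : Fin (n + 1) → K, x ≠ 0 →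
    (∀ f ∈ S, eval x (map (algebraMap k K) f) = 0) →
    Module.finrank K
      (Submodule.span K
        {g : Fin (n + 1) → K |
          ∃ f ∈ Ideal.span ((map (algebraMap k K)) '' S),
            g = fun j => eval x (pderiv j f)}) = n - d
open MvPolynomial

/-! ### Morphisms of projective varieties, given by finitely many polynomial charts -/

/-- Data describing a morphism from a closed subvariety of `ℙᵐ` to `ℙⁿ`: finitely many
"charts", each of which is an `(n+1)`-tuple of homogeneous polynomials of a common
degree in the `m+1` homogeneous coordinates. -/
structure ChartMap (k : Type) [CommRing k] (m n : ℕ) where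
  numCharts : ℕ
  F : Fin numCharts → Fin (n + 1) → MvPolynomial (Fin (m + 1)) k
  deg : Fin numCharts → ℕ
  homog : ∀ c i, (F c i).IsHomogeneous (deg c)

/-- Evaluation of the chart `c` of a `ChartMap` on a coordinate vector with entries in a
`k`-algebra `A`. -/
def ChartMap.evalVec {k : Type} [CommRing k] {m n : ℕ} (Φ : ChartMap k m n)
    {A : Type} [CommRing A] [Algebra k A] (c : Fin Φ.numCharts) (y : Fin (m + 1) → A) :
    Fin (n + 1) → A :=
  fun i => eval y (map (algebraMap k A) (Φ.F c i))

/-- Base change of the polynomial data of a chart map along `k → K`. -/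
def ChartMap.baseChange {k K : Type} [CommRing k] [CommRing K] [Algebra k K] {m n : ℕ}
    (Φ : ChartMap k m n) : ChartMap K m n where
  numCharts := Φ.numCharts
  F := fun c i => map (algebraMap k K) (Φ.F c i)
  deg := Φ.deg
  homog := fun c i => (Φ.homog c i).map _

/-- The `A`-points of the closed subscheme of `ℙⁿ` cut out by `S`, for a (local)
`k`-algebra `A`, described by coordinate vectors: vectors, one of whose coordinates is a
unit, on which all the equations vanish.  (Two such vectors describe the same `A`-point
iff they differ by a unit scalar, see `unitEquiv`.) -/
def ringPoints (k : Type) [CommRing k] {n : ℕ} (S : Set (MvPolynomial (Fin (n + 1)) k))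
    (A : Type) [CommRing A] [Algebra k A] : Set (Fin (n + 1) → A) :=
  {a | (∃ i, IsUnit (a i)) ∧ ∀ f ∈ S, eval a (map (algebraMap k A) f) = 0}

/-- Two coordinate vectors describe the same point iff they differ by a unit scalar. -/
def unitEquiv {A : Type} [CommRing A] {N : ℕ} (a b : Fin N → A) : Prop :=
  ∃ u : Aˣ, b = fun i => (u : A) * a i

/-- The property that the chart data `Φ` defines a morphism from the closed subvariety
`Y ⊆ ℙᵐ` cut out by `SY` to the closed subvariety `X ⊆ ℙⁿ` cut out by `SX`:  on the
points of `Y` with values in any local `k`-algebra `A`, some chart is defined (has a unit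
coordinate), any two defined charts agree up to a unit scalar, and the image satisfies
the equations of `X`.  (The functor of points on local rings determines a morphism of
  schemes, and every morphism of quasi-projective varieties arises this way.) -/
structure IsChartMorphism (k : Type) [Field k] {m n : ℕ} (Φ : ChartMap k m n)
    (SY : Set (MvPolynomial (Fin (m + 1)) k)) (SX : Set (MvPolynomial (Fin (n + 1)) k)) :
    Prop where
  total : ∀ (A : Type) [CommRing A] [IsLocalRing A] [Algebra k A],
    ∀ a ∈ ringPoints k SY A, ∃ c i, IsUnit (Φ.evalVec c a i)
  compat : ∀ (A : Type) [CommRing A] [IsLocalRing A] [Algebra k A],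
    ∀ a ∈ ringPoints k SY A, ∀ c c', (∃ i, IsUnit (Φ.evalVec c a i)) →
      (∃ i, IsUnit (Φ.evalVec c' a i)) → unitEquiv (Φ.evalVec c a) (Φ.evalVec c' a)
  mapsInto : ∀ (A : Type) [CommRing A] [IsLocalRing A] [Algebra k A],
    ∀ a ∈ ringPoints k SY A, ∀ c, (∃ i, IsUnit (Φ.evalVec c a i)) →
      Φ.evalVec c a ∈ ringPoints k SX A

/-- The graph of the map induced by the chart data `Φ` on projective points over a field
`L`: `z` is the image of `x` if some chart of `Φ` is nonzero at (a representative of) `x`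
and `z` is the corresponding projective point. -/
def chartImage {k L : Type} [Field k] [Field L] [Algebra k L] {m n : ℕ}
    (Φ : ChartMap k m n) (x : Projectivization L (Fin (m + 1) → L))
    (z : Projectivization L (Fin (n + 1) → L)) : Prop :=
  ∃ c, ∃ h : Φ.evalVec c x.rep ≠ 0, z = Projectivization.mk L (Φ.evalVec c x.rep) h

/-! ### Finite étale morphisms, concretely -/

/-- The set of coordinate vectors of `A`-points of `Y` lying (up to a unit scalar, as
they must) over the `A`-point of `X` with coordinate vector `b`, under the map given by
the chart data `Φ`. -/
def fiberOver (k : Type) [Field k] {m n : ℕ} (Φ : ChartMap k m n)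
    (SY : Set (MvPolynomial (Fin (m + 1)) k)) (A : Type) [CommRing A] [Algebra k A]
    (b : Fin (n + 1) → A) : Set (Fin (m + 1) → A) :=
  {a | a ∈ ringPoints k SY A ∧ ∃ c, (∃ i, IsUnit (Φ.evalVec c a i)) ∧
    unitEquiv (Φ.evalVec c a) b}

/-- A set of coordinate vectors contains exactly `d` points up to unit scaling. -/
def HasExactlyPoints {A : Type} [CommRing A] {N : ℕ} (s : Set (Fin N → A)) (d : ℕ) :
    Prop :=
  ∃ r : Fin d → (Fin N → A), (∀ j, r j ∈ s) ∧
    (∀ j j', unitEquiv (r j) (r j') → j = j') ∧ ∀ a ∈ s, ∃ j, unitEquiv a (r j)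

/-- The morphism `Y → X` given by the chart data `Φ` is finite étale of degree `d`:
over every point of `X` with values in a local Artinian `k`-algebra with algebraically
closed residue field, the fiber consists of exactly `d` points.  (For a morphism of
projective varieties over a field of characteristic `0` this characterizes finite étale
morphisms of degree `d`.) -/
def IsFiniteEtaleOfDegree (k : Type) [Field k] {m n : ℕ} (Φ : ChartMap k m n)
    (SY : Set (MvPolynomial (Fin (m + 1)) k)) (SX : Set (MvPolynomial (Fin (n + 1)) k))
    (d : ℕ) : Prop :=
  ∀ (A : Type) [CommRing A] [IsLocalRing A] [IsArtinianRing A] [Algebra k A],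
    IsAlgClosed (IsLocalRing.ResidueField A) →
    ∀ b ∈ ringPoints k SX A, HasExactlyPoints (fiberOver k Φ SY A b) d

/-- Finite étale (of some positive degree). -/
def IsFiniteEtaleMor (k : Type) [Field k] {m n : ℕ} (Φ : ChartMap k m n)
    (SY : Set (MvPolynomial (Fin (m + 1)) k)) (SX : Set (MvPolynomial (Fin (n + 1)) k)) :
    Prop :=
  ∃ d : ℕ, 0 < d ∧ IsFiniteEtaleOfDegree k Φ SY SX d

/-! ### Rational curves -/

/-- Data for a morphism `ℙ¹ → ℙⁿ`: an `(n+1)`-tuple of binary forms of a common degree. -/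
structure RatCurveData (K : Type) [CommRing K] (n : ℕ) where
  d : ℕ
  P : Fin (n + 1) → MvPolynomial (Fin 2) K
  homog : ∀ i, (P i).IsHomogeneous d

/-- Evaluation of the tuple of binary forms at `(s, t)`. -/
def RatCurveData.evalAt {K : Type} [CommRing K] {n : ℕ} (Γ : RatCurveData K n)
    (s t : K) : Fin (n + 1) → K :=
  fun i => eval ![s, t] (Γ.P i)

/-- A subset `C` of `ℙⁿ(K)`, `K` algebraically closed, is a (possibly singular) rational
curve if it is the image of a non-constant morphism `ℙ¹ → ℙⁿ` (such an image is
automatically an integral closed curve). -/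
def IsRationalCurve (K : Type) [Field K] {n : ℕ}
    (C : Set (Projectivization K (Fin (n + 1) → K))) : Prop :=
  ∃ Γ : RatCurveData K n,
    (∀ s t : K, ¬(s = 0 ∧ t = 0) → Γ.evalAt s t ≠ 0) ∧
    (∃ s t s' t' : K, ¬(s = 0 ∧ t = 0) ∧ ¬(s' = 0 ∧ t' = 0) ∧
      ∀ u : K, Γ.evalAt s' t' ≠ u • Γ.evalAt s t) ∧
    C = {z | ∃ s t : K, ∃ h : Γ.evalAt s t ≠ 0, z = Projectivization.mk K (Γ.evalAt s t) h}

/-! ### Deck transformations and Galois covers -/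

/-- The chart morphism `σ : Y → Y` commutes with the chart morphism `Φ : Y → X`,
as maps on points over every field extension. -/
def CommutesWith (k : Type) [Field k] {m n : ℕ} (Φ : ChartMap k m n)
    (σ : ChartMap k m m) (SY : Set (MvPolynomial (Fin (m + 1)) k)) : Prop :=
  ∀ (Ω : Type) [Field Ω] [Algebra k Ω], ∀ y ∈ projZeroLocus k SY Ω, ∀ z,
    chartImage σ y z → ∀ w, chartImage Φ z w → chartImage Φ y w

/-- `σ` is a deck transformation (automorphism over `X`) of the cover `Φ : Y → X`:
it is a morphism `Y → Y` commuting with `Φ`, with a two-sided inverse of the same kind. -/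
def IsDeckAut (k : Type) [Field k] {m n : ℕ} (Φ : ChartMap k m n)
    (SY : Set (MvPolynomial (Fin (m + 1)) k)) (SX : Set (MvPolynomial (Fin (n + 1)) k))
    (σ : ChartMap k m m) : Prop :=
  IsChartMorphism k σ SY SY ∧ CommutesWith k Φ σ SY ∧
    ∃ τ : ChartMap k m m, IsChartMorphism k τ SY SY ∧ CommutesWith k Φ τ SY ∧
      ∀ (Ω : Type) [Field Ω] [Algebra k Ω], ∀ y ∈ projZeroLocus k SY Ω,
        (∀ z, chartImage σ y z → ∀ w, chartImage τ z w → w = y) ∧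
        (∀ z, chartImage τ y z → ∀ w, chartImage σ z w → w = y)

/-- The finite étale cover `Φ : Y → X` is Galois: the group of deck transformations
acts simply transitively on every geometric fiber (transitively, and with trivial
stabilizers: a deck transformation fixing a point is the identity on all points). -/
def IsGaloisCover (k : Type) [Field k] {m n : ℕ} (Φ : ChartMap k m n)
    (SY : Set (MvPolynomial (Fin (m + 1)) k)) (SX : Set (MvPolynomial (Fin (n + 1)) k)) :
    Prop :=
  ∀ (Ω : Type) [Field Ω] [Algebra k Ω] [IsAlgClosed Ω],
    ∀ x ∈ projZeroLocus k SX Ω, ∀ y ∈ projZeroLocus k SY Ω, ∀ y' ∈ projZeroLocus k SY Ω,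
      chartImage Φ y x → chartImage Φ y' x →
        (∃ σ, IsDeckAut k Φ SY SX σ ∧ chartImage σ y y') ∧
        (∀ σ, IsDeckAut k Φ SY SX σ → chartImage σ y y →
          ∀ (Ω' : Type) [Field Ω'] [Algebra k Ω'],
            ∀ z ∈ projZeroLocus k SY Ω', chartImage σ z z)

/-- `g` is an isomorphism from the closed subvariety cut out by `SA` to the one cut out
by `SB`: a morphism with a two-sided inverse morphism. -/
def IsChartIso (k : Type) [Field k] {a b : ℕ} (g : ChartMap k a b)
    (SA : Set (MvPolynomial (Fin (a + 1)) k)) (SB : Set (MvPolynomial (Fin (b + 1)) k)) :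
    Prop :=
  IsChartMorphism k g SA SB ∧
    ∃ g' : ChartMap k b a, IsChartMorphism k g' SB SA ∧
      ∀ (Ω : Type) [Field Ω] [Algebra k Ω],
        (∀ y ∈ projZeroLocus k SA Ω, ∀ z, chartImage g y z →
          ∀ w, chartImage g' z w → w = y) ∧
        (∀ y ∈ projZeroLocus k SB Ω, ∀ z, chartImage g' y z →
          ∀ w, chartImage g z w → w = y)

/-! ### Coordinate vectors up to unit scalars -/

section Vectors

variable {A : Type} [CommRing A] {N : ℕ}

lemma unitEquiv.refl (a : Fin N → A) : unitEquiv a a := ⟨1, by simp⟩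

lemma unitEquiv.symm {a b : Fin N → A} (h : unitEquiv a b) : unitEquiv b a := by
  obtain ⟨u, rfl⟩ := h
  exact ⟨u⁻¹, by ext i; simp⟩

lemma unitEquiv.trans {a b c : Fin N → A} (h : unitEquiv a b) (h' : unitEquiv b c) :
    unitEquiv a c := by
  obtain ⟨u, rfl⟩ := h
  obtain ⟨v, rfl⟩ := h'
  exact ⟨v * u, by ext i; simp [mul_assoc]⟩

lemma unitEquiv.exists_isUnit {a b : Fin N → A} (h : unitEquiv a b) (ha : ∃ i, IsUnit (a i)) :
    ∃ i, IsUnit (b i) := by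
  obtain ⟨u, rfl⟩ := h
  obtain ⟨i, hi⟩ := ha
  exact ⟨i, u.isUnit.mul hi⟩

lemma exists_isUnit_iff_ne_zero {L : Type} [Field L] {a : Fin N → L} :
    (∃ i, IsUnit (a i)) ↔ a ≠ 0 := by
  simp [Function.ne_iff, isUnit_iff_ne_zero]

lemma unitEquiv_iff_exists_ne_zero {L : Type} [Field L] {a b : Fin N → L} :
    unitEquiv a b ↔ ∃ u : L, u ≠ 0 ∧ b = u • a :=
  ⟨fun ⟨u, hu⟩ => ⟨u, u.ne_zero, hu⟩, fun ⟨u, hu, h⟩ => ⟨Units.mk0 u hu, h⟩⟩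

lemma unitEquiv.map {B : Type} [CommRing B] {a b : Fin N → A} (h : unitEquiv a b) (f : A →+* B) :
    unitEquiv (f ∘ a) (f ∘ b) := by
  obtain ⟨u, rfl⟩ := h
  exact ⟨Units.map f u, by ext i; simp⟩

/-- Homogeneous polynomials scale by the power of the scalar given by their degree. -/
lemma MvPolynomial.IsHomogeneous.eval_smul' {R ι : Type*} [CommRing R] {f : MvPolynomial ι R}
    {e : ℕ} (hf : f.IsHomogeneous e) (u : R) (a : ι → R) :
    eval (u • a) f = u ^ e * eval a f := by
  rw [eval_eq, eval_eq, Finset.mul_sum]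
  refine Finset.sum_congr rfl fun d hd => ?_
  have h : ∑ i ∈ d.support, d i = e := (hf.degree_eq_sum_deg_support hd).symm
  simp only [Pi.smul_apply, smul_eq_mul, mul_pow, Finset.prod_mul_distrib, Finset.prod_pow_eq_pow_sum, h]
  ring

end Vectors

section Charts

variable {k : Type} [Field k] {m n : ℕ}

lemma ChartMap.evalVec_smul (Φ : ChartMap k m n) {A : Type} [CommRing A] [Algebra k A]
    (c : Fin Φ.numCharts) (u : A) (y : Fin (m + 1) → A) :
    Φ.evalVec c (u • y) = u ^ Φ.deg c • Φ.evalVec c y := by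
  ext i
  exact ((Φ.homog c i).map _).eval_smul' u y

lemma eval_map_algHom {ι A B : Type*} [CommRing A] [CommRing B] [Algebra k A] [Algebra k B]
    (f : A →ₐ[k] B) (a : ι → A) (p : MvPolynomial ι k) :
    eval (f ∘ a) (map (algebraMap k B) p) = f (eval a (map (algebraMap k A) p)) := by
  rw [eval_map, eval_map, ← aeval_def, ← aeval_def]
  exact (comp_aeval_apply a f p).symm

lemma eval_map_eq_aeval {ι A : Type*} [CommRing A] [Algebra k A] (a : ι → A)
    (p : MvPolynomial ι k) : eval a (map (algebraMap k A) p) = aeval a p := by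
  rw [eval_map, aeval_def]

lemma ChartMap.evalVec_apply (Φ : ChartMap k m n) {A : Type} [CommRing A] [Algebra k A]
    (c : Fin Φ.numCharts) (y : Fin (m + 1) → A) (i : Fin (n + 1)) :
    Φ.evalVec c y i = aeval y (Φ.F c i) :=
  eval_map_eq_aeval y _

lemma ChartMap.evalVec_algHom (Φ : ChartMap k m n) {A B : Type} [CommRing A] [CommRing B]
    [Algebra k A] [Algebra k B] (f : A →ₐ[k] B) (c : Fin Φ.numCharts) (y : Fin (m + 1) → A) :
    Φ.evalVec c (f ∘ y) = f ∘ Φ.evalVec c y := by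
  ext i
  exact eval_map_algHom f y _

lemma mem_ringPoints_of_unitEquiv {S : Set (MvPolynomial (Fin (n + 1)) k)}
    (hS : ∀ f ∈ S, ∃ e, f.IsHomogeneous e) {A : Type} [CommRing A] [Algebra k A]
    {a b : Fin (n + 1) → A} (hab : unitEquiv a b) (ha : a ∈ ringPoints k S A) :
    b ∈ ringPoints k S A := by
  refine ⟨hab.exists_isUnit ha.1, fun f hf => ?_⟩
  obtain ⟨u, rfl⟩ := hab
  obtain ⟨e, he⟩ := hS f hf
  exact ((he.map _).eval_smul' (u : A) a).trans (by rw [ha.2 f hf, mul_zero])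

lemma ringPoints_algHom {S : Set (MvPolynomial (Fin (n + 1)) k)}
    {A B : Type} [CommRing A] [CommRing B] [Algebra k A] [Algebra k B] (g : A →ₐ[k] B)
    {a : Fin (n + 1) → A} (ha : a ∈ ringPoints k S A) : g ∘ a ∈ ringPoints k S B := by
  refine ⟨ha.1.imp fun i hi => hi.map g, fun f hf => ?_⟩
  rw [eval_map_algHom, ha.2 f hf, map_zero]

/-- `x` is a coordinate vector of the image of the point with coordinate vector `a`. -/
def IsImage (Φ : ChartMap k m n) {A : Type} [CommRing A] [Algebra k A]
    (a : Fin (m + 1) → A) (x : Fin (n + 1) → A) : Prop :=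
  ∃ c, (∃ i, IsUnit (Φ.evalVec c a i)) ∧ unitEquiv (Φ.evalVec c a) x

section

variable {Φ : ChartMap k m n} {A : Type} [CommRing A] [Algebra k A]

lemma IsImage.congr_right {a : Fin (m + 1) → A} {x x' : Fin (n + 1) → A} (h : IsImage Φ a x)
    (hx : unitEquiv x x') : IsImage Φ a x' := by
  obtain ⟨c, hc, h⟩ := h
  exact ⟨c, hc, h.trans hx⟩

lemma IsImage.congr_left {a a' : Fin (m + 1) → A} {x : Fin (n + 1) → A} (h : IsImage Φ a x)
    (ha : unitEquiv a a') : IsImage Φ a' x := by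
  obtain ⟨c, hc, h⟩ := h
  obtain ⟨u, rfl⟩ := ha
  have key : unitEquiv (Φ.evalVec c a) (Φ.evalVec c (u • a)) := by
    refine ⟨u ^ Φ.deg c, ?_⟩
    rw [show (u • a : Fin (m + 1) → A) = (u : A) • a from rfl, Φ.evalVec_smul]
    ext i
    simp
  exact ⟨c, key.exists_isUnit hc, key.symm.trans h⟩

lemma IsImage.exists_isUnit {a : Fin (m + 1) → A} {x : Fin (n + 1) → A} (h : IsImage Φ a x) :
    ∃ i, IsUnit (x i) := by
  obtain ⟨c, hc, h⟩ := h
  exact h.exists_isUnit hc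

lemma IsImage.map {B : Type} [CommRing B] [Algebra k B] {a : Fin (m + 1) → A}
    {x : Fin (n + 1) → A} (h : IsImage Φ a x) (f : A →ₐ[k] B) : IsImage Φ (f ∘ a) (f ∘ x) := by
  obtain ⟨c, hc, h⟩ := h
  refine ⟨c, ?_, ?_⟩
  · rw [Φ.evalVec_algHom]
    exact hc.imp fun i hi => hi.map f
  · rw [Φ.evalVec_algHom]
    exact h.map (f : A →+* B)

variable {SY : Set (MvPolynomial (Fin (m + 1)) k)} {SX : Set (MvPolynomial (Fin (n + 1)) k)}

lemma IsChartMorphism.exists_isImage [IsLocalRing A] (hΦ : IsChartMorphism k Φ SY SX)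
    {a : Fin (m + 1) → A} (ha : a ∈ ringPoints k SY A) : ∃ x, IsImage Φ a x := by
  obtain ⟨c, i, h⟩ := hΦ.total A a ha
  exact ⟨_, c, ⟨i, h⟩, .refl _⟩

lemma IsChartMorphism.unitEquiv_of_isImage [IsLocalRing A] (hΦ : IsChartMorphism k Φ SY SX)
    {a : Fin (m + 1) → A} (ha : a ∈ ringPoints k SY A) {x x' : Fin (n + 1) → A}
    (h : IsImage Φ a x) (h' : IsImage Φ a x') : unitEquiv x x' := by
  obtain ⟨c, hc, h⟩ := h
  obtain ⟨c', hc', h'⟩ := h'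
  exact h.symm.trans ((hΦ.compat A a ha c c' hc hc').trans h')

lemma IsChartMorphism.mem_of_isImage [IsLocalRing A] (hΦ : IsChartMorphism k Φ SY SX)
    (hSX : ∀ f ∈ SX, ∃ e, f.IsHomogeneous e)
    {a : Fin (m + 1) → A} (ha : a ∈ ringPoints k SY A) {x : Fin (n + 1) → A}
    (h : IsImage Φ a x) : x ∈ ringPoints k SX A := by
  obtain ⟨c, hc, h⟩ := h
  exact mem_ringPoints_of_unitEquiv hSX h (hΦ.mapsInto A a ha c hc)

end

/-! ### Passing between projective points and coordinate vectors over a field -/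

section Field

variable {L : Type} [Field L] [Algebra k L]

lemma mem_projZeroLocus_iff {S : Set (MvPolynomial (Fin (n + 1)) k)}
    {x : Projectivization L (Fin (n + 1) → L)} :
    x ∈ projZeroLocus k S L ↔ x.rep ∈ ringPoints k S L :=
  ⟨fun h => ⟨exists_isUnit_iff_ne_zero.2 x.rep_nonzero, h⟩, fun h => h.2⟩

lemma unitEquiv_rep_mk {N : ℕ} {v : Fin N → L} (hv : v ≠ 0) :
    unitEquiv v (Projectivization.mk L v hv).rep := by
  obtain ⟨u, hu⟩ := Projectivization.exists_smul_eq_mk_rep L v hv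
  exact ⟨u, hu.symm⟩

lemma unitEquiv_rep_iff {N : ℕ} {v : Fin N → L} (hv : v ≠ 0) {x : Projectivization L (Fin N → L)} :
    unitEquiv v x.rep ↔ x = Projectivization.mk L v hv := by
  constructor
  · rintro ⟨u, hu⟩
    conv_lhs => rw [← x.mk_rep]
    rw [Projectivization.mk_eq_mk_iff]
    exact ⟨u, hu.symm⟩
  · rintro rfl
    exact unitEquiv_rep_mk hv

lemma eq_of_unitEquiv_rep {N : ℕ} {x y : Projectivization L (Fin N → L)}
    (h : unitEquiv x.rep y.rep) : x = y := by
  rw [unitEquiv_rep_iff x.rep_nonzero, x.mk_rep] at h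
  exact h.symm

lemma mk_mem_projZeroLocus_iff {S : Set (MvPolynomial (Fin (n + 1)) k)}
    (hS : ∀ f ∈ S, ∃ e, f.IsHomogeneous e) {v : Fin (n + 1) → L} (hv : v ≠ 0) :
    Projectivization.mk L v hv ∈ projZeroLocus k S L ↔ v ∈ ringPoints k S L := by
  rw [mem_projZeroLocus_iff]
  exact ⟨mem_ringPoints_of_unitEquiv hS (unitEquiv_rep_mk hv).symm,
    mem_ringPoints_of_unitEquiv hS (unitEquiv_rep_mk hv)⟩

lemma chartImage_iff {Φ : ChartMap k m n} {x : Projectivization L (Fin (m + 1) → L)}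
    {z : Projectivization L (Fin (n + 1) → L)} :
    chartImage Φ x z ↔ IsImage Φ x.rep z.rep := by
  constructor
  · rintro ⟨c, h, rfl⟩
    exact ⟨c, exists_isUnit_iff_ne_zero.2 h, unitEquiv_rep_mk h⟩
  · rintro ⟨c, h, h'⟩
    have h := exists_isUnit_iff_ne_zero.1 h
    exact ⟨c, h, (unitEquiv_rep_iff h).1 h'⟩

lemma chartImage_mk_iff {Φ : ChartMap k m n} {v : Fin (m + 1) → L} (hv : v ≠ 0)
    {w : Fin (n + 1) → L} (hw : w ≠ 0) :
    chartImage Φ (Projectivization.mk L v hv) (Projectivization.mk L w hw) ↔ IsImage Φ v w := by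
  rw [chartImage_iff]
  exact ⟨fun h => (h.congr_left (unitEquiv_rep_mk hv).symm).congr_right (unitEquiv_rep_mk hw).symm,
    fun h => (h.congr_left (unitEquiv_rep_mk hv)).congr_right (unitEquiv_rep_mk hw)⟩

end Field

/-! ### Constructing and composing chart maps -/

/-- Chart data indexed by an arbitrary finite type. -/
def ChartMap.ofFintype {R : Type} [CommRing R] {m n : ℕ} (ι : Type) [Fintype ι]
    (F : ι → Fin (n + 1) → MvPolynomial (Fin (m + 1)) R) (deg : ι → ℕ)
    (homog : ∀ c i, (F c i).IsHomogeneous (deg c)) : ChartMap R m n where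
  numCharts := Fintype.card ι
  F c := F ((Fintype.equivFin ι).symm c)
  deg c := deg ((Fintype.equivFin ι).symm c)
  homog c := homog ((Fintype.equivFin ι).symm c)

lemma ChartMap.forall_ofFintype {R : Type} [CommRing R] {ι : Type} [Fintype ι]
    {F : ι → Fin (n + 1) → MvPolynomial (Fin (m + 1)) R} {deg : ι → ℕ}
    {homog : ∀ c i, (F c i).IsHomogeneous (deg c)} {A : Type} [CommRing A] [Algebra R A]
    {a : Fin (m + 1) → A} {P : (Fin (n + 1) → A) → Prop} :
    (∀ c, P ((ChartMap.ofFintype ι F deg homog).evalVec c a)) ↔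
      ∀ c, P (fun i => eval a (map (algebraMap R A) (F c i))) := by
  refine ⟨fun h c => ?_, fun h c => h ((Fintype.equivFin ι).symm c)⟩
  have := h (Fintype.equivFin ι c)
  unfold ChartMap.evalVec ChartMap.ofFintype at this
  simpa only [Equiv.symm_apply_apply] using this

lemma ChartMap.exists_ofFintype {R : Type} [CommRing R] {ι : Type} [Fintype ι]
    {F : ι → Fin (n + 1) → MvPolynomial (Fin (m + 1)) R} {deg : ι → ℕ}
    {homog : ∀ c i, (F c i).IsHomogeneous (deg c)} {A : Type} [CommRing A] [Algebra R A]
    {a : Fin (m + 1) → A} {P : (Fin (n + 1) → A) → Prop} :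
    (∃ c, P ((ChartMap.ofFintype ι F deg homog).evalVec c a)) ↔
      ∃ c, P (fun i => eval a (map (algebraMap R A) (F c i))) := by
  have := ChartMap.forall_ofFintype (homog := homog) (a := a) (P := fun x => ¬ P x)
  simpa using not_congr this

/-- Composition of chart maps.  The extra factor makes sure that a chart of the composition is
only defined where the inner chart is. -/
def ChartMap.comp {l : ℕ} (Ψ : ChartMap k m n) (Φ : ChartMap k l m) : ChartMap k l n :=
  .ofFintype (Fin Φ.numCharts × Fin Ψ.numCharts × Fin (m + 1))
    (fun c i => Φ.F c.1 c.2.2 * bind₁ (Φ.F c.1) (Ψ.F c.2.1 i))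
    (fun c => Φ.deg c.1 + Φ.deg c.1 * Ψ.deg c.2.1)
    (fun c i => (Φ.homog _ _).mul ((Ψ.homog _ _).aeval _ (fun _ => Φ.homog _ _)))

lemma isImage_comp_iff {l : ℕ} {Ψ : ChartMap k m n} {Φ : ChartMap k l m} {A : Type} [CommRing A]
    [Algebra k A] {a : Fin (l + 1) → A} {x : Fin (n + 1) → A} :
    IsImage (Ψ.comp Φ) a x ↔ ∃ y, IsImage Φ a y ∧ IsImage Ψ y x := by
  have hev : ∀ c : Fin Φ.numCharts × Fin Ψ.numCharts × Fin (m + 1),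
      (fun i => eval a (map (algebraMap k A) (Φ.F c.1 c.2.2 * bind₁ (Φ.F c.1) (Ψ.F c.2.1 i)))) =
        Φ.evalVec c.1 a c.2.2 • Ψ.evalVec c.2.1 (Φ.evalVec c.1 a) := by
    intro c
    ext i
    rw [eval_map_eq_aeval, map_mul, Pi.smul_apply, smul_eq_mul, Φ.evalVec_apply, Ψ.evalVec_apply,
      aeval_bind₁, show Φ.evalVec c.1 a = fun i => aeval a (Φ.F c.1 i) from
        funext (Φ.evalVec_apply c.1 a)]
  unfold IsImage ChartMap.comp
  rw [ChartMap.exists_ofFintype (P := fun v => (∃ i, IsUnit (v i)) ∧ unitEquiv v x)]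
  constructor
  · rintro ⟨c, hc, h⟩
    rw [hev] at hc h
    obtain ⟨i, hi⟩ := hc
    obtain ⟨hj, hi⟩ := IsUnit.mul_iff.1 hi
    refine ⟨_, ⟨c.1, ⟨c.2.2, hj⟩, .refl _⟩, c.2.1, ⟨i, hi⟩, ?_⟩
    exact unitEquiv.trans ⟨hj.unit, rfl⟩ h
  · rintro ⟨y, ⟨c, ⟨j, hj⟩, h⟩, h'⟩
    obtain ⟨c', ⟨i, hi⟩, h''⟩ := IsImage.congr_left (Φ := Ψ) h' h.symm
    refine ⟨⟨c, c', j⟩, ?_⟩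
    rw [hev]
    exact ⟨⟨i, hj.mul hi⟩, unitEquiv.trans (unitEquiv.symm ⟨hj.unit, rfl⟩) h''⟩

lemma isChartMorphism_iff {Φ : ChartMap k m n} {SY : Set (MvPolynomial (Fin (m + 1)) k)}
    {SX : Set (MvPolynomial (Fin (n + 1)) k)} (hSX : ∀ f ∈ SX, ∃ e, f.IsHomogeneous e) :
    IsChartMorphism k Φ SY SX ↔
      ∀ (A : Type) [CommRing A] [IsLocalRing A] [Algebra k A], ∀ a ∈ ringPoints k SY A,
        (∃ x, IsImage Φ a x) ∧ (∀ x x', IsImage Φ a x → IsImage Φ a x' → unitEquiv x x') ∧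
          ∀ x, IsImage Φ a x → x ∈ ringPoints k SX A := by
  constructor
  · intro h A _ _ _ a ha
    exact ⟨h.exists_isImage ha, fun _ _ => h.unitEquiv_of_isImage ha,
      fun _ => h.mem_of_isImage hSX ha⟩
  · intro h
    refine ⟨fun A _ _ _ a ha => ?_, fun A _ _ _ a ha c c' hc hc' => ?_,
      fun A _ _ _ a ha c hc => ?_⟩
    · obtain ⟨x, c, hc, -⟩ := (h A a ha).1
      exact ⟨c, hc⟩
    · exact (h A a ha).2.1 _ _ ⟨c, hc, .refl _⟩ ⟨c', hc', .refl _⟩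
    · exact (h A a ha).2.2 _ ⟨c, hc, .refl _⟩

lemma IsChartMorphism.comp {l : ℕ} {Ψ : ChartMap k m n} {Φ : ChartMap k l m}
    {SZ : Set (MvPolynomial (Fin (l + 1)) k)} {SY : Set (MvPolynomial (Fin (m + 1)) k)}
    {SX : Set (MvPolynomial (Fin (n + 1)) k)} (hSY : ∀ f ∈ SY, ∃ e, f.IsHomogeneous e)
    (hSX : ∀ f ∈ SX, ∃ e, f.IsHomogeneous e)
    (hΨ : IsChartMorphism k Ψ SY SX) (hΦ : IsChartMorphism k Φ SZ SY) :
    IsChartMorphism k (Ψ.comp Φ) SZ SX := by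
  rw [isChartMorphism_iff hSX]
  intro A _ _ _ a ha
  simp only [isImage_comp_iff]
  refine ⟨?_, ?_, ?_⟩
  · obtain ⟨y, hy⟩ := hΦ.exists_isImage ha
    obtain ⟨x, hx⟩ := hΨ.exists_isImage (hΦ.mem_of_isImage hSY ha hy)
    exact ⟨x, y, hy, hx⟩
  · rintro x x' ⟨y, hy, hx⟩ ⟨y', hy', hx'⟩
    exact hΨ.unitEquiv_of_isImage (hΦ.mem_of_isImage hSY ha hy) hx
      (hx'.congr_left (hΦ.unitEquiv_of_isImage ha hy' hy))
  · rintro x ⟨y, hy, hx⟩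
    exact hΨ.mem_of_isImage hSX (hΦ.mem_of_isImage hSY ha hy) hx

end Charts

/-! ### Deck transformations on coordinate vectors -/

section Deck

variable {k : Type} [Field k] {m n : ℕ} {Φ : ChartMap k m n}
  {SY : Set (MvPolynomial (Fin (m + 1)) k)} {SX : Set (MvPolynomial (Fin (n + 1)) k)}

lemma ringPoints.ne_zero {L : Type} [Field L] [Algebra k L] {a : Fin (m + 1) → L}
    (ha : a ∈ ringPoints k SY L) : a ≠ 0 :=
  exists_isUnit_iff_ne_zero.1 ha.1

lemma IsImage.ne_zero {L : Type} [Field L] [Algebra k L] {a : Fin (m + 1) → L}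
    {x : Fin (n + 1) → L} (h : IsImage Φ a x) : x ≠ 0 :=
  exists_isUnit_iff_ne_zero.1 h.exists_isUnit

lemma mk_eq_mk_iff_unitEquiv {L : Type} [Field L] {N : ℕ} {v w : Fin N → L} (hv : v ≠ 0)
    (hw : w ≠ 0) : Projectivization.mk L v hv = Projectivization.mk L w hw ↔ unitEquiv w v := by
  rw [← unitEquiv_rep_iff hw]
  exact ⟨fun h => h.trans (unitEquiv_rep_mk hv).symm, fun h => h.trans (unitEquiv_rep_mk hv)⟩

lemma commutesWith_iff {σ : ChartMap k m m} (hSY : ∀ f ∈ SY, ∃ e, f.IsHomogeneous e) :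
    CommutesWith k Φ σ SY ↔ ∀ (Ω : Type) [Field Ω] [Algebra k Ω], ∀ a ∈ ringPoints k SY Ω,
      ∀ b, IsImage σ a b → ∀ x, IsImage Φ b x → IsImage Φ a x := by
  constructor
  · intro h Ω _ _ a ha b hb x hx
    have := h Ω (.mk Ω a (ringPoints.ne_zero ha)) ((mk_mem_projZeroLocus_iff hSY _).2 ha)
      (.mk Ω b hb.ne_zero) ((chartImage_mk_iff _ _).2 hb) (.mk Ω x hx.ne_zero)
      ((chartImage_mk_iff _ _).2 hx)
    exact (chartImage_mk_iff _ _).1 this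
  · intro h Ω _ _ a ha b hb x hx
    rw [chartImage_iff] at *
    exact h Ω _ (mem_projZeroLocus_iff.1 ha) _ hb _ hx

/-- `τ` is a left inverse of `σ` on the field valued points satisfying `SY`. -/
def IsLeftInverseOn {l : ℕ} (SY : Set (MvPolynomial (Fin (m + 1)) k)) (τ : ChartMap k l m)
    (σ : ChartMap k m l) : Prop :=
  ∀ (Ω : Type) [Field Ω] [Algebra k Ω], ∀ a ∈ ringPoints k SY Ω,
    ∀ b, IsImage σ a b → ∀ c, IsImage τ b c → unitEquiv a c

lemma isLeftInverseOn_iff {l : ℕ} {σ : ChartMap k m l} {τ : ChartMap k l m}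
    (hSY : ∀ f ∈ SY, ∃ e, f.IsHomogeneous e) :
    IsLeftInverseOn SY τ σ ↔ ∀ (Ω : Type) [Field Ω] [Algebra k Ω], ∀ y ∈ projZeroLocus k SY Ω,
      ∀ z, chartImage σ y z → ∀ w, chartImage τ z w → w = y := by
  constructor
  · intro h Ω _ _ a ha b hb x hx
    rw [chartImage_iff] at *
    exact (eq_of_unitEquiv_rep (h Ω _ (mem_projZeroLocus_iff.1 ha) _ hb _ hx)).symm
  · intro h Ω _ _ a ha b hb x hx
    have := h Ω (.mk Ω a (ringPoints.ne_zero ha)) ((mk_mem_projZeroLocus_iff hSY _).2 ha)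
      (.mk Ω b hb.ne_zero) ((chartImage_mk_iff _ _).2 hb) (.mk Ω x hx.ne_zero)
      ((chartImage_mk_iff _ _).2 hx)
    exact (mk_eq_mk_iff_unitEquiv _ _).1 this

lemma isDeckAut_iff {σ : ChartMap k m m} (hSY : ∀ f ∈ SY, ∃ e, f.IsHomogeneous e) :
    IsDeckAut k Φ SY SX σ ↔ IsChartMorphism k σ SY SY ∧ CommutesWith k Φ σ SY ∧
      ∃ τ : ChartMap k m m, IsChartMorphism k τ SY SY ∧ CommutesWith k Φ τ SY ∧
        IsLeftInverseOn SY τ σ ∧ IsLeftInverseOn SY σ τ := by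
  simp only [isLeftInverseOn_iff hSY, IsDeckAut]
  refine and_congr_right fun _ => and_congr_right fun _ => exists_congr fun τ =>
    and_congr_right fun _ => and_congr_right fun _ => ⟨fun h => ⟨?_, ?_⟩, ?_⟩
  · exact fun Ω _ _ y hy => (h Ω y hy).1
  · exact fun Ω _ _ y hy => (h Ω y hy).2
  · exact fun h Ω _ _ y hy => ⟨h.1 Ω y hy, h.2 Ω y hy⟩

lemma CommutesWith.comp {σ τ : ChartMap k m m} (hSY : ∀ f ∈ SY, ∃ e, f.IsHomogeneous e)
    (hσ : CommutesWith k Φ σ SY) (hτ : CommutesWith k Φ τ SY) (hτY : IsChartMorphism k τ SY SY) :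
    CommutesWith k Φ (σ.comp τ) SY := by
  rw [commutesWith_iff hSY] at *
  intro Ω _ _ a ha b hb x hx
  obtain ⟨c, hc, hb⟩ := isImage_comp_iff.1 hb
  exact hτ Ω a ha c hc x (hσ Ω c (hτY.mem_of_isImage hSY ha hc) b hb x hx)

lemma IsLeftInverseOn.comp {σ τ σ' τ' : ChartMap k m m} (hSY : ∀ f ∈ SY, ∃ e, f.IsHomogeneous e)
    (hσ : IsChartMorphism k σ SY SY) (hτ' : IsChartMorphism k τ' SY SY)
    (hσ' : IsChartMorphism k σ' SY SY)
    (h : IsLeftInverseOn SY τ σ) (h' : IsLeftInverseOn SY τ' σ') :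
    IsLeftInverseOn SY (τ.comp τ') (σ'.comp σ) := by
  intro Ω _ _ a ha b hb c hc
  obtain ⟨a₁, ha₁, hb⟩ := isImage_comp_iff.1 hb
  obtain ⟨b₁, hb₁, hc⟩ := isImage_comp_iff.1 hc
  exact h Ω a ha a₁ ha₁ c (hc.congr_left
    (h' Ω a₁ (hσ.mem_of_isImage hSY ha ha₁) b hb b₁ hb₁).symm)

lemma IsDeckAut.comp {σ σ' : ChartMap k m m} (hSY : ∀ f ∈ SY, ∃ e, f.IsHomogeneous e)
    (hσ : IsDeckAut k Φ SY SX σ) (hσ' : IsDeckAut k Φ SY SX σ') :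
    IsDeckAut k Φ SY SX (σ'.comp σ) := by
  rw [isDeckAut_iff hSY] at *
  obtain ⟨h1, h2, τ, h3, h4, h5, h6⟩ := hσ
  obtain ⟨h1', h2', τ', h3', h4', h5', h6'⟩ := hσ'
  exact ⟨h1'.comp hSY hSY h1, h2'.comp hSY h2 h1, τ.comp τ', h3.comp hSY hSY h3',
    h4.comp hSY h4' h3', h5.comp hSY h1 h3' h1' h5', h6'.comp hSY h3' h1 h3 h6⟩

variable (hSY : ∀ f ∈ SY, ∃ e, f.IsHomogeneous e) (hmor : IsChartMorphism k Φ SY SX)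
  (hSX : ∀ f ∈ SX, ∃ e, f.IsHomogeneous e) (hgal : IsGaloisCover k Φ SY SX)
include hSY hmor hSX hgal

lemma IsGaloisCover.exists_isImage {Ω : Type} [Field Ω] [Algebra k Ω] [IsAlgClosed Ω]
    {y y' : Fin (m + 1) → Ω} (hy : y ∈ ringPoints k SY Ω) (hy' : y' ∈ ringPoints k SY Ω)
    {x : Fin (n + 1) → Ω} (hx : IsImage Φ y x) (hx' : IsImage Φ y' x) :
    ∃ σ, IsDeckAut k Φ SY SX σ ∧ IsImage σ y y' := by
  have hx₀ := hmor.mem_of_isImage hSX hy hx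
  obtain ⟨σ, hσ, h⟩ := (hgal Ω (.mk Ω x hx.ne_zero) ((mk_mem_projZeroLocus_iff hSX _).2 hx₀)
    (.mk Ω y (ringPoints.ne_zero hy)) ((mk_mem_projZeroLocus_iff hSY _).2 hy)
    (.mk Ω y' (ringPoints.ne_zero hy')) ((mk_mem_projZeroLocus_iff hSY _).2 hy')
    ((chartImage_mk_iff _ _).2 hx) ((chartImage_mk_iff _ _).2 hx')).1
  exact ⟨σ, hσ, (chartImage_mk_iff _ _).1 h⟩

/-- A deck transformation with a fixed point is the identity. -/
lemma IsGaloisCover.isImage_self {Ω : Type} [Field Ω] [Algebra k Ω] [IsAlgClosed Ω]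
    {y : Fin (m + 1) → Ω} (hy : y ∈ ringPoints k SY Ω) {σ : ChartMap k m m}
    (hσ : IsDeckAut k Φ SY SX σ) (hfix : IsImage σ y y)
    {Ω' : Type} [Field Ω'] [Algebra k Ω'] {z : Fin (m + 1) → Ω'} (hz : z ∈ ringPoints k SY Ω') :
    IsImage σ z z := by
  obtain ⟨x, hx⟩ := hmor.exists_isImage hy
  have hx₀ := hmor.mem_of_isImage hSX hy hx
  have := (hgal Ω (.mk Ω x hx.ne_zero) ((mk_mem_projZeroLocus_iff hSX _).2 hx₀)
    (.mk Ω y (ringPoints.ne_zero hy)) ((mk_mem_projZeroLocus_iff hSY _).2 hy)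
    (.mk Ω y (ringPoints.ne_zero hy)) ((mk_mem_projZeroLocus_iff hSY _).2 hy)
    ((chartImage_mk_iff _ _).2 hx) ((chartImage_mk_iff _ _).2 hx)).2 σ hσ
    ((chartImage_mk_iff _ _).2 hfix) Ω' (.mk Ω' z (ringPoints.ne_zero hz))
    ((mk_mem_projZeroLocus_iff hSY _).2 hz)
  exact (chartImage_mk_iff _ _).1 this

/-- Deck transformations agreeing at one point are equal. -/
lemma IsGaloisCover.isImage_of_agree {Ω : Type} [Field Ω] [Algebra k Ω] [IsAlgClosed Ω]
    {y y' : Fin (m + 1) → Ω} (hy : y ∈ ringPoints k SY Ω) {σ σ' : ChartMap k m m}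
    (hσ : IsDeckAut k Φ SY SX σ) (hσ' : IsDeckAut k Φ SY SX σ') (h : IsImage σ y y')
    (h' : IsImage σ' y y')
    {Ω' : Type} [Field Ω'] [Algebra k Ω'] {z w : Fin (m + 1) → Ω'} (hz : z ∈ ringPoints k SY Ω')
    (hzw : IsImage σ z w) : IsImage σ' z w := by
  obtain ⟨hσ'₁, hσ'₂, τ, hτ₁, hτ₂, hτσ, hστ⟩ := (isDeckAut_iff hSY).1 hσ'
  have hτ : IsDeckAut k Φ SY SX τ :=
    (isDeckAut_iff hSY).2 ⟨hτ₁, hτ₂, σ', hσ'₁, hσ'₂, hστ, hτσ⟩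
  have hcomp : IsDeckAut k Φ SY SX (τ.comp σ) := hσ.comp hSY hτ
  obtain ⟨y₁, hy₁⟩ := hτ₁.exists_isImage (hσ.1.mem_of_isImage hSY hy h)
  have hfix : IsImage (τ.comp σ) y y :=
    isImage_comp_iff.2 ⟨y', h, hy₁.congr_right (hτσ Ω y hy y' h' y₁ hy₁).symm⟩
  have hzfix := hgal.isImage_self hSY hmor hSX hy hcomp hfix hz
  have hw := hσ.1.mem_of_isImage hSY hz hzw
  obtain ⟨z₁, hz₁⟩ := hτ₁.exists_isImage hw
  have hzz₁ : unitEquiv z z₁ := hcomp.1.unitEquiv_of_isImage hz hzfix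
    (isImage_comp_iff.2 ⟨w, hzw, hz₁⟩)
  obtain ⟨w₁, hw₁⟩ := hσ'₁.exists_isImage hz
  exact hw₁.congr_right (hστ Ω' w hw z₁ hz₁ w₁ (hw₁.congr_left hzz₁)).symm

/-- There are finitely many deck transformations, up to equality on points. -/
lemma IsGaloisCover.exists_reps (K : Type) [Field K] [Algebra k K] [IsAlgClosed K]
    {y₀ : Fin (m + 1) → K} (hy₀ : y₀ ∈ ringPoints k SY K) (het : IsFiniteEtaleMor k Φ SY SX) :
    ∃ (d : ℕ) (σ : Fin d → ChartMap k m m), (∀ i, IsDeckAut k Φ SY SX (σ i)) ∧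
      ∀ (Ω : Type) [Field Ω] [Algebra k Ω] [IsAlgClosed Ω] (y y' : Fin (m + 1) → Ω)
        (x : Fin (n + 1) → Ω), y ∈ ringPoints k SY Ω → y' ∈ ringPoints k SY Ω →
        IsImage Φ y x → IsImage Φ y' x → ∃ i, IsImage (σ i) y y' := by
  obtain ⟨x₀, hx₀⟩ := hmor.exists_isImage hy₀
  obtain ⟨d, -, hd⟩ := het
  have hres : IsAlgClosed (IsLocalRing.ResidueField K) :=
    .of_ringEquiv K _ (RingEquiv.ofBijective (IsLocalRing.residue K)
      ⟨(IsLocalRing.residue K).injective, IsLocalRing.residue_surjective⟩)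
  obtain ⟨r, hr, -, hrs⟩ := hd K hres x₀ (hmor.mem_of_isImage hSX hy₀ hx₀)
  choose σ hσ hσr using fun j => hgal.exists_isImage hSY hmor hSX hy₀ (hr j).1 hx₀ (hr j).2
  refine ⟨d, σ, hσ, fun Ω _ _ _ y y' x hy hy' hx hx' => ?_⟩
  obtain ⟨ρ, hρ, hρy⟩ := hgal.exists_isImage hSY hmor hSX hy hy' hx hx'
  obtain ⟨z, hz⟩ := hρ.1.exists_isImage hy₀
  have hzY := hρ.1.mem_of_isImage hSY hy₀ hz
  obtain ⟨x₁, hx₁⟩ := hmor.exists_isImage hzY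
  have hx₀₁ := hmor.unitEquiv_of_isImage hy₀ hx₀
    ((commutesWith_iff hSY).1 hρ.2.1 K y₀ hy₀ z hz x₁ hx₁)
  obtain ⟨j, hj⟩ := hrs z ⟨hzY, hx₁.congr_right hx₀₁.symm⟩
  exact ⟨j, hgal.isImage_of_agree hSY hmor hSX hy₀ hρ (hσ j) (hz.congr_right hj) (hσr j) hy hρy⟩

end Deck

/-! ### Bounding discriminants of Galois extensions -/

section Different

open NumberField

variable {k E : Type} [Field k] [NumberField k] [Field E] [NumberField E] [Algebra k E]

/-- The ideal generated by the differences `b - s b` of algebraic integers. -/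
def inertiaIdeal (s : E ≃ₐ[k] E) : Ideal (𝓞 E) :=
  Ideal.span {x | ∃ b : 𝓞 E, (x : E) = b - s b}

variable (k E) in
/-- The span of the orbit functions `g ↦ g b`. -/
def orbitFunctions : Submodule (𝓞 E) ((E ≃ₐ[k] E) → E) :=
  Submodule.span (𝓞 E) (Set.range fun (b : 𝓞 E) (g : E ≃ₐ[k] E) => g b)

lemma orbit_mem_orbitFunctions (b : 𝓞 E) : (fun g : E ≃ₐ[k] E => g (b : E)) ∈ orbitFunctions k E :=
  Submodule.subset_span ⟨b, rfl⟩

lemma one_mem_orbitFunctions : (1 : (E ≃ₐ[k] E) → E) ∈ orbitFunctions k E := by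
  convert orbit_mem_orbitFunctions (k := k) (1 : 𝓞 E) using 1
  ext g
  simp

lemma mul_mem_orbitFunctions {F G : (E ≃ₐ[k] E) → E} (hF : F ∈ orbitFunctions k E)
    (hG : G ∈ orbitFunctions k E) : F * G ∈ orbitFunctions k E := by
  have h := Submodule.mul_mem_mul hF hG
  refine Submodule.span_mono ?_ ((Submodule.span_mul_span (𝓞 E) _ _).le h)
  rintro _ ⟨_, ⟨a, rfl⟩, _, ⟨b, rfl⟩, rfl⟩
  exact ⟨a * b, by ext g; simp⟩

lemma prod_mem_orbitFunctions {ι : Type*} (S : Finset ι) (F : ι → (E ≃ₐ[k] E) → E)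
    (hF : ∀ i ∈ S, F i ∈ orbitFunctions k E) : ∏ i ∈ S, F i ∈ orbitFunctions k E :=
  Finset.prod_induction _ (· ∈ orbitFunctions k E) (fun _ _ => mul_mem_orbitFunctions)
    one_mem_orbitFunctions hF

lemma exists_orbitFunction {s : E ≃ₐ[k] E} {q : 𝓞 E} (hq : q ∈ inertiaIdeal s) :
    ∃ F ∈ orbitFunctions k E, F 1 = q ∧ F s = 0 := by
  induction hq using Submodule.span_induction with
  | mem x hx =>
    obtain ⟨b, hb⟩ := hx
    refine ⟨(fun g => g (b : E)) - (fun _ => s b), ?_, by simp [hb], by simp⟩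
    have hs : IsIntegral ℤ (s (b : E)) := b.isIntegral_coe.map (s : E →+* E).toIntAlgHom
    obtain ⟨c, hc⟩ : ∃ c : 𝓞 E, (c : E) = s b := ⟨⟨_, hs⟩, rfl⟩
    refine sub_mem (orbit_mem_orbitFunctions b) ?_
    convert (orbitFunctions k E).smul_mem c (one_mem_orbitFunctions (k := k)) using 1
    ext g
    rw [Pi.smul_apply, Pi.one_apply, Algebra.smul_def, mul_one]
    exact hc.symm
  | zero => exact ⟨0, zero_mem _, by simp, rfl⟩
  | add x y _ _ hx hy =>
    obtain ⟨F, hF, h1, h2⟩ := hx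
    obtain ⟨G, hG, h3, h4⟩ := hy
    exact ⟨F + G, add_mem hF hG, by simp [h1, h3], by simp [h2, h4]⟩
  | smul a x _ hx =>
    obtain ⟨F, hF, h1, h2⟩ := hx
    exact ⟨a • F, Submodule.smul_mem _ _ hF, by simp [h1, Algebra.smul_def], by simp [h2]⟩

lemma exists_orbitFunction_single [IsGalois k E] {q : 𝓞 E}
    (hq : ∀ s : E ≃ₐ[k] E, s ≠ 1 → q ∈ inertiaIdeal s) :
    ∃ F ∈ orbitFunctions k E, F 1 = (q : E) ^ (Fintype.card (E ≃ₐ[k] E) - 1) ∧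
      ∀ s ≠ 1, F s = 0 := by
  classical
  have h : ∀ s : E ≃ₐ[k] E, ∃ F ∈ orbitFunctions k E, s ≠ 1 → F 1 = q ∧ F s = 0 := fun s => by
    by_cases hs : s = 1
    · exact ⟨0, zero_mem _, fun h => absurd hs h⟩
    · obtain ⟨F, hF, h⟩ := exists_orbitFunction (hq s hs)
      exact ⟨F, hF, fun _ => h⟩
  choose F hF h using h
  refine ⟨∏ s ∈ Finset.univ.erase 1, F s, prod_mem_orbitFunctions _ _ fun s _ => hF s, ?_, ?_⟩
  · rw [Finset.prod_apply, Finset.prod_congr rfl (g := fun _ => (q : E)) fun s hs =>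
      (h s (Finset.ne_of_mem_erase hs)).1]
    simp
  · intro s hs
    rw [Finset.prod_apply]
    exact Finset.prod_eq_zero (Finset.mem_erase.2 ⟨hs, Finset.mem_univ s⟩) (h s hs).2

lemma sum_mul_mem_of_mem_traceDual [IsGalois k E] {F : (E ≃ₐ[k] E) → E}
    (hF : F ∈ orbitFunctions k E) {x : E}
    (hx : x ∈ Submodule.traceDual (𝓞 k) k (1 : Submodule (𝓞 E) E)) :
    ∑ g : E ≃ₐ[k] E, F g * g x ∈ (1 : Submodule (𝓞 E) E) := by
  induction hF using Submodule.span_induction with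
  | mem F hF =>
    obtain ⟨b, rfl⟩ := hF
    obtain ⟨a, ha⟩ := Submodule.mem_traceDual.1 hx (b : E) (Submodule.mem_one.2 ⟨b, rfl⟩)
    refine Submodule.mem_one.2 ⟨algebraMap (𝓞 k) (𝓞 E) a, ?_⟩
    simp only [← map_mul]
    rw [← trace_eq_sum_automorphisms, mul_comm, ← Algebra.traceForm_apply, ← ha,
      ← IsScalarTower.algebraMap_apply, ← IsScalarTower.algebraMap_apply]
  | zero => simp
  | add F G _ _ hF hG => simpa [add_mul, Finset.sum_add_distrib] using add_mem hF hG
  | smul a F _ hF =>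
    have := Submodule.smul_mem _ a hF
    rw [Finset.smul_sum] at this
    simpa using this

lemma mem_differentIdeal_of_inertia [IsGalois k E] {q : 𝓞 E}
    (hq : ∀ s : E ≃ₐ[k] E, s ≠ 1 → q ∈ inertiaIdeal s) :
    q ^ (Fintype.card (E ≃ₐ[k] E) - 1) ∈ differentIdeal (𝓞 k) (𝓞 E) := by
  classical
  obtain ⟨F, hF, h1, h2⟩ := exists_orbitFunction_single hq
  have : (algebraMap (𝓞 E) E (q ^ (Fintype.card (E ≃ₐ[k] E) - 1))) ∈
      IsLocalization.coeSubmodule E (differentIdeal (𝓞 k) (𝓞 E)) := by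
    rw [coeSubmodule_differentIdeal (𝓞 k) k]
    rw [Submodule.mem_div_iff_forall_mul_mem]
    intro x hx
    have := sum_mul_mem_of_mem_traceDual hF hx
    rw [Finset.sum_eq_single 1 (fun s _ hs => by rw [h2 s hs, zero_mul]) (by simp), h1] at this
    simpa using this
  obtain ⟨y, hy, hyq⟩ := this
  have : y = q ^ (Fintype.card (E ≃ₐ[k] E) - 1) := RingOfIntegers.coe_injective hyq
  rwa [← this]

lemma natAbs_discr_le_of_inertia [IsGalois k E] {Q : ℕ} (hQ : Q ≠ 0) {d : ℕ}
    (hd : Module.finrank k E ≤ d)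
    (hq : ∀ s : E ≃ₐ[k] E, s ≠ 1 → (Q : 𝓞 E) ∈ inertiaIdeal s) :
    (discr E).natAbs ≤ (Q ^ d) ^ (d * Module.finrank ℚ k) * (discr k).natAbs ^ d := by
  have h := mem_differentIdeal_of_inertia hq
  have hcard : Fintype.card (E ≃ₐ[k] E) ≤ d := by
    rwa [← Nat.card_eq_fintype_card, IsGalois.card_aut_eq_finrank]
  have hdisc : (discr k).natAbs ≠ 0 := Int.natAbs_ne_zero.2 (discr_ne_zero k)
  rw [natAbs_discr_eq_absNorm_differentIdeal_mul_natAbs_discr_pow k (𝓞 k) E (𝓞 E)]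
  refine Nat.mul_le_mul ?_ (Nat.pow_le_pow_right (Nat.pos_of_ne_zero hdisc) hd)
  have h1 := Ideal.absNorm_dvd_absNorm_of_le ((Ideal.span_singleton_le_iff_mem _).2 h)
  have h2 : Ideal.absNorm (Ideal.span {(Q : 𝓞 E) ^ (Fintype.card (E ≃ₐ[k] E) - 1)}) =
      (Q ^ (Fintype.card (E ≃ₐ[k] E) - 1)) ^ Module.finrank ℚ E := by
    rw [Ideal.absNorm_span_singleton, ← Nat.cast_pow]
    have := Algebra.norm_algebraMap_of_basis (RingOfIntegers.basis E)
      ((Q ^ (Fintype.card (E ≃ₐ[k] E) - 1) : ℕ) : ℤ)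
    rw [map_natCast] at this
    rw [this, ← Module.finrank_eq_card_basis (RingOfIntegers.basis E), RingOfIntegers.rank]
    simp [Int.natAbs_pow]
  have hpos : 0 < Q := Nat.pos_of_ne_zero hQ
  rw [h2] at h1
  refine (Nat.le_of_dvd (by positivity) h1).trans ?_
  have h3 : Module.finrank ℚ E ≤ d * Module.finrank ℚ k := by
    rw [← Module.finrank_mul_finrank ℚ k E, mul_comm]
    exact Nat.mul_le_mul_right _ hd
  calc _ ≤ (Q ^ d) ^ Module.finrank ℚ E :=
        Nat.pow_le_pow_left (Nat.pow_le_pow_right hpos ((Nat.sub_le _ _).trans hcard)) _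
    _ ≤ _ := Nat.pow_le_pow_right (by positivity) h3

end Different

/-! ### Divisibility at a prime of the ring of integers -/

section Local

open NumberField IsDedekindDomain

variable {E : Type} [Field E] [NumberField E]

/-- Membership in the localization of an ideal at a prime. -/
def LocMem (v : HeightOneSpectrum (𝓞 E)) (I : Ideal (𝓞 E)) (x : E) : Prop :=
  ∃ d ∉ v.asIdeal, ∃ b ∈ I, x * algebraMap (𝓞 E) E d = algebraMap (𝓞 E) E b

variable {v : HeightOneSpectrum (𝓞 E)} {I : Ideal (𝓞 E)}

lemma LocMem.zero : LocMem v I 0 :=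
  ⟨1, (Ideal.ne_top_iff_one _).1 v.isPrime.ne_top, 0, zero_mem _, by simp⟩

lemma LocMem.add {x y : E} (hx : LocMem v I x) (hy : LocMem v I y) : LocMem v I (x + y) := by
  obtain ⟨d, hd, b, hb, h⟩ := hx
  obtain ⟨d', hd', b', hb', h'⟩ := hy
  refine ⟨d * d', v.isPrime.mul_notMem hd hd', d' * b + d * b',
    add_mem (I.mul_mem_left _ hb) (I.mul_mem_left _ hb'), ?_⟩
  simp only [map_mul, map_add]
  rw [← h, ← h']
  ring

lemma LocMem.mul_left {a x : E} (ha : v.valuation E a ≤ 1) (hx : LocMem v I x) :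
    LocMem v I (a * x) := by
  obtain ⟨n, d', hn⟩ := v.exists_primeCompl_mul_eq_of_integer a ha
  obtain ⟨d, hd, b, hb, h⟩ := hx
  refine ⟨d' * d, v.isPrime.mul_notMem d'.2 hd, n * b, I.mul_mem_left _ hb, ?_⟩
  simp only [map_mul]
  rw [← h, ← hn]
  ring

lemma mem_of_forall_locMem {q : 𝓞 E}
    (h : ∀ v : HeightOneSpectrum (𝓞 E), LocMem v I (algebraMap (𝓞 E) E q)) : q ∈ I := by
  set J : Ideal (𝓞 E) := Submodule.comap (LinearMap.mulRight (𝓞 E) q) I with hJ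
  suffices hT : J = ⊤ by
    have : (1 : 𝓞 E) ∈ J := hT ▸ Submodule.mem_top
    simpa [hJ] using this
  by_contra hne
  obtain ⟨P, hP, hJP⟩ := Ideal.exists_le_maximal J hne
  have hbot : P ≠ ⊥ := Ring.ne_bot_of_isMaximal_of_not_isField hP (RingOfIntegers.not_isField E)
  obtain ⟨d, hd, b, hb, hdb⟩ := h ⟨P, hP.isPrime, hbot⟩
  refine hd (hJP ?_)
  have : d * q = b := by
    apply FaithfulSMul.algebraMap_injective (𝓞 E) E
    rw [map_mul, ← hdb, mul_comm]
  simpa [hJ, this] using hb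

lemma exists_common_denom {x y : E} (hx : v.valuation E x ≤ 1) (hy : v.valuation E y ≤ 1) :
    ∃ d ∉ v.asIdeal, ∃ a b : 𝓞 E, x * algebraMap (𝓞 E) E d = algebraMap (𝓞 E) E a ∧
      y * algebraMap (𝓞 E) E d = algebraMap (𝓞 E) E b := by
  obtain ⟨a, d, h⟩ := v.exists_primeCompl_mul_eq_of_integer x hx
  obtain ⟨b, d', h'⟩ := v.exists_primeCompl_mul_eq_of_integer y hy
  refine ⟨d * d', v.isPrime.mul_notMem d.2 d'.2, a * d', b * d, ?_, ?_⟩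
  · rw [map_mul, map_mul, ← h]; ring
  · rw [map_mul, map_mul, ← h']; ring

variable {k : Type} [Field k] [NumberField k] [Algebra k E]

lemma exists_algEquiv_apply_eq (s : E ≃ₐ[k] E) (a : 𝓞 E) : ∃ b : 𝓞 E, s b = (a : E) :=
  ⟨⟨s.symm a, a.isIntegral_coe.map (s.symm : E →+* E).toIntAlgHom⟩, s.apply_symm_apply _⟩

lemma sub_mem_inertiaIdeal {s : E ≃ₐ[k] E} {a b : 𝓞 E} (h : s b = (a : E)) :
    a - b ∈ inertiaIdeal s := by
  rw [← neg_sub]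
  exact neg_mem (Ideal.subset_span ⟨b, by simp [h]⟩)

/-- If `(u, u')` and `(w, w')` are proportional, then `(u, u')` and `(s w, s w')` are proportional
modulo the inertia ideal of `s`. -/
lemma locMem_minor {s : E ≃ₐ[k] E} {u u' w w' : E} (h : u * w' = u' * w)
    (hu : v.valuation E u ≤ 1) (hu' : v.valuation E u' ≤ 1) (hw : v.valuation E (s w) ≤ 1)
    (hw' : v.valuation E (s w') ≤ 1) : LocMem v (inertiaIdeal s) (u * s w' - u' * s w) := by
  obtain ⟨d, hd, a, a', ha, ha'⟩ := exists_common_denom hu hu'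
  obtain ⟨e, he, b, b', hb, hb'⟩ := exists_common_denom hw hw'
  obtain ⟨e₁, he₁⟩ := exists_algEquiv_apply_eq s e
  obtain ⟨b₁, hb₁⟩ := exists_algEquiv_apply_eq s b
  obtain ⟨b₁', hb₁'⟩ := exists_algEquiv_apply_eq s b'
  refine ⟨d * e, v.isPrime.mul_notMem hd he, a * (b' - b₁') - a' * (b - b₁),
    sub_mem (Ideal.mul_mem_left _ _ (sub_mem_inertiaIdeal hb₁'))
      (Ideal.mul_mem_left _ _ (sub_mem_inertiaIdeal hb₁)), ?_⟩
  have h1 : w * algebraMap (𝓞 E) E e₁ = algebraMap (𝓞 E) E b₁ := s.injective (by rw [map_mul, he₁, hb₁, hb])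
  have h2 : w' * algebraMap (𝓞 E) E e₁ = algebraMap (𝓞 E) E b₁' := s.injective (by rw [map_mul, he₁, hb₁', hb'])
  simp only [map_mul, map_sub]
  rw [← ha, ← ha', ← hb, ← hb', ← h1, ← h2]
  linear_combination (algebraMap (𝓞 E) E d * algebraMap (𝓞 E) E e₁) * h

lemma exists_valuation_div_le_one {N : ℕ} {y : Fin N → E} (hy : y ≠ 0)
    (v : HeightOneSpectrum (𝓞 E)) : ∃ i, y i ≠ 0 ∧ ∀ j, v.valuation E (y j / y i) ≤ 1 := by
  obtain ⟨i₀, hi₀⟩ := Function.ne_iff.1 hy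
  have : Nonempty (Fin N) := ⟨i₀⟩
  obtain ⟨i, hi⟩ := Finite.exists_max fun j => v.valuation E (y j)
  have hne : v.valuation E (y i) ≠ 0 := fun h => by
    have := hi i₀
    rw [h, le_zero_iff, map_eq_zero] at this
    exact hi₀ this
  refine ⟨i, fun h => hne (by rw [h, map_zero]), fun j => ?_⟩
  rw [map_div₀]
  exact div_le_one_of_le₀ (hi j) zero_le

/-- Denominators of a polynomial over a number field. -/
lemma exists_nat_valuation_aeval_le_one {m : ℕ} (p : MvPolynomial (Fin m) k) :
    ∃ Q : ℕ, Q ≠ 0 ∧ ∀ (E : Type) [Field E] [NumberField E] [Algebra k E]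
      (v : HeightOneSpectrum (𝓞 E)) (y : Fin m → E), (∀ i, v.valuation E (y i) ≤ 1) →
      v.valuation E (Q * aeval y p) ≤ 1 := by
  induction p using MvPolynomial.induction_on with
  | C a =>
    obtain ⟨n, hn, h⟩ := exists_integral_multiples ℤ ℚ ({a} : Finset k)
    refine ⟨n.natAbs, Int.natAbs_ne_zero.2 hn, fun E _ _ _ v y _ => ?_⟩
    have h := (h a (Finset.mem_singleton_self a))
    have h' : IsIntegral ℤ ((n.natAbs : k) * a) := by
      rw [zsmul_eq_mul] at h
      rcases Int.natAbs_eq n with hn | hn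
      · rw [hn] at h; simpa using h
      · rw [hn] at h; simpa using h.neg
    have h'' := h'.map (algebraMap k E).toIntAlgHom
    have := v.valuation_le_one (K := E) ⟨_, h''⟩
    simpa using this
  | add p q hp hq =>
    obtain ⟨P, hP, hp⟩ := hp
    obtain ⟨Q, hQ, hq⟩ := hq
    refine ⟨P * Q, mul_ne_zero hP hQ, fun E _ _ _ v y hy => ?_⟩
    have hN : ∀ n : ℕ, v.valuation E (n : E) ≤ 1 := fun n => by
      simpa using v.valuation_le_one (K := E) (n : 𝓞 E)
    have : ((P * Q : ℕ) : E) * aeval y (p + q) =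
        Q * (P * aeval y p) + P * (Q * aeval y q) := by push_cast [map_add]; ring
    rw [this]
    refine (Valuation.map_add_le _ ?_ ?_)
    · rw [map_mul]; exact mul_le_one' (hN _) (hp E v y hy)
    · rw [map_mul]; exact mul_le_one' (hN _) (hq E v y hy)
  | mul_X p i hp =>
    obtain ⟨P, hP, hp⟩ := hp
    refine ⟨P, hP, fun E _ _ _ v y hy => ?_⟩
    rw [map_mul (aeval y), aeval_X, ← mul_assoc, map_mul]
    exact mul_le_one' (hp E v y hy) (hy i)

end Local

section ChevalleyWeil

open NumberField IsDedekindDomain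

variable {k : Type} [Field k] {m : ℕ}

/-- The equations saying that the image of a point under `σ` is that point. -/
def minorSet (σ : ChartMap k m m) : Set (MvPolynomial (Fin (m + 1)) k) :=
  {p | ∃ c j l, p = X j * σ.F c l - X l * σ.F c j}

variable [NumberField k] {SY : Set (MvPolynomial (Fin (m + 1)) k)}

lemma valuation_natCast_le_one {E : Type} [Field E] [NumberField E] (v : HeightOneSpectrum (𝓞 E))
    (N : ℕ) : v.valuation E (N : E) ≤ 1 := by
  simpa using v.valuation_le_one (K := E) (N : 𝓞 E)

/-- Over a number field, a family of polynomials has a common denominator. -/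
lemma exists_nat_forall_valuation_aeval_le_one {ι : Type} [Finite ι] {N : ℕ}
    (p : ι → MvPolynomial (Fin N) k) :
    ∃ Q : ℕ, Q ≠ 0 ∧ ∀ (E : Type) [Field E] [NumberField E] [Algebra k E]
      (v : HeightOneSpectrum (𝓞 E)) (y : Fin N → E), (∀ i, v.valuation E (y i) ≤ 1) →
      ∀ i, v.valuation E (Q * aeval y (p i)) ≤ 1 := by
  classical
  have := Fintype.ofFinite ι
  choose Q hQ h using fun i => exists_nat_valuation_aeval_le_one (p i)
  refine ⟨∏ i, Q i, Finset.prod_ne_zero_iff.2 fun i _ => hQ i, fun E _ _ _ v y hy i => ?_⟩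
  rw [← Finset.mul_prod_erase _ _ (Finset.mem_univ i),
    show ((Q i * ∏ j ∈ Finset.univ.erase i, Q j : ℕ) : E) * aeval y (p i) =
      (∏ j ∈ Finset.univ.erase i, Q j : ℕ) * (Q i * aeval y (p i)) by push_cast; ring, map_mul]
  exact mul_le_one' (valuation_natCast_le_one v _) (h i E v y hy)

lemma exists_nat_locMem_of_mem_span (σ : ChartMap k m m) {p : MvPolynomial (Fin (m + 1)) k}
    (hp : p ∈ Ideal.span (SY ∪ minorSet σ)) :
    ∃ Q : ℕ, Q ≠ 0 ∧ ∀ (E : Type) [Field E] [NumberField E] [Algebra k E] (s : E ≃ₐ[k] E)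
      (v : HeightOneSpectrum (𝓞 E)) (y y' : Fin (m + 1) → E) (i₁ : Fin (m + 1)),
      (∀ i, v.valuation E (y i) ≤ 1) → (∀ f ∈ SY, aeval y f = 0) →
      (∀ c l, σ.evalVec c y l = σ.evalVec c y i₁ * y' l) →
      (∀ j l, LocMem v (inertiaIdeal s) (y j * y' l - y l * y' j)) →
      LocMem v (inertiaIdeal s) (Q * aeval y p) := by
  induction hp using Submodule.span_induction with
  | mem p hp =>
    rcases hp with hp | ⟨c, j, l, rfl⟩
    · refine ⟨1, one_ne_zero, fun E _ _ _ s v y y' i₁ _ h _ _ => ?_⟩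
      rw [h p hp, mul_zero]
      exact .zero
    · obtain ⟨Q, hQ, h⟩ := exists_nat_forall_valuation_aeval_le_one (σ.F c)
      refine ⟨Q, hQ, fun E _ _ _ s v y y' i₁ hy _ hσ hloc => ?_⟩
      have : (Q : E) * aeval y (X j * σ.F c l - X l * σ.F c j) =
          (Q * aeval y (σ.F c i₁)) * (y j * y' l - y l * y' j) := by
        have h1 := hσ c l
        have h2 := hσ c j
        simp only [σ.evalVec_apply] at h1 h2
        rw [map_sub, map_mul, map_mul, aeval_X, aeval_X, h1, h2]
        ring
      rw [this]
      exact (hloc j l).mul_left (h E v y hy i₁)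
  | zero =>
    refine ⟨1, one_ne_zero, fun E _ _ _ s v y y' i₁ _ h _ _ => ?_⟩
    rw [map_zero, mul_zero]
    exact .zero
  | add p q _ _ hp hq =>
    obtain ⟨P, hP, hp⟩ := hp
    obtain ⟨Q, hQ, hq⟩ := hq
    refine ⟨P * Q, mul_ne_zero hP hQ, fun E _ _ _ s v y y' i₁ h1 h2 h3 h4 => ?_⟩
    rw [show ((P * Q : ℕ) : E) * aeval y (p + q) = Q * (P * aeval y p) + P * (Q * aeval y q) by
      push_cast [map_add]; ring]
    exact ((hp E s v y y' i₁ h1 h2 h3 h4).mul_left (valuation_natCast_le_one v _)).add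
      ((hq E s v y y' i₁ h1 h2 h3 h4).mul_left (valuation_natCast_le_one v _))
  | smul a p _ hp =>
    obtain ⟨P, hP, hp⟩ := hp
    obtain ⟨Q, hQ, h⟩ := exists_nat_valuation_aeval_le_one a
    refine ⟨Q * P, mul_ne_zero hQ hP, fun E _ _ _ s v y y' i₁ h1 h2 h3 h4 => ?_⟩
    rw [show ((Q * P : ℕ) : E) * aeval y (a • p) = (Q * aeval y a) * (P * aeval y p) by
      rw [smul_eq_mul]; push_cast [map_mul]; ring]
    exact (hp E s v y y' i₁ h1 h2 h3 h4).mul_left (h E v y h1)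

/-- If `σ` has no fixed points, then the inertia ideals of all automorphisms acting on a point
through `σ` contain a fixed integer. -/
lemma exists_nat_mem_inertiaIdeal (hSY : ∀ f ∈ SY, ∃ e, f.IsHomogeneous e)
    {σ : ChartMap k m m} (hσ : IsChartMorphism k σ SY SY) {M : ℕ}
    (hM : ∀ i, X i ^ M ∈ Ideal.span (SY ∪ minorSet σ)) :
    ∃ Q : ℕ, Q ≠ 0 ∧ ∀ (E : Type) [Field E] [NumberField E] [Algebra k E] (s : E ≃ₐ[k] E)
      (y : Fin (m + 1) → E), y ∈ ringPoints k SY E → IsImage σ y (s ∘ y) →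
      (Q : 𝓞 E) ∈ inertiaIdeal s := by
  choose Q hQ h using fun i => exists_nat_locMem_of_mem_span σ (hM i)
  refine ⟨∏ i, Q i, Finset.prod_ne_zero_iff.2 fun i _ => hQ i, fun E _ _ _ s y hy hsy => ?_⟩
  refine mem_of_forall_locMem fun v => ?_
  have hy0 : y ≠ 0 := ringPoints.ne_zero hy
  obtain ⟨i₀, hi₀, hv₀⟩ := exists_valuation_div_le_one hy0 v
  obtain ⟨i₁, hi₁, hv₁⟩ := exists_valuation_div_le_one hsy.ne_zero v
  have hi₁' : y i₁ ≠ 0 := fun h => hi₁ (by simp [h])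
  have hyu : unitEquiv y (fun j => y j / y i₀) :=
    unitEquiv_iff_exists_ne_zero.2 ⟨(y i₀)⁻¹, inv_ne_zero hi₀, by ext j; simp [div_eq_inv_mul]⟩
  have hy' := mem_ringPoints_of_unitEquiv hSY hyu hy
  have key := h i₀ E s v (fun j => y j / y i₀) (fun j => s (y j / y i₁)) i₁ hv₀
    (fun f hf => by rw [← eval_map_eq_aeval]; exact hy'.2 f hf) ?_ ?_
  · have h1 : aeval (fun j => y j / y i₀) (X i₀ ^ M : MvPolynomial (Fin (m + 1)) k) = 1 := by
      simp [div_self hi₀]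
    rw [h1, mul_one] at key
    rw [← Finset.mul_prod_erase _ _ (Finset.mem_univ i₀), mul_comm]
    have := key.mul_left (valuation_natCast_le_one v (∏ j ∈ Finset.univ.erase i₀, Q j))
    simpa using this
  · intro c l
    by_cases hc : σ.evalVec c (fun j => y j / y i₀) = 0
    · simp [hc]
    · have him : IsImage σ (fun j => y j / y i₀) (σ.evalVec c (fun j => y j / y i₀)) :=
        ⟨c, exists_isUnit_iff_ne_zero.2 hc, .refl _⟩
      obtain ⟨u, hu⟩ := hσ.unitEquiv_of_isImage hy' (hsy.congr_left hyu) him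
      rw [hu]
      have : s (y i₁) ≠ 0 := by simpa using hi₁'
      simp only [Function.comp_apply, map_div₀]
      field_simp
  · intro j l
    refine locMem_minor (w := y j / y i₁) (w' := y l / y i₁) (by ring) (hv₀ j) (hv₀ l) ?_ ?_
    · simpa using hv₁ j
    · simpa using hv₁ l

omit [NumberField k] in
lemma exists_X_pow_mem_span_of_forall_not_isImage (K : Type) [Field K] [Algebra k K]
    [IsAlgClosed K] [Algebra.IsAlgebraic k K] (hSY : ∀ f ∈ SY, ∃ e, f.IsHomogeneous e)
    {σ : ChartMap k m m} (hσ : IsChartMorphism k σ SY SY)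
    (hfix : ∀ y ∈ ringPoints k SY K, ¬ IsImage σ y y) :
    ∃ M : ℕ, ∀ i, X i ^ M ∈ Ideal.span (SY ∪ minorSet σ) := by
  have h : ∀ i, X i ∈ (Ideal.span (SY ∪ minorSet σ)).radical := by
    intro i
    rw [← vanishingIdeal_zeroLocus_eq_radical (K := K), mem_vanishingIdeal_iff]
    intro y hy
    rw [zeroLocus_span] at hy
    have hy1 : ∀ f ∈ SY, aeval y f = 0 := fun f hf => hy f (Or.inl hf)
    have hy2 : ∀ c j l, y j * σ.evalVec c y l = y l * σ.evalVec c y j := by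
      intro c j l
      have := hy _ (Or.inr ⟨c, j, l, rfl⟩)
      simpa [sub_eq_zero, σ.evalVec_apply] using this
    rw [aeval_X]
    by_contra hyi
    have hyp : y ∈ ringPoints k SY K :=
      ⟨⟨i, isUnit_iff_ne_zero.2 hyi⟩, fun f hf => by rw [eval_map_eq_aeval]; exact hy1 f hf⟩
    obtain ⟨c, j, hc⟩ := hσ.total K y hyp
    refine hfix y hyp ⟨c, ⟨j, hc⟩, ?_⟩
    have hcj := isUnit_iff_ne_zero.1 hc
    have hci : σ.evalVec c y i ≠ 0 := fun h0 => by
      have := hy2 c i j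
      rw [h0, mul_zero] at this
      exact mul_ne_zero hyi hcj this
    refine unitEquiv_iff_exists_ne_zero.2 ⟨y i / σ.evalVec c y i, div_ne_zero hyi hci, ?_⟩
    ext l
    have := hy2 c i l
    rw [Pi.smul_apply, smul_eq_mul, div_mul_eq_mul_div, this, mul_div_cancel_right₀ _ hci]
  choose M hM using h
  refine ⟨∑ i, M i, fun i => ?_⟩
  rw [← Finset.add_sum_erase _ _ (Finset.mem_univ i), pow_add]
  exact Ideal.mul_mem_right _ _ (hM i)

end ChevalleyWeil

section Descent

variable {k : Type} [Field k] {m n : ℕ}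

lemma unitEquiv_of_map {E K : Type} [Field E] [Field K] {N : ℕ} (f : E →+* K) {a b : Fin N → E}
    (ha : a ≠ 0) (h : unitEquiv (f ∘ a) (f ∘ b)) : unitEquiv a b := by
  obtain ⟨u, hu0, hu⟩ := unitEquiv_iff_exists_ne_zero.1 h
  obtain ⟨i, hi⟩ := Function.ne_iff.1 ha
  have hi' : f (a i) ≠ 0 := by simpa using hi
  have hu' : u = f (b i / a i) := by
    have := congrFun hu i
    simp only [Function.comp_apply, Pi.smul_apply, smul_eq_mul] at this
    rw [map_div₀, this, mul_div_cancel_right₀ _ hi']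
  refine unitEquiv_iff_exists_ne_zero.2 ⟨b i / a i, fun h0 => hu0 (by rw [hu', h0, map_zero]), ?_⟩
  ext j
  apply f.injective
  have := congrFun hu j
  rw [hu'] at this
  simpa using this

lemma IsImage.of_map {Φ : ChartMap k m n} {E K : Type} [Field E] [Field K] [Algebra k E]
    [Algebra k K] (f : E →ₐ[k] K) {a : Fin (m + 1) → E} {x : Fin (n + 1) → E}
    (h : IsImage Φ (f ∘ a) (f ∘ x)) : IsImage Φ a x := by
  obtain ⟨c, hc, h⟩ := h
  rw [Φ.evalVec_algHom] at hc h
  have hc' : Φ.evalVec c a ≠ 0 := fun h0 => by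
    rw [exists_isUnit_iff_ne_zero, h0] at hc
    exact hc (by ext; simp)
  exact ⟨c, exists_isUnit_iff_ne_zero.2 hc', unitEquiv_of_map (f : E →+* K) hc' h⟩

lemma algHom_comp_algebraMap {A B : Type} [CommRing A] [CommRing B] [Algebra k A] [Algebra k B]
    (f : A →ₐ[k] B) {N : ℕ} (x : Fin N → k) : f ∘ algebraMap k A ∘ x = algebraMap k B ∘ x := by
  ext j
  simp

lemma IsImage.map_rational {Φ : ChartMap k m n} {A B : Type} [CommRing A] [CommRing B]
    [Algebra k A] [Algebra k B] (f : A →ₐ[k] B) {a : Fin (m + 1) → A} {x : Fin (n + 1) → k}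
    (h : IsImage Φ a (algebraMap k A ∘ x)) : IsImage Φ (f ∘ a) (algebraMap k B ∘ x) :=
  algHom_comp_algebraMap f x ▸ h.map f

lemma mem_ringPoints_of_map {S : Set (MvPolynomial (Fin (n + 1)) k)} {E K : Type} [Field E]
    [Field K] [Algebra k E] [Algebra k K] (f : E →ₐ[k] K) {a : Fin (n + 1) → E}
    (ha : f ∘ a ∈ ringPoints k S K) : a ∈ ringPoints k S E := by
  refine ⟨?_, fun p hp => ?_⟩
  · obtain ⟨i, hi⟩ := ha.1
    exact ⟨i, isUnit_iff_ne_zero.2 fun h0 => by simp [h0] at hi⟩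
  · apply f.toRingHom.injective
    rw [map_zero]
    exact (eval_map_algHom f a p).symm.trans (ha.2 p hp)

lemma eq_of_unitEquiv_of_apply_eq {L : Type} [CommRing L] {N : ℕ} {a b : Fin N → L}
    (h : unitEquiv a b) {l : Fin N} (ha : a l = 1) (hb : b l = 1) : a = b := by
  obtain ⟨u, rfl⟩ := h
  have : (u : L) = 1 := by simpa [ha] using hb
  ext j
  simp [this]

end Descent

section ChevalleyWeil

open NumberField IntermediateField

variable {k : Type} [Field k] [NumberField k] {m n : ℕ} {Φ : ChartMap k m n}
  {SY : Set (MvPolynomial (Fin (m + 1)) k)} {SX : Set (MvPolynomial (Fin (n + 1)) k)}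

/-- The fields of definition of the points over rational points, as subfields of `K`. -/
lemma exists_bounded_field (hSY : ∀ f ∈ SY, ∃ e, f.IsHomogeneous e)
    (hmor : IsChartMorphism k Φ SY SX)
    (hSX : ∀ f ∈ SX, ∃ e, f.IsHomogeneous e) (hgal : IsGaloisCover k Φ SY SX)
    (K : Type) [Field K] [Algebra k K] [IsAlgClosed K] [Algebra.IsAlgebraic k K]
    {d : ℕ} (σ : Fin d → ChartMap k m m) (hσ : ∀ i, IsDeckAut k Φ SY SX (σ i))
    (hrep : ∀ (y y' : Fin (m + 1) → K)
        (x : Fin (n + 1) → K), y ∈ ringPoints k SY K → y' ∈ ringPoints k SY K →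
        IsImage Φ y x → IsImage Φ y' x → ∃ i, IsImage (σ i) y y') :
    ∃ B : ℕ, ∀ y ∈ ringPoints k SY K, ∀ x : Fin (n + 1) → k, IsImage Φ y (algebraMap k K ∘ x) →
      ∃ E : IntermediateField k K, Normal k E ∧ FiniteDimensional k E ∧
        (∀ [NumberField E], |discr E| ≤ B) ∧
        ∃ y' : Fin (m + 1) → E, unitEquiv y (algebraMap E K ∘ y') := by
  classical
  have : IsAlgClosure k K := ⟨inferInstance, inferInstance⟩
  have : Normal k K := inferInstance
  have hfree : ∀ i, ∃ Q : ℕ, Q ≠ 0 ∧ ((∀ y ∈ ringPoints k SY K, ¬ IsImage (σ i) y y) →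
      ∀ (E : Type) [Field E] [NumberField E] [Algebra k E] (s : E ≃ₐ[k] E)
      (y : Fin (m + 1) → E), y ∈ ringPoints k SY E → IsImage (σ i) y (s ∘ y) →
      (Q : 𝓞 E) ∈ inertiaIdeal s) := by
    intro i
    by_cases hfix : ∀ y ∈ ringPoints k SY K, ¬ IsImage (σ i) y y
    · obtain ⟨M, hM⟩ := exists_X_pow_mem_span_of_forall_not_isImage K hSY (hσ i).1 hfix
      obtain ⟨Q, hQ, h⟩ := exists_nat_mem_inertiaIdeal hSY (hσ i).1 hM
      exact ⟨Q, hQ, fun _ => h⟩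
    · exact ⟨1, one_ne_zero, fun h => absurd h hfix⟩
  choose Q hQ hQI using hfree
  have hQ' : ∏ i, Q i ≠ 0 := Finset.prod_ne_zero_iff.2 fun i _ => hQ i
  refine ⟨((∏ i, Q i) ^ d) ^ (d * Module.finrank ℚ k) * (discr k).natAbs ^ d,
    fun y₁ hy₁ x hx₁ => ?_⟩
  obtain ⟨l, hl⟩ := hy₁.1
  obtain ⟨y, hyy, hyl⟩ : ∃ y, unitEquiv y₁ y ∧ y l = 1 :=
    ⟨_, ⟨hl.unit⁻¹, rfl⟩, hl.val_inv_mul⟩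
  have hy := mem_ringPoints_of_unitEquiv hSY hyy hy₁
  have hx := hx₁.congr_left hyy
  have hS : ∀ s : K ≃ₐ[k] K, ∃ i, IsImage (σ i) y (s ∘ y) := by
    intro s
    have := hrep y (s ∘ y) _ hy (ringPoints_algHom (s : K →ₐ[k] K) hy) hx
      (hx.map_rational (s : K →ₐ[k] K))
    simpa using this
  set E : IntermediateField k K := adjoin k (Set.range y) with hE
  have hyE : ∀ j, y j ∈ E := fun j => subset_adjoin _ _ ⟨j, rfl⟩
  set yE : Fin (m + 1) → E := fun j => ⟨y j, hyE j⟩ with hyEdef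
  have hyEy : E.val ∘ yE = y := rfl
  have hyEm : yE ∈ ringPoints k SY E := mem_ringPoints_of_map E.val hy
  have hfd : FiniteDimensional k E := finiteDimensional_adjoin fun z _ =>
    Algebra.IsIntegral.isIntegral z
  have hnorm : Normal k E := by
    refine normal_iff_forall_map_le'.2 fun s => ?_
    rw [hE, adjoin_map, adjoin_le_iff]
    rintro _ ⟨_, ⟨j, rfl⟩, rfl⟩
    obtain ⟨i, c, hc, hi⟩ := hS s
    obtain ⟨u, -, hu⟩ := unitEquiv_iff_exists_ne_zero.1 hi
    rw [← hyEy, (σ i).evalVec_algHom, hyEy] at hu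
    have h1 := congrFun hu l
    have h2 := congrFun hu j
    simp only [Function.comp_apply, Pi.smul_apply, smul_eq_mul, hyl, map_one] at h1 h2
    change s (y j) ∈ E
    rw [h2, eq_inv_of_mul_eq_one_left h1.symm]
    exact E.mul_mem (E.inv_mem (SetLike.coe_mem _)) (SetLike.coe_mem _)
  have hgalE : IsGalois k E := {}
  have hxE : IsImage Φ yE (algebraMap k E ∘ x) := IsImage.of_map E.val (by
    rw [algHom_comp_algebraMap]
    exact hx)
  have hSE : ∀ s : E ≃ₐ[k] E, ∃ i, IsImage (σ i) yE (s ∘ yE) := by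
    intro s
    have h1 : s ∘ yE ∈ ringPoints k SY E := ringPoints_algHom (s : E →ₐ[k] E) hyEm
    have h2 : IsImage Φ (s ∘ yE) (algebraMap k E ∘ x) := hxE.map_rational (s : E →ₐ[k] E)
    obtain ⟨i, hi⟩ := hrep (E.val ∘ yE) (E.val ∘ (s ∘ yE)) _ (ringPoints_algHom E.val hyEm)
      (ringPoints_algHom E.val h1) (hxE.map E.val) (h2.map E.val)
    exact ⟨i, hi.of_map E.val⟩
  choose τ hτ using hSE
  have hext : ∀ s t : E ≃ₐ[k] E, unitEquiv (s ∘ yE) (t ∘ yE) → s = t := by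
    intro s t hst
    have h1 : yE l = 1 := Subtype.ext hyl
    have h2 := eq_of_unitEquiv_of_apply_eq hst (l := l) (by simp [h1]) (by simp [h1])
    have h3 : (s : E →ₐ[k] E) = t := by
      refine algHom_ext_of_eq_adjoin k hE ?_
      rintro _ ⟨j, rfl⟩
      exact congrFun h2 j
    ext z
    exact congrArg Subtype.val (DFunLike.congr_fun h3 z)
  have hinj : Function.Injective τ := by
    intro s t hst
    refine hext s t ((hσ (τ s)).1.unitEquiv_of_isImage hyEm (hτ s) ?_)
    rw [hst]
    exact hτ t
  have hcard : Module.finrank k E ≤ d := by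
    rw [← IsGalois.card_aut_eq_finrank]
    simpa using Nat.card_le_card_of_injective τ hinj
  refine ⟨E, hnorm, hfd, ?_, yE, by rwa [← hyEy] at hyy⟩
  intro hNF
  rw [Int.abs_eq_natAbs]
  refine Int.ofNat_le.2 (natAbs_discr_le_of_inertia hQ' hcard fun s hs => ?_)
  rw [← Finset.mul_prod_erase _ _ (Finset.mem_univ (τ s)), Nat.cast_mul]
  refine Ideal.mul_mem_right _ _ (hQI (τ s) (fun z hz hfix => hs ?_) E s yE hyEm (hτ s))
  refine (hext 1 s ?_).symm
  have := hgal.isImage_self hSY hmor hSX hz (hσ _) hfix hyEm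
  exact (hσ (τ s)).1.unitEquiv_of_isImage hyEm this (hτ s)

/-- The points of a Galois cover over the rational points of the base are defined over a common
number field. -/
lemma exists_normal_field (hSY : ∀ f ∈ SY, ∃ e, f.IsHomogeneous e)
    (hmor : IsChartMorphism k Φ SY SX)
    (hSX : ∀ f ∈ SX, ∃ e, f.IsHomogeneous e) (hgal : IsGaloisCover k Φ SY SX)
    (K : Type) [Field K] [Algebra k K] [IsAlgClosed K] [Algebra.IsAlgebraic k K] [CharZero K]
    {d : ℕ} (σ : Fin d → ChartMap k m m) (hσ : ∀ i, IsDeckAut k Φ SY SX (σ i))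
    (hrep : ∀ (y y' : Fin (m + 1) → K)
        (x : Fin (n + 1) → K), y ∈ ringPoints k SY K → y' ∈ ringPoints k SY K →
        IsImage Φ y x → IsImage Φ y' x → ∃ i, IsImage (σ i) y y') :
    ∃ L : IntermediateField k K, Normal k L ∧ FiniteDimensional k L ∧
      ∀ y ∈ ringPoints k SY K, ∀ x : Fin (n + 1) → k, IsImage Φ y (algebraMap k K ∘ x) →
        ∃ y' : Fin (m + 1) → L, unitEquiv y (algebraMap L K ∘ y') := by
  obtain ⟨B, hB⟩ := exists_bounded_field hSY hmor hSX hgal K σ hσ hrep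
  set T : Set (IntermediateField k K) := {E | Normal k E ∧ FiniteDimensional k E ∧
    ∀ [NumberField E], |discr E| ≤ B} with hT
  have hfin : T.Finite := by
    have hinj : Function.Injective (fun E : IntermediateField k K => E.restrictScalars ℚ) :=
      restrictScalars_injective ℚ
    have hNF : ∀ E ∈ T, NumberField E := fun E hE =>
      have := hE.2.1
      NumberField.of_module_finite k E
    have hsub : (fun E : IntermediateField k K => E.restrictScalars ℚ) '' T ⊆
        Subtype.val '' {F : {F : IntermediateField ℚ K // FiniteDimensional ℚ F} |
          haveI : NumberField F := @NumberField.mk _ _ inferInstance F.prop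
          |discr F| ≤ B} := by
      rintro _ ⟨E, hE, rfl⟩
      have := hNF E hE
      have hfd : FiniteDimensional ℚ (E.restrictScalars ℚ) :=
        inferInstanceAs (FiniteDimensional ℚ E)
      refine ⟨⟨_, hfd⟩, ?_, rfl⟩
      exact hE.2.2
    exact (((finite_of_discr_bdd K B).image _).subset hsub).of_finite_image hinj.injOn
  have := hfin.to_subtype
  have h1 : ∀ E : T, Normal k E.1 := fun E => E.2.1
  have h2 : ∀ E : T, FiniteDimensional k E.1 := fun E => E.2.2.1
  refine ⟨⨆ E : T, E.1, normal_iSup _ _ _, inferInstance, fun y hy x hx => ?_⟩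
  obtain ⟨E, hE1, hE2, hE3, y', hy'⟩ := hB y hy x hx
  have hle : E ≤ ⨆ E : T, E.1 := le_iSup (fun E : T => E.1) ⟨E, hE1, hE2, hE3⟩
  exact ⟨fun j => ⟨y' j, hle (y' j).2⟩, hy'⟩

end ChevalleyWeil

section Frames

variable {k L : Type} [Field k] [Field L] [Algebra k L] [FiniteDimensional k L]

variable (k L) in
/-- Dual bases of a Galois extension `L / k` together with an enumeration of the coordinates of the
ambient projective space of the twists of a cover. -/
structure TwistFrame (m n : ℕ) where
  M : ℕ
  r : ℕ
  b : Fin r → L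
  bd : Fin r → L
  e : Fin (M + 1) ≃ Fin (n + 1) × Fin r × ((L ≃ₐ[k] L) → Fin (m + 1))
  sum_apply_mul : ∀ h : L ≃ₐ[k] L, h ≠ 1 → ∑ i, h (b i) * bd i = 0
  sum_mul : ∑ i, b i * bd i = 1
  trace_mul : ∀ i j, Algebra.trace k L (b i * bd j) = if i = j then 1 else 0

lemma TwistFrame.nonempty [IsGalois k L] (m n : ℕ) : Nonempty (TwistFrame k L m n) := by
  classical
  let b := Module.finBasis k L
  have hr : 0 < Module.finrank k L := Module.finrank_pos
  have hcard : Fintype.card (Fin (n + 1) × Fin (Module.finrank k L) ×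
      ((L ≃ₐ[k] L) → Fin (m + 1))) - 1 + 1 = Fintype.card (Fin (n + 1) ×
        Fin (Module.finrank k L) × ((L ≃ₐ[k] L) → Fin (m + 1))) := by
    refine Nat.sub_add_cancel (Fintype.card_pos_iff.2 ⟨0, ⟨0, hr⟩, fun _ => 0⟩)
  have key : ∀ h : L ≃ₐ[k] L, ∑ i, h (b i) * b.traceDual i = if h = 1 then 1 else 0 := by
    have hli := (linearIndependent_monoidHom L L).comp
      (fun h : L ≃ₐ[k] L => ((h : L →+* L) : L →* L)) (fun s t hst => by
        ext x
        exact DFunLike.congr_fun hst x)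
    rw [Fintype.linearIndependent_iff] at hli
    intro h
    rw [← sub_eq_zero]
    refine hli (fun h => ∑ i, h (b i) * b.traceDual i - if h = 1 then 1 else 0) ?_ h
    ext x
    have h1 : ∑ i, Algebra.trace k L (x * b i) • b.traceDual i = x := by
      conv_rhs => rw [← b.traceDual.sum_repr x]
      simp [Algebra.traceForm_apply]
    simp only [Algebra.smul_def, trace_eq_sum_automorphisms, map_mul, Finset.sum_mul] at h1
    rw [Finset.sum_comm] at h1
    simp only [Function.comp_apply, Finset.sum_apply, Pi.smul_apply, smul_eq_mul, sub_mul,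
      Finset.sum_sub_distrib, Pi.zero_apply, ite_mul, one_mul, zero_mul, Finset.sum_ite_eq',
      Finset.mem_univ, if_true, MonoidHom.coe_coe, AlgEquiv.one_apply, RingHom.coe_coe]
    rw [sub_eq_zero]
    refine Eq.trans ?_ h1
    refine Finset.sum_congr rfl fun g _ => ?_
    rw [Finset.sum_mul]
    exact Finset.sum_congr rfl fun i _ => by ring
  exact ⟨{
    M := _
    r := _
    b := b
    bd := b.traceDual
    e := (finCongr hcard).trans (Fintype.equivFin _).symm
    sum_apply_mul := fun h hh => by rw [key, if_neg hh]
    sum_mul := by simpa using key 1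
    trace_mul := fun i j => b.trace_mul_traceDual i j }⟩

namespace TwistFrame

variable {m n : ℕ} (F : TwistFrame k L m n) {A B : Type} [CommRing A] [Algebra L A] [CommRing B]
  [Algebra L B]

/-- The coordinate vector on the twist attached to the coordinate vectors `x` of a point of the
base and `ys` of the translates of a point of the cover. -/
def T (x : Fin (n + 1) → A) (ys : (L ≃ₐ[k] L) → Fin (m + 1) → A) : Fin (F.M + 1) → A := fun a =>
  ∑ h : L ≃ₐ[k] L, algebraMap L A (h (F.b (F.e a).2.1)) *
    (x (F.e a).1 * ∏ g, ys g ((F.e a).2.2 (h⁻¹ * g)))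

/-- The conjugate linear forms from which the points of the cover are recovered. -/
def W (h : L ≃ₐ[k] L) (t : Fin (F.M + 1) → A) (j : Fin (n + 1)) (φ : (L ≃ₐ[k] L) → Fin (m + 1)) :
    A :=
  ∑ i, algebraMap L A (h (F.bd i)) * t (F.e.symm (j, i, φ))

lemma T_map (f : A →ₐ[L] B) (x : Fin (n + 1) → A) (ys : (L ≃ₐ[k] L) → Fin (m + 1) → A) :
    F.T (f ∘ x) (fun g => f ∘ ys g) = f ∘ F.T x ys := by
  ext a
  simp [T, map_sum, map_prod]

lemma W_map (f : A →ₐ[L] B) (h : L ≃ₐ[k] L) (t : Fin (F.M + 1) → A) (j φ) :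
    F.W h (f ∘ t) j φ = f (F.W h t j φ) := by
  simp [W, map_sum]

lemma T_smul (u : A) (v : (L ≃ₐ[k] L) → A) (x : Fin (n + 1) → A)
    (ys : (L ≃ₐ[k] L) → Fin (m + 1) → A) :
    F.T (u • x) (fun g => v g • ys g) = (u * ∏ g, v g) • F.T x ys := by
  ext a
  simp only [T, Pi.smul_apply, smul_eq_mul, Finset.mul_sum, Finset.prod_mul_distrib]
  exact Finset.sum_congr rfl fun h _ => by ring

lemma sum_apply_bd_mul_apply_b [DecidableEq (L ≃ₐ[k] L)] (h h' : L ≃ₐ[k] L) :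
    ∑ i, h (F.bd i) * h' (F.b i) = if h' = h then 1 else 0 := by
  have : ∑ i, h (F.bd i) * h' (F.b i) = h (∑ i, (h⁻¹ * h') (F.b i) * F.bd i) := by
    rw [map_sum]
    refine Finset.sum_congr rfl fun i _ => ?_
    rw [map_mul, ← AlgEquiv.mul_apply, mul_inv_cancel_left, mul_comm]
  rw [this]
  split_ifs with hh
  · subst hh
    simp [F.sum_mul]
  · rw [F.sum_apply_mul _ fun h0 => hh (by rwa [inv_mul_eq_one, eq_comm] at h0), map_zero]

lemma W_T (h : L ≃ₐ[k] L) (x : Fin (n + 1) → A) (ys : (L ≃ₐ[k] L) → Fin (m + 1) → A) (j φ) :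
    F.W h (F.T x ys) j φ = x j * ∏ g, ys g (φ (h⁻¹ * g)) := by
  classical
  simp only [W, T, Equiv.apply_symm_apply, Finset.mul_sum]
  rw [Finset.sum_comm]
  have : ∀ h' : L ≃ₐ[k] L, ∑ i, algebraMap L A (h (F.bd i)) * (algebraMap L A (h' (F.b i)) *
      (x j * ∏ g, ys g (φ (h'⁻¹ * g)))) =
      (if h' = h then 1 else 0) * (x j * ∏ g, ys g (φ (h'⁻¹ * g))) := by
    intro h'
    simp only [← mul_assoc, ← map_mul, ← Finset.sum_mul, ← map_sum, F.sum_apply_bd_mul_apply_b]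
    split_ifs <;> simp
  rw [Finset.sum_congr rfl fun h' _ => this h']
  simp

lemma apply_eq_sum_W [IsGalois k L] (t : Fin (F.M + 1) → A) (j i φ) :
    t (F.e.symm (j, i, φ)) = ∑ h : L ≃ₐ[k] L, algebraMap L A (h (F.b i)) * F.W h t j φ := by
  classical
  simp only [W, Finset.mul_sum]
  rw [Finset.sum_comm]
  have : ∀ i', ∑ h : L ≃ₐ[k] L, algebraMap L A (h (F.b i)) * (algebraMap L A (h (F.bd i')) *
      t (F.e.symm (j, i', φ))) = (if i = i' then 1 else 0) * t (F.e.symm (j, i', φ)) := by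
    intro i'
    simp only [← mul_assoc, ← map_mul, ← Finset.sum_mul, ← map_sum]
    rw [← trace_eq_sum_automorphisms (K := k), F.trace_mul]
    split_ifs <;> simp
  rw [Finset.sum_congr rfl fun h' _ => this h']
  simp

/-- The automorphism `σ` of the coefficients permutes the conjugate linear forms. -/
lemma map_T (h₀ : L ≃ₐ[k] L) (f : A →+* B)
    (hf : ∀ a : L, f (algebraMap L A a) = algebraMap L B (h₀ a))
    (x : Fin (n + 1) → A) (ys : (L ≃ₐ[k] L) → Fin (m + 1) → A) :
    f ∘ F.T x ys = F.T (f ∘ x) (fun g => f ∘ ys (h₀⁻¹ * g)) := by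
  ext a
  simp only [T, Function.comp_apply, map_sum, map_mul, map_prod, hf]
  refine Fintype.sum_equiv (Equiv.mulLeft h₀) _ _ fun h => ?_
  simp only [Equiv.coe_mulLeft, AlgEquiv.mul_apply]
  congr 2
  refine Fintype.prod_equiv (Equiv.mulLeft h₀) _ _ fun g => ?_
  simp [mul_assoc]

end TwistFrame

end Frames

section DescentOfPolynomials

variable {k L : Type} [Field k] [Field L] [Algebra k L]

/-- The polynomial obtained by taking the traces of the coefficients of `c • q`. -/
def tracePoly {N : ℕ} (c : L) (q : MvPolynomial (Fin N) L) : MvPolynomial (Fin N) k :=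
  ∑ d ∈ q.support, monomial d (Algebra.trace k L (c * coeff d q))

lemma isHomogeneous_tracePoly {N : ℕ} (c : L) {q : MvPolynomial (Fin N) L} {e : ℕ}
    (hq : q.IsHomogeneous e) : (tracePoly (k := k) c q).IsHomogeneous e :=
  IsHomogeneous.sum _ _ _ fun d hd =>
    isHomogeneous_monomial _ (by
      have := hq (mem_support_iff.1 hd)
      rw [← this, Finsupp.degree_eq_weight_one]
      rfl)

variable [FiniteDimensional k L] [IsGalois k L]

lemma map_tracePoly {N : ℕ} (c : L) (q : MvPolynomial (Fin N) L) :
    map (algebraMap k L) (tracePoly c q) =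
      ∑ h : L ≃ₐ[k] L, C (h c) * map (h : L →+* L) q := by
  ext d
  rw [coeff_map, coeff_sum]
  simp only [tracePoly, coeff_sum, coeff_monomial, coeff_C_mul, coeff_map, Finset.sum_ite_eq']
  have : (if d ∈ q.support then Algebra.trace k L (c * coeff d q) else 0) =
      Algebra.trace k L (c * coeff d q) := by
    split_ifs with h
    · rfl
    · rw [notMem_support_iff.1 h, mul_zero, map_zero]
  rw [this, trace_eq_sum_automorphisms]
  simp

variable {m n : ℕ} (F : TwistFrame k L m n)

/-- A polynomial over `L` is a combination of polynomials over `k` in the span of its conjugates. -/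
lemma TwistFrame.eq_sum_tracePoly {N : ℕ} (q : MvPolynomial (Fin N) L) :
    q = ∑ i, C (F.bd i) * map (algebraMap k L) (tracePoly (F.b i) q) := by
  classical
  simp only [map_tracePoly, Finset.mul_sum]
  rw [Finset.sum_comm]
  have : ∀ h : L ≃ₐ[k] L, ∑ i, C (F.bd i) * (C (h (F.b i)) * map (h : L →+* L) q) =
      C (if h = 1 then 1 else 0) * map (h : L →+* L) q := by
    intro h
    have := F.sum_apply_bd_mul_apply_b 1 h
    rw [← this, map_sum, Finset.sum_mul]
    simp [mul_assoc]
  rw [Finset.sum_congr rfl fun h' _ => this h']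
  rw [Finset.sum_eq_single 1]
  · simp only [if_true, C_1, one_mul]
    exact (map_id q).symm
  · intro h _ hh
    simp [hh]
  · simp

end DescentOfPolynomials

section Minors

lemma unitEquiv_of_mul_eq_mul {A : Type} [CommRing A] {N : ℕ} {a b : Fin N → A}
    (h : ∀ i j, a i * b j = a j * b i) (ha : ∃ i, IsUnit (a i)) (hb : ∃ i, IsUnit (b i)) :
    unitEquiv a b := by
  obtain ⟨i, u, hu⟩ := ha
  obtain ⟨j, hj⟩ := hb
  have h1 : IsUnit (b i) := by
    have h2 : IsUnit (a j * b i) := by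
      rw [← h i j, ← hu]
      exact u.isUnit.mul hj
    exact (IsUnit.mul_iff.1 h2).2
  obtain ⟨v, hv⟩ := h1
  refine ⟨u⁻¹ * v, ?_⟩
  ext l
  have := h l i
  rw [← hu, ← hv] at this
  rw [Units.val_mul, mul_assoc, mul_comm (v : A), this, Units.inv_mul_cancel_left]

end Minors

section BaseChange

variable {k K A : Type} [Field k] [Field K] [Algebra k K] [CommRing A] [Algebra k A] [Algebra K A]
  [IsScalarTower k K A] {m n : ℕ}

lemma mem_ringPoints_image_map_iff {S : Set (MvPolynomial (Fin (n + 1)) k)} {a : Fin (n + 1) → A} :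
    a ∈ ringPoints K (map (algebraMap k K) '' S) A ↔ a ∈ ringPoints k S A := by
  simp only [ringPoints, Set.mem_setOf_eq, Set.forall_mem_image, map_map,
    ← IsScalarTower.algebraMap_eq]

lemma isImage_baseChange_iff {Φ : ChartMap k m n} {a : Fin (m + 1) → A} {x : Fin (n + 1) → A} :
    IsImage (Φ.baseChange (K := K)) a x ↔ IsImage Φ a x := by
  have : ∀ c, (Φ.baseChange (K := K)).evalVec c a = Φ.evalVec c a := fun c => by
    ext i
    simp only [ChartMap.evalVec, ChartMap.baseChange, map_map, ← IsScalarTower.algebraMap_eq]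
  simp only [IsImage]
  exact exists_congr fun c => by rw [this c]

lemma isHomogeneous_of_mem_image_map {S : Set (MvPolynomial (Fin (n + 1)) k)}
    (hS : ∀ f ∈ S, ∃ e, f.IsHomogeneous e) :
    ∀ f ∈ map (algebraMap k K) '' S, ∃ e, f.IsHomogeneous e := by
  rintro _ ⟨f, hf, rfl⟩
  obtain ⟨e, he⟩ := hS f hf
  exact ⟨e, he.map _⟩

end BaseChange

namespace TwistFrame

variable {k L : Type} [Field k] [Field L] [Algebra k L] [FiniteDimensional k L] {m n : ℕ}
  (F : TwistFrame k L m n) {A : Type} [CommRing A] [Algebra L A]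

section

open Classical in
/-- The factor by which the charts of the projection to the cover scale its points. -/
def factor (h : L ≃ₐ[k] L) (x : Fin (n + 1) → A) (ys : (L ≃ₐ[k] L) → Fin (m + 1) → A) (j : Fin (n + 1))
    (φ : (L ≃ₐ[k] L) → Fin (m + 1)) : A :=
  x j * ∏ g ∈ Finset.univ.erase h, ys g (φ (h⁻¹ * g))

open Classical in
/-- The charts of the projection from the twist to the cover and their conjugates. -/
def projVec (h : L ≃ₐ[k] L) (t : Fin (F.M + 1) → A) (j : Fin (n + 1))
    (φ : (L ≃ₐ[k] L) → Fin (m + 1)) : Fin (m + 1) → A :=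
  fun l => F.W h t j (Function.update φ 1 l)

lemma projVec_T (h : L ≃ₐ[k] L) (x : Fin (n + 1) → A) (ys : (L ≃ₐ[k] L) → Fin (m + 1) → A) (j φ) :
    F.projVec h (F.T x ys) j φ = factor h x ys j φ • ys h := by
  classical
  ext l
  rw [projVec, W_T, factor, Pi.smul_apply, smul_eq_mul, ← Finset.prod_erase_mul _ _ (Finset.mem_univ h),
    ← mul_assoc]
  congr 2
  · refine Finset.prod_congr (by ext; simp) fun g hg => ?_
    rw [Function.update_of_ne]
    rw [Ne, inv_mul_eq_one]
    exact fun hh => (Finset.mem_erase.1 hg).1 hh.symm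
  · simp

lemma W_smul (h : L ≃ₐ[k] L) (u : A) (t : Fin (F.M + 1) → A) (j φ) :
    F.W h (u • t) j φ = u * F.W h t j φ := by
  simp only [W, Pi.smul_apply, smul_eq_mul, Finset.mul_sum]
  exact Finset.sum_congr rfl fun _ _ => by ring

lemma projVec_smul (h : L ≃ₐ[k] L) (u : A) (t : Fin (F.M + 1) → A) (j φ) :
    F.projVec h (u • t) j φ = u • F.projVec h t j φ := by
  ext l
  simp [projVec, W_smul]

lemma exists_isUnit_T [IsLocalRing A] {x : Fin (n + 1) → A} {ys : (L ≃ₐ[k] L) → Fin (m + 1) → A}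
    (hx : ∃ j, IsUnit (x j)) (hys : ∀ g, ∃ l, IsUnit (ys g l)) : ∃ a, IsUnit (F.T x ys a) := by
  obtain ⟨j, hj⟩ := hx
  choose l hl using hys
  have h : IsUnit (F.W 1 (F.T x ys) j l) := by
    rw [W_T]
    refine hj.mul ?_
    simp only [inv_one, one_mul]
    exact Finset.prod_induction _ IsUnit (fun _ _ => IsUnit.mul) isUnit_one fun g _ => hl g
  by_contra! hcon
  refine (?_ : F.W 1 (F.T x ys) j l ∈ nonunits A) h
  rw [← IsLocalRing.mem_maximalIdeal]
  exact Ideal.sum_mem _ fun i _ => Ideal.mul_mem_left _ _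
    ((IsLocalRing.mem_maximalIdeal _).2 (hcon _))

lemma exists_isUnit_of_T [IsLocalRing A] {x : Fin (n + 1) → A}
    {ys : (L ≃ₐ[k] L) → Fin (m + 1) → A} (h : ∃ a, IsUnit (F.T x ys a)) :
    (∃ j, IsUnit (x j)) ∧ ∀ g, ∃ l, IsUnit (ys g l) := by
  obtain ⟨a, ha⟩ := h
  have : ∃ h : L ≃ₐ[k] L, IsUnit (x (F.e a).1 * ∏ g, ys g ((F.e a).2.2 (h⁻¹ * g))) := by
    by_contra! hcon
    refine (?_ : F.T x ys a ∈ nonunits A) ha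
    rw [← IsLocalRing.mem_maximalIdeal]
    exact Ideal.sum_mem _ fun i _ => Ideal.mul_mem_left _ _
      ((IsLocalRing.mem_maximalIdeal _).2 (hcon _))
  obtain ⟨h, hh⟩ := this
  rw [IsUnit.mul_iff] at hh
  refine ⟨⟨_, hh.1⟩, fun g => ⟨_, isUnit_of_dvd_unit (Finset.dvd_prod_of_mem
    (fun g => ys g ((F.e a).2.2 (h⁻¹ * g))) (Finset.mem_univ g)) hh.2⟩⟩

lemma exists_isUnit_W [IsGalois k L] [IsLocalRing A] {t : Fin (F.M + 1) → A}
    (h : ∃ a, IsUnit (t a)) : ∃ g j φ, IsUnit (F.W g t j φ) := by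
  obtain ⟨a, ha⟩ := h
  by_contra! hcon
  refine (?_ : t a ∈ nonunits A) ha
  rw [← F.e.symm_apply_apply a, F.apply_eq_sum_W t, ← IsLocalRing.mem_maximalIdeal]
  exact Ideal.sum_mem _ fun i _ => Ideal.mul_mem_left _ _
    ((IsLocalRing.mem_maximalIdeal _).2 (hcon _ _ _))

/-- The linear forms `W` as polynomials. -/
def WPoly (h : L ≃ₐ[k] L) (j : Fin (n + 1)) (φ : (L ≃ₐ[k] L) → Fin (m + 1)) :
    MvPolynomial (Fin (F.M + 1)) L :=
  F.W h X j φ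

lemma isHomogeneous_WPoly (h : L ≃ₐ[k] L) (j φ) : (F.WPoly h j φ).IsHomogeneous 1 :=
  IsHomogeneous.sum _ _ _ fun i _ => by
    simpa [algebraMap_eq] using (isHomogeneous_C (Fin (F.M + 1)) (h (F.bd i))).mul
      (isHomogeneous_X L (F.e.symm (j, i, φ)))

lemma aeval_WPoly (h : L ≃ₐ[k] L) (j φ) (t : Fin (F.M + 1) → A) :
    aeval t (F.WPoly h j φ) = F.W h t j φ := by
  rw [WPoly, ← W_map]
  congr 1
  ext i
  simp

lemma map_WPoly (g h : L ≃ₐ[k] L) (j φ) :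
    map (g : L →+* L) (F.WPoly h j φ) = F.WPoly (g * h) j φ := by
  simp [WPoly, W, algebraMap_eq, map_sum]

end

end TwistFrame

section Twist

variable {k L : Type} [Field k] [Field L] [Algebra k L] [FiniteDimensional k L] {m n : ℕ}

/-- `x` is the image of the point `a` of the cover, and `ys` are its translates. -/
def IsWitness (Φ : ChartMap k m n) (ρ : (L ≃ₐ[k] L) → ChartMap k m m)
    (SY : Set (MvPolynomial (Fin (m + 1)) k)) {A : Type} [CommRing A] [Algebra k A]
    (a : Fin (m + 1) → A) (x : Fin (n + 1) → A) (ys : (L ≃ₐ[k] L) → Fin (m + 1) → A) : Prop :=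
  a ∈ ringPoints k SY A ∧ IsImage Φ a x ∧ ∀ g, IsImage (ρ g) a (ys g)

/-- The equations of the twist of the cover `Φ` by the automorphisms `ρ`. -/
def TwistFrame.eqs (F : TwistFrame k L m n) (Φ : ChartMap k m n) (ρ : (L ≃ₐ[k] L) → ChartMap k m m)
    (SY : Set (MvPolynomial (Fin (m + 1)) k)) : Set (MvPolynomial (Fin (F.M + 1)) k) :=
  {f | (∃ e, f.IsHomogeneous e) ∧ ∀ (A : Type) [CommRing A] [IsLocalRing A] [Algebra k A]
    [Algebra L A] [IsScalarTower k L A] (a x ys), IsWitness Φ ρ SY (A := A) a x ys →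
      aeval (F.T x ys) f = 0}

/-- The automorphisms `ρ` of the cover `Φ` define a twist. -/
structure IsTwistSystem (Φ : ChartMap k m n) (ρ : (L ≃ₐ[k] L) → ChartMap k m m)
    (SY : Set (MvPolynomial (Fin (m + 1)) k)) (SX : Set (MvPolynomial (Fin (n + 1)) k)) : Prop where
  homY : ∀ f ∈ SY, ∃ e, f.IsHomogeneous e
  homX : ∀ f ∈ SX, ∃ e, f.IsHomogeneous e
  mor : IsChartMorphism k Φ SY SX
  morρ : ∀ g, IsChartMorphism k (ρ g) SY SY
  comm : ∀ (Ω : Type) [Field Ω] [Algebra k Ω], ∀ y ∈ ringPoints k SY Ω, ∀ g z x,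
    IsImage (ρ g) y z → IsImage Φ z x → IsImage Φ y x
  one : ∀ (Ω : Type) [Field Ω] [Algebra k Ω], ∀ y ∈ ringPoints k SY Ω, IsImage (ρ 1) y y
  mul : ∀ (Ω : Type) [Field Ω] [Algebra k Ω], ∀ y ∈ ringPoints k SY Ω, ∀ g h z w,
    IsImage (ρ h) y z → IsImage (ρ g) z w → IsImage (ρ (h * g)) y w

variable {Φ : ChartMap k m n} {ρ : (L ≃ₐ[k] L) → ChartMap k m m}
  {SY : Set (MvPolynomial (Fin (m + 1)) k)} {SX : Set (MvPolynomial (Fin (n + 1)) k)}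

namespace IsTwistSystem

variable (H : IsTwistSystem Φ ρ SY SX)
include H

lemma exists_isWitness {A : Type} [CommRing A] [IsLocalRing A] [Algebra k A] {a : Fin (m + 1) → A}
    (ha : a ∈ ringPoints k SY A) : ∃ x ys, IsWitness Φ ρ SY a x ys := by
  obtain ⟨x, hx⟩ := H.mor.exists_isImage ha
  choose ys hys using fun g => (H.morρ g).exists_isImage ha
  exact ⟨x, ys, ha, hx, hys⟩

end IsTwistSystem

namespace TwistFrame

variable (F : TwistFrame k L m n)

lemma homogeneous_eqs : ∀ f ∈ F.eqs Φ ρ SY, ∃ e, f.IsHomogeneous e := fun _ hf => hf.1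

lemma T_mem {A : Type} [CommRing A] [IsLocalRing A] [Algebra k A] [Algebra L A]
    [IsScalarTower k L A] {a : Fin (m + 1) → A} {x ys} (h : IsWitness Φ ρ SY a x ys) :
    F.T x ys ∈ ringPoints k (F.eqs Φ ρ SY) A := by
  refine ⟨F.exists_isUnit_T h.2.1.exists_isUnit fun g => (h.2.2 g).exists_isUnit, fun f hf => ?_⟩
  rw [eval_map_eq_aeval]
  exact hf.2 A a x ys h

lemma aeval_eq_zero_of_conj [IsGalois k L] {q : MvPolynomial (Fin (F.M + 1)) L} {e : ℕ}
    (hq : q.IsHomogeneous e)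
    (H : ∀ h : L ≃ₐ[k] L, ∀ (A : Type) [CommRing A] [IsLocalRing A] [Algebra k A]
    [Algebra L A] [IsScalarTower k L A] (a x ys), IsWitness Φ ρ SY (A := A) a x ys →
      aeval (F.T x ys) (map (h : L →+* L) q) = 0)
    {A : Type} [CommRing A] [Algebra k A] [Algebra L A] [IsScalarTower k L A]
    {z : Fin (F.M + 1) → A} (hz : z ∈ ringPoints k (F.eqs Φ ρ SY) A) : aeval z q = 0 := by
  rw [F.eq_sum_tracePoly q, map_sum]
  refine Finset.sum_eq_zero fun i _ => ?_
  rw [map_mul, aeval_map_algebraMap]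
  have : tracePoly (k := k) (F.b i) q ∈ F.eqs Φ ρ SY := by
    refine ⟨⟨e, isHomogeneous_tracePoly _ hq⟩, fun B _ _ _ _ _ a x ys hw => ?_⟩
    rw [← aeval_map_algebraMap (A := L), map_tracePoly, map_sum]
    refine Finset.sum_eq_zero fun h _ => ?_
    rw [map_mul, H h B a x ys hw, mul_zero]
  have h := hz.2 _ this
  rw [eval_map_eq_aeval] at h
  rw [h, mul_zero]

open Classical in
/-- The projection from the twist to the base. -/
def toBase : ChartMap k F.M n :=
  .ofFintype (Fin F.r × ((L ≃ₐ[k] L) → Fin (m + 1))) (fun c j => X (F.e.symm (j, c))) (fun _ => 1)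
    fun _ _ => isHomogeneous_X _ _

lemma isImage_toBase_iff {A : Type} [CommRing A] [Algebra k A] {z : Fin (F.M + 1) → A}
    {x : Fin (n + 1) → A} : IsImage F.toBase z x ↔ ∃ c, (∃ j, IsUnit (z (F.e.symm (j, c)))) ∧
      unitEquiv (fun j => z (F.e.symm (j, c))) x := by
  classical
  refine (ChartMap.exists_ofFintype (a := z) (P := fun v : Fin (n + 1) → A => (∃ j, IsUnit (v j)) ∧ unitEquiv v x)).trans ?_
  simp

lemma T_apply_symm {A : Type} [CommRing A] [Algebra L A] (x : Fin (n + 1) → A)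
    (ys : (L ≃ₐ[k] L) → Fin (m + 1) → A) (c) :
    ∃ u : A, (fun j => F.T x ys (F.e.symm (j, c))) = u • x := by
  refine ⟨∑ h : L ≃ₐ[k] L, algebraMap L A (h (F.b c.1)) * ∏ g, ys g (c.2 (h⁻¹ * g)), ?_⟩
  ext j
  simp only [T, Equiv.apply_symm_apply, Pi.smul_apply, smul_eq_mul, Finset.sum_mul]
  exact Finset.sum_congr rfl fun h _ => by ring

lemma isImage_toBase_T {A : Type} [CommRing A] [IsLocalRing A] [Algebra k A] [Algebra L A]
    {x : Fin (n + 1) → A} {ys : (L ≃ₐ[k] L) → Fin (m + 1) → A} (h : ∃ a, IsUnit (F.T x ys a)) :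
    IsImage F.toBase (F.T x ys) x := by
  rw [isImage_toBase_iff]
  obtain ⟨a, ha⟩ := h
  rw [← F.e.symm_apply_apply a] at ha
  obtain ⟨u, hu⟩ := F.T_apply_symm x ys (F.e a).2
  refine ⟨(F.e a).2, ⟨(F.e a).1, ha⟩, ?_⟩
  have hau : IsUnit (u * x (F.e a).1) := by
    convert ha using 1
    exact (congrFun hu (F.e a).1).symm
  rw [hu]
  obtain ⟨u, rfl⟩ := (IsUnit.mul_iff.1 hau).1
  exact unitEquiv.symm ⟨u, rfl⟩

/-- The projection from the twist to the base is a morphism. -/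
lemma isChartMorphism_toBase (H : IsTwistSystem Φ ρ SY SX) :
    IsChartMorphism k F.toBase (F.eqs Φ ρ SY) SX := by
  rw [isChartMorphism_iff H.homX]
  intro A _ _ _ z hz
  simp only [isImage_toBase_iff]
  refine ⟨?_, ?_, ?_⟩
  · obtain ⟨a, ha⟩ := hz.1
    rw [← F.e.symm_apply_apply a] at ha
    exact ⟨_, (F.e a).2, ⟨(F.e a).1, ha⟩, .refl _⟩
  · rintro x x' ⟨c, ⟨j, hj⟩, h⟩ ⟨c', ⟨j', hj'⟩, h'⟩
    refine h.symm.trans (unitEquiv.trans ?_ h')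
    have key : ∀ i i', z (F.e.symm (i, c)) * z (F.e.symm (i', c')) =
        z (F.e.symm (i', c)) * z (F.e.symm (i, c')) := by
      intro i i'
      have : X (F.e.symm (i, c)) * X (F.e.symm (i', c')) -
          X (F.e.symm (i', c)) * X (F.e.symm (i, c')) ∈ F.eqs Φ ρ SY := by
        refine ⟨⟨2, ?_⟩, fun B _ _ _ _ _ a x ys hw => ?_⟩
        · exact ((isHomogeneous_X _ _).mul (isHomogeneous_X _ _)).sub
            ((isHomogeneous_X _ _).mul (isHomogeneous_X _ _))
        · obtain ⟨u, hu⟩ := F.T_apply_symm x ys c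
          obtain ⟨u', hu'⟩ := F.T_apply_symm x ys c'
          simp only [map_sub, map_mul, aeval_X, funext_iff, Pi.smul_apply, smul_eq_mul] at hu hu' ⊢
          rw [hu, hu, hu', hu']
          ring
      have := hz.2 _ this
      rw [eval_map_eq_aeval] at this
      simpa [sub_eq_zero] using this
    exact unitEquiv_of_mul_eq_mul key ⟨j, hj⟩ ⟨j', hj'⟩
  · rintro x ⟨c, hc, h⟩
    refine mem_ringPoints_of_unitEquiv H.homX h ⟨hc, fun f hf => ?_⟩
    obtain ⟨e, he⟩ := H.homX f hf
    have : aeval (fun j => X (F.e.symm (j, c))) f ∈ F.eqs Φ ρ SY := by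
      refine ⟨⟨1 * e, he.aeval _ fun _ => isHomogeneous_X _ _⟩, fun B _ _ _ _ _ a x ys hw => ?_⟩
      rw [comp_aeval_apply]
      obtain ⟨u, hu⟩ := F.T_apply_symm x ys c
      simp only [aeval_X]
      rw [hu, ← eval_map_eq_aeval, (he.map _).eval_smul',
        (H.mor.mem_of_isImage H.homX hw.1 hw.2.1).2 f hf, mul_zero]
    have := hz.2 _ this
    rw [eval_map_eq_aeval, comp_aeval_apply] at this
    rw [eval_map_eq_aeval]
    simpa only [aeval_X] using this

end TwistFrame

end Twist

namespace TwistFrame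

variable {k L : Type} [Field k] [Field L] [Algebra k L] [FiniteDimensional k L] {m n : ℕ}
  {Φ : ChartMap k m n} {ρ : (L ≃ₐ[k] L) → ChartMap k m m}
  {SY : Set (MvPolynomial (Fin (m + 1)) k)} {SX : Set (MvPolynomial (Fin (n + 1)) k)}
  (F : TwistFrame k L m n)

section Projection

variable {A : Type} [CommRing A] [Algebra L A]

/-- `y` is a coordinate vector of the point of the cover corresponding to `z`. -/
def IsProj (z : Fin (F.M + 1) → A) (y : Fin (m + 1) → A) : Prop :=
  ∃ c : Fin (n + 1) × ((L ≃ₐ[k] L) → Fin (m + 1)),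
    (∃ l, IsUnit (F.projVec 1 z c.1 c.2 l)) ∧ unitEquiv (F.projVec 1 z c.1 c.2) y

open Classical in
/-- The charts of the projection to the cover as polynomials. -/
def projPoly (h : L ≃ₐ[k] L) (j : Fin (n + 1)) (φ : (L ≃ₐ[k] L) → Fin (m + 1)) (l : Fin (m + 1)) :
    MvPolynomial (Fin (F.M + 1)) L :=
  F.WPoly h j (Function.update φ 1 l)

lemma isHomogeneous_projPoly (h : L ≃ₐ[k] L) (j φ l) : (F.projPoly h j φ l).IsHomogeneous 1 :=
  F.isHomogeneous_WPoly _ _ _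

lemma aeval_projPoly (h : L ≃ₐ[k] L) (j φ l) (t : Fin (F.M + 1) → A) :
    aeval t (F.projPoly h j φ l) = F.projVec h t j φ l :=
  F.aeval_WPoly _ _ _ _

lemma map_projPoly (g h : L ≃ₐ[k] L) (j φ l) :
    map (g : L →+* L) (F.projPoly h j φ l) = F.projPoly (g * h) j φ l :=
  F.map_WPoly _ _ _ _

lemma isProj_T [IsLocalRing A] {x : Fin (n + 1) → A} {ys : (L ≃ₐ[k] L) → Fin (m + 1) → A}
    (hx : ∃ j, IsUnit (x j)) (hys : ∀ g, ∃ l, IsUnit (ys g l)) : F.IsProj (F.T x ys) (ys 1) := by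
  obtain ⟨j, hj⟩ := hx
  choose l hl using hys
  have hu : IsUnit (factor 1 x ys j l) := by
    refine hj.mul ?_
    simp only [inv_one, one_mul]
    exact Finset.prod_induction _ IsUnit (fun _ _ => IsUnit.mul) isUnit_one fun g _ => hl g
  have : F.projVec 1 (F.T x ys) j l = factor 1 x ys j l • ys 1 := F.projVec_T _ _ _ _ _
  refine ⟨(j, l), ⟨l 1, ?_⟩, ?_⟩
  · rw [this]
    exact hu.mul (hl 1)
  · rw [this]
    obtain ⟨u, hu⟩ := hu
    rw [← hu]
    exact unitEquiv.symm ⟨u, rfl⟩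

lemma IsProj.congr_right {z : Fin (F.M + 1) → A} {y y' : Fin (m + 1) → A} (h : F.IsProj z y)
    (h' : unitEquiv y y') : F.IsProj z y' := by
  obtain ⟨c, hc, h⟩ := h
  exact ⟨c, hc, h.trans h'⟩

lemma IsProj.congr_left {z z' : Fin (F.M + 1) → A} {y : Fin (m + 1) → A} (h : F.IsProj z y)
    (h' : unitEquiv z z') : F.IsProj z' y := by
  obtain ⟨c, hc, h⟩ := h
  obtain ⟨u, rfl⟩ := h'
  have : unitEquiv (F.projVec 1 z c.1 c.2) (F.projVec 1 ((u : A) • z) c.1 c.2) := by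
    rw [projVec_smul]
    exact ⟨u, rfl⟩
  exact ⟨c, this.exists_isUnit hc, this.symm.trans h⟩

variable [IsGalois k L] [Algebra k A] [IsScalarTower k L A]

lemma exists_isProj [IsLocalRing A] {z : Fin (F.M + 1) → A}
    (hz : z ∈ ringPoints k (F.eqs Φ ρ SY) A) : ∃ y, F.IsProj z y := by
  classical
  obtain ⟨h, j, φ, hu⟩ := F.exists_isUnit_W hz.1
  have key : F.W h z j φ = F.W 1 z j (fun g => φ (h⁻¹ * g)) := by
    have := F.aeval_eq_zero_of_conj (Φ := Φ) (ρ := ρ) (SY := SY)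
      ((F.isHomogeneous_WPoly h j φ).sub (F.isHomogeneous_WPoly 1 j (fun g => φ (h⁻¹ * g))))
      (fun g B _ _ _ _ _ a x ys hw => by
        rw [map_sub, map_sub, map_WPoly, map_WPoly, aeval_WPoly, aeval_WPoly, W_T, W_T, sub_eq_zero]
        simp [mul_assoc]) hz
    rwa [map_sub, aeval_WPoly, aeval_WPoly, sub_eq_zero] at this
  rw [key] at hu
  refine ⟨_, (j, fun g => φ (h⁻¹ * g)), ⟨φ (h⁻¹ * 1), ?_⟩, .refl _⟩
  have : Function.update (fun g => φ (h⁻¹ * g)) 1 (φ (h⁻¹ * 1)) = fun g => φ (h⁻¹ * g) := by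
    simp
  rwa [projVec, this]

lemma IsProj.unitEquiv {z : Fin (F.M + 1) → A}
    (hz : z ∈ ringPoints k (F.eqs Φ ρ SY) A) {y y' : Fin (m + 1) → A} (h : F.IsProj z y)
    (h' : F.IsProj z y') : unitEquiv y y' := by
  obtain ⟨c, hc, h⟩ := h
  obtain ⟨c', hc', h'⟩ := h'
  refine h.symm.trans (.trans (unitEquiv_of_mul_eq_mul (fun l l' => ?_) hc hc') h')
  have := F.aeval_eq_zero_of_conj (Φ := Φ) (ρ := ρ) (SY := SY)
    (((F.isHomogeneous_projPoly 1 c.1 c.2 l).mul (F.isHomogeneous_projPoly 1 c'.1 c'.2 l')).sub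
      ((F.isHomogeneous_projPoly 1 c.1 c.2 l').mul (F.isHomogeneous_projPoly 1 c'.1 c'.2 l)))
    (fun g B _ _ _ _ _ a x ys hw => by
      simp only [map_sub, map_mul, map_projPoly, aeval_projPoly, projVec_T, Pi.smul_apply,
        smul_eq_mul]
      ring) hz
  simpa only [map_sub, map_mul, aeval_projPoly, sub_eq_zero] using this

lemma IsProj.mem (H : IsTwistSystem Φ ρ SY SX) {z : Fin (F.M + 1) → A}
    (hz : z ∈ ringPoints k (F.eqs Φ ρ SY) A) {y : Fin (m + 1) → A} (h : F.IsProj z y) :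
    y ∈ ringPoints k SY A := by
  obtain ⟨c, hc, h⟩ := h
  refine mem_ringPoints_of_unitEquiv H.homY h ⟨hc, fun f hf => ?_⟩
  obtain ⟨e, he⟩ := H.homY f hf
  have hmap : ∀ g : L ≃ₐ[k] L, map (g : L →+* L) (aeval (F.projPoly 1 c.1 c.2) f) =
      aeval (F.projPoly g c.1 c.2) f := by
    intro g
    rw [show map (g : L →+* L) (aeval (F.projPoly 1 c.1 c.2) f) = mapAlgHom (g : L →ₐ[k] L)
      (aeval (F.projPoly 1 c.1 c.2) f) from rfl, comp_aeval_apply]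
    congr 2
    ext l : 1
    have := F.map_projPoly g 1 c.1 c.2 l
    rw [mul_one] at this
    exact this
  have hev : ∀ (B : Type) [CommRing B] [Algebra k B] [Algebra L B] [IsScalarTower k L B]
      (g : L ≃ₐ[k] L) (t : Fin (F.M + 1) → B), aeval t (aeval (F.projPoly g c.1 c.2) f) =
        aeval (F.projVec g t c.1 c.2) f := by
    intro B _ _ _ _ g t
    rw [show aeval t (aeval (F.projPoly g c.1 c.2) f) = ((aeval t :
      MvPolynomial _ L →ₐ[L] B).restrictScalars k) (aeval (F.projPoly g c.1 c.2) f) from rfl,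
      comp_aeval_apply]
    congr 2
    ext l : 1
    exact F.aeval_projPoly _ _ _ _ _
  have := F.aeval_eq_zero_of_conj (Φ := Φ) (ρ := ρ) (SY := SY) (e := 1 * e)
    (q := aeval (F.projPoly 1 c.1 c.2) f)
    (he.aeval _ fun l => F.isHomogeneous_projPoly _ _ _ _)
    (fun g B _ _ _ _ _ a x ys hw => by
      rw [hmap, hev, projVec_T, ← eval_map_eq_aeval, (he.map _).eval_smul',
        ((H.morρ g).mem_of_isImage H.homY hw.1 (hw.2.2 g)).2 f hf, mul_zero]) hz
  rw [hev] at this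
  rw [eval_map_eq_aeval, this]

end Projection

section Morphisms

variable (K : Type) [Field K] [Algebra L K]

open Classical in
/-- The projection from the twist to the cover over a splitting field. -/
def toCover : ChartMap K F.M m :=
  .ofFintype (Fin (n + 1) × ((L ≃ₐ[k] L) → Fin (m + 1)))
    (fun c l => map (algebraMap L K) (F.projPoly 1 c.1 c.2 l)) (fun _ => 1)
    fun _ _ => (F.isHomogeneous_projPoly _ _ _ _).map _

variable {K} in
lemma isImage_toCover_iff {A : Type} [CommRing A] [Algebra K A] [Algebra L A] [IsScalarTower L K A]
    {z : Fin (F.M + 1) → A} {y : Fin (m + 1) → A} : IsImage (F.toCover K) z y ↔ F.IsProj z y := by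
  classical
  refine (ChartMap.exists_ofFintype (a := z)
    (P := fun v : Fin (m + 1) → A => (∃ j, IsUnit (v j)) ∧ unitEquiv v y)).trans ?_
  refine exists_congr fun c => ?_
  have : (fun i => eval z (map (algebraMap K A) (map (algebraMap L K)
      (F.projPoly 1 c.1 c.2 i)))) = F.projVec 1 z c.1 c.2 := by
    ext l
    rw [map_map, ← IsScalarTower.algebraMap_eq, eval_map_eq_aeval, aeval_projPoly]
  rw [this]

lemma isChartMorphism_toCover [IsGalois k L] [Algebra k K] [IsScalarTower k L K]
    (H : IsTwistSystem Φ ρ SY SX) : IsChartMorphism K (F.toCover K)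
      (map (algebraMap k K) '' F.eqs Φ ρ SY) (map (algebraMap k K) '' SY) := by
  rw [isChartMorphism_iff (isHomogeneous_of_mem_image_map H.homY)]
  intro A _ _ _ z hz
  letI : Algebra L A := Algebra.compHom A (algebraMap L K)
  letI : Algebra k A := Algebra.compHom A (algebraMap k K)
  haveI : IsScalarTower L K A := .of_algebraMap_eq fun _ => rfl
  haveI : IsScalarTower k K A := .of_algebraMap_eq fun _ => rfl
  haveI : IsScalarTower k L A := .to₁₂₄ k L K A
  simp only [isImage_toCover_iff, mem_ringPoints_image_map_iff] at hz ⊢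
  exact ⟨F.exists_isProj hz, fun y y' h h' => h.unitEquiv F hz h', fun y h => h.mem F H hz⟩

variable (Φ ρ) in
/-- The polynomials parametrizing the twist by the cover, in terms of given charts. -/
def paramPoly (c : Fin Φ.numCharts × ∀ g, Fin (ρ g).numCharts) (i : Fin (F.M + 1)) :
    MvPolynomial (Fin (m + 1)) L :=
  F.T (fun j => map (algebraMap k L) (Φ.F c.1 j))
    (fun g l => map (algebraMap k L) ((ρ g).F (c.2 g) l)) i

lemma isHomogeneous_paramPoly (c : Fin Φ.numCharts × ∀ g, Fin (ρ g).numCharts) (i) :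
    (F.paramPoly Φ ρ c i).IsHomogeneous (Φ.deg c.1 + ∑ g, (ρ g).deg (c.2 g)) := by
  refine IsHomogeneous.sum _ _ _ fun h _ => ?_
  have := (isHomogeneous_C (Fin (m + 1)) (h (F.b (F.e i).2.1))).mul
    (((Φ.homog c.1 (F.e i).1).map (algebraMap k L)).mul (IsHomogeneous.prod Finset.univ _ _
      fun g _ => ((ρ g).homog (c.2 g) ((F.e i).2.2 (h⁻¹ * g))).map (algebraMap k L)))
  rw [zero_add] at this
  exact this

variable {K} in
lemma aeval_paramPoly {A : Type} [CommRing A] [Algebra k A] [Algebra L A] [IsScalarTower k L A]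
    (c : Fin Φ.numCharts × ∀ g, Fin (ρ g).numCharts) (a : Fin (m + 1) → A) :
    (fun i => aeval a (F.paramPoly Φ ρ c i)) =
      F.T (Φ.evalVec c.1 a) (fun g => (ρ g).evalVec (c.2 g) a) := by
  have h := F.T_map (aeval a : MvPolynomial (Fin (m + 1)) L →ₐ[L] A)
    (fun j => map (algebraMap k L) (Φ.F c.1 j))
    (fun g l => map (algebraMap k L) ((ρ g).F (c.2 g) l))
  refine h.symm.trans ?_
  congr 1
  · ext j
    simp [ChartMap.evalVec_apply, aeval_map_algebraMap]
  · ext g l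
    simp [ChartMap.evalVec_apply, aeval_map_algebraMap]

open Classical in
variable (Φ ρ) in
/-- The morphism from the cover to the twist over a splitting field. -/
def fromCover : ChartMap K m F.M :=
  .ofFintype (Fin Φ.numCharts × ∀ g, Fin (ρ g).numCharts)
    (fun c i => map (algebraMap L K) (F.paramPoly Φ ρ c i)) _
    fun c i => (F.isHomogeneous_paramPoly c i).map _

variable {K}

lemma isImage_fromCover_iff {A : Type} [CommRing A] [IsLocalRing A] [Algebra K A] [Algebra L A]
    [IsScalarTower L K A] [Algebra k A] [IsScalarTower k L A]
    {a : Fin (m + 1) → A} {t : Fin (F.M + 1) → A} : IsImage (F.fromCover Φ ρ K) a t ↔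
      ∃ x ys, IsImage Φ a x ∧ (∀ g, IsImage (ρ g) a (ys g)) ∧ unitEquiv (F.T x ys) t := by
  classical
  refine (ChartMap.exists_ofFintype (a := a)
    (P := fun v : Fin (F.M + 1) → A => (∃ j, IsUnit (v j)) ∧ unitEquiv v t)).trans ?_
  have : ∀ c, (fun i => eval a (map (algebraMap K A) (map (algebraMap L K)
      (F.paramPoly Φ ρ c i)))) = F.T (Φ.evalVec c.1 a) (fun g => (ρ g).evalVec (c.2 g) a) := by
    intro c
    rw [← aeval_paramPoly]
    ext l
    rw [map_map, ← IsScalarTower.algebraMap_eq, eval_map_eq_aeval]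
  simp only [this, fun c i => congrFun (this c) i]
  constructor
  · rintro ⟨c, hc, h⟩
    have := F.exists_isUnit_of_T hc
    exact ⟨_, _, ⟨_, this.1, .refl _⟩, fun g => ⟨_, this.2 g, .refl _⟩, h⟩
  · rintro ⟨x, ys, ⟨c, hc, u, rfl⟩, hys, h⟩
    choose cg hcg v hv using hys
    refine ⟨⟨c, cg⟩, F.exists_isUnit_T hc hcg, .trans ⟨u * ∏ g, v g, ?_⟩ h⟩
    rw [show ys = fun g => (v g : A) • (ρ g).evalVec (cg g) a from funext hv]
    rw [show (fun i => (u : A) * Φ.evalVec c a i) = (u : A) • Φ.evalVec c a from rfl, F.T_smul]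
    simp only [Units.val_mul, Units.coe_prod]
    rfl

lemma isChartMorphism_fromCover [Algebra k K] [IsScalarTower k L K]
    (H : IsTwistSystem Φ ρ SY SX) : IsChartMorphism K (F.fromCover Φ ρ K)
      (map (algebraMap k K) '' SY) (map (algebraMap k K) '' F.eqs Φ ρ SY) := by
  rw [isChartMorphism_iff (isHomogeneous_of_mem_image_map F.homogeneous_eqs)]
  intro A _ _ _ a ha
  letI : Algebra L A := Algebra.compHom A (algebraMap L K)
  letI : Algebra k A := Algebra.compHom A (algebraMap k K)
  haveI : IsScalarTower L K A := .of_algebraMap_eq fun _ => rfl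
  haveI : IsScalarTower k K A := .of_algebraMap_eq fun _ => rfl
  haveI : IsScalarTower k L A := .to₁₂₄ k L K A
  simp only [isImage_fromCover_iff, mem_ringPoints_image_map_iff] at ha ⊢
  refine ⟨?_, ?_, ?_⟩
  · obtain ⟨x, ys, hw⟩ := H.exists_isWitness ha
    exact ⟨_, x, ys, hw.2.1, hw.2.2, .refl _⟩
  · rintro t t' ⟨x, ys, hx, hys, h⟩ ⟨x', ys', hx', hys', h'⟩
    refine h.symm.trans (.trans ?_ h')
    obtain ⟨u, rfl⟩ := H.mor.unitEquiv_of_isImage ha hx hx'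
    choose v hv using fun g => (H.morρ g).unitEquiv_of_isImage ha (hys g) (hys' g)
    rw [show ys' = fun g => (v g : A) • ys g from funext hv,
      show (fun i => (u : A) * x i) = (u : A) • x from rfl, F.T_smul]
    refine ⟨u * ∏ g, v g, ?_⟩
    simp only [Units.val_mul, Units.coe_prod]
    rfl
  · rintro t ⟨x, ys, hx, hys, h⟩
    exact mem_ringPoints_of_unitEquiv F.homogeneous_eqs h (F.T_mem ⟨ha, hx, hys⟩)

end Morphisms

end TwistFrame

section

variable {k : Type} [Field k]

lemma MvPolynomial.IsHomogeneous.aeval_smul' {ι A : Type*} [CommRing A] [Algebra k A]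
    {f : MvPolynomial ι k} {e : ℕ} (hf : f.IsHomogeneous e) (u : A) (a : ι → A) :
    MvPolynomial.aeval (u • a) f = u ^ e * MvPolynomial.aeval a f := by
  rw [← eval_map_eq_aeval, (hf.map _).eval_smul', eval_map_eq_aeval]

end

namespace TwistFrame

variable {k L : Type} [Field k] [Field L] [Algebra k L] [FiniteDimensional k L] {m n : ℕ}
  {Φ : ChartMap k m n} {ρ : (L ≃ₐ[k] L) → ChartMap k m m}
  {SY : Set (MvPolynomial (Fin (m + 1)) k)} {SX : Set (MvPolynomial (Fin (n + 1)) k)}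
  (F : TwistFrame k L m n)

lemma unitEquiv_T {A : Type} [CommRing A] [Algebra L A] {x x' : Fin (n + 1) → A}
    {ys ys' : (L ≃ₐ[k] L) → Fin (m + 1) → A} (hx : unitEquiv x x')
    (hys : ∀ g, unitEquiv (ys g) (ys' g)) : unitEquiv (F.T x ys) (F.T x' ys') := by
  obtain ⟨u, rfl⟩ := hx
  choose v hv using hys
  rw [show ys' = fun g => (v g : A) • ys g from funext hv,
    show (fun i => (u : A) * x i) = (u : A) • x from rfl, F.T_smul]
  refine ⟨u * ∏ g, v g, ?_⟩
  simp only [Units.val_mul, Units.coe_prod]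
  rfl

lemma unitEquiv_T_of_isWitness (H : IsTwistSystem Φ ρ SY SX) {A : Type} [CommRing A]
    [IsLocalRing A] [Algebra k A] [Algebra L A] {a : Fin (m + 1) → A} {x x' : Fin (n + 1) → A}
    {ys ys' : (L ≃ₐ[k] L) → Fin (m + 1) → A} (h : IsWitness Φ ρ SY a x ys)
    (h' : IsWitness Φ ρ SY a x' ys') : unitEquiv (F.T x ys) (F.T x' ys') :=
  F.unitEquiv_T (H.mor.unitEquiv_of_isImage h.1 h.2.1 h'.2.1)
    fun g => (H.morρ g).unitEquiv_of_isImage h.1 (h.2.2 g) (h'.2.2 g)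

lemma aeval_aeval_paramPoly {A : Type} [CommRing A] [Algebra k A] [Algebra L A]
    [IsScalarTower k L A] (c : Fin Φ.numCharts × ∀ g, Fin (ρ g).numCharts) (a : Fin (m + 1) → A)
    (f : MvPolynomial (Fin (F.M + 1)) k) :
    aeval a (aeval (F.paramPoly Φ ρ c) f) =
      aeval (F.T (Φ.evalVec c.1 a) (fun g => (ρ g).evalVec (c.2 g) a)) f := by
  rw [← aeval_paramPoly]
  exact comp_aeval_apply _ ((aeval a : MvPolynomial _ L →ₐ[L] A).restrictScalars k) f

/-- In a given chart, the parametrization of the twist yields a multiple of its points. -/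
lemma exists_smul_T (H : IsTwistSystem Φ ρ SY SX) {Ω : Type} [Field Ω] [Algebra k Ω] [Algebra L Ω]
    {a : Fin (m + 1) → Ω} {x : Fin (n + 1) → Ω} {ys : (L ≃ₐ[k] L) → Fin (m + 1) → Ω}
    (h : IsWitness Φ ρ SY a x ys) (c : Fin Φ.numCharts × ∀ g, Fin (ρ g).numCharts) :
    ∃ u : Ω, F.T (Φ.evalVec c.1 a) (fun g => (ρ g).evalVec (c.2 g) a) = u • F.T x ys := by
  by_cases h0 : F.T (Φ.evalVec c.1 a) (fun g => (ρ g).evalVec (c.2 g) a) = 0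
  · exact ⟨0, by rw [h0, zero_smul]⟩
  · have := F.exists_isUnit_of_T (exists_isUnit_iff_ne_zero.2 h0)
    obtain ⟨u, hu⟩ := F.unitEquiv_T_of_isWitness H h
      ⟨h.1, ⟨_, this.1, .refl _⟩, fun g => ⟨_, this.2 g, .refl _⟩⟩
    exact ⟨u, hu⟩

variable (k) in
/-- The polynomial which does not vanish where given coordinates of given charts are invertible. -/
def domainPoly (Φ : ChartMap k m n) (ρ : (L ≃ₐ[k] L) → ChartMap k m m)
    (τ : Fin (m + 1) × (Fin Φ.numCharts × ∀ g, Fin (ρ g).numCharts) × Fin (n + 1) ×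
      ((L ≃ₐ[k] L) → Fin (m + 1))) : MvPolynomial (Fin (m + 1)) k :=
  X τ.1 * (Φ.F τ.2.1.1 τ.2.2.1 * ∏ g, (ρ g).F (τ.2.1.2 g) (τ.2.2.2 g))

lemma aeval_domainPoly {A : Type} [CommRing A] [Algebra k A] (τ) (a : Fin (m + 1) → A) :
    aeval a (domainPoly k Φ ρ τ) = a τ.1 * (Φ.evalVec τ.2.1.1 a τ.2.2.1 *
      ∏ g, (ρ g).evalVec (τ.2.1.2 g) a (τ.2.2.2 g)) := by
  simp [domainPoly, ChartMap.evalVec_apply, map_prod]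

lemma isWitness_of_aeval_domainPoly {Ω : Type} [Field Ω] [Algebra k Ω] {τ} {a : Fin (m + 1) → Ω}
    (ha : ∀ f ∈ SY, aeval a f = 0) (h : aeval a (domainPoly k Φ ρ τ) ≠ 0) :
    IsWitness Φ ρ SY a (Φ.evalVec τ.2.1.1 a) (fun g => (ρ g).evalVec (τ.2.1.2 g) a) := by
  rw [aeval_domainPoly, mul_ne_zero_iff, mul_ne_zero_iff, Finset.prod_ne_zero_iff] at h
  refine ⟨⟨⟨_, isUnit_iff_ne_zero.2 h.1⟩, fun f hf => ?_⟩, ⟨_, ⟨_, isUnit_iff_ne_zero.2 h.2.1⟩,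
    .refl _⟩, fun g => ⟨_, ⟨_, isUnit_iff_ne_zero.2 (h.2.2 g (Finset.mem_univ g))⟩, .refl _⟩⟩
  rw [eval_map_eq_aeval, ha f hf]

lemma exists_isUnit_aeval_domainPoly {A : Type} [CommRing A] [Algebra k A]
    {a : Fin (m + 1) → A} {x : Fin (n + 1) → A} {ys : (L ≃ₐ[k] L) → Fin (m + 1) → A}
    (h : IsWitness Φ ρ SY a x ys) : ∃ τ, IsUnit (aeval a (domainPoly k Φ ρ τ)) ∧
      IsWitness Φ ρ SY a (Φ.evalVec τ.2.1.1 a) (fun g => (ρ g).evalVec (τ.2.1.2 g) a) := by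
  obtain ⟨ha, ⟨c, ⟨j, hj⟩, -⟩, h⟩ := h
  have ha' := ha
  obtain ⟨⟨l0, hl0⟩, -⟩ := ha'
  choose cg hcg _ using h
  choose l hl using hcg
  refine ⟨(l0, (c, cg), j, l), ?_, ha, ⟨c, ⟨j, hj⟩, .refl _⟩, fun g => ⟨_, ⟨l g, hl g⟩, .refl _⟩⟩
  rw [aeval_domainPoly]
  exact hl0.mul (hj.mul (Finset.prod_induction _ IsUnit (fun _ _ => IsUnit.mul) isUnit_one
    fun g _ => hl g))

/-- A form vanishing on all geometric points of the twist has a power among its equations. -/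
lemma exists_pow_mem_eqs (H : IsTwistSystem Φ ρ SY SX) {f : MvPolynomial (Fin (F.M + 1)) k} {e : ℕ}
    (hf : f.IsHomogeneous e)
    (hfv : ∀ (Ω : Type) [Field Ω] [Algebra k Ω] [Algebra L Ω] [IsScalarTower k L Ω] (a x ys),
      IsWitness Φ ρ SY (A := Ω) a x ys → aeval (F.T x ys) f = 0) :
    ∃ N, f ^ N ∈ F.eqs Φ ρ SY := by
  classical
  have key : ∀ τ, ∃ N, (aeval (F.paramPoly Φ ρ τ.2.1) f *
      map (algebraMap k L) (domainPoly k Φ ρ τ)) ^ N ∈ Ideal.span (map (algebraMap k L) '' SY) := by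
    intro τ
    rw [← Ideal.mem_radical_iff, ← vanishingIdeal_zeroLocus_eq_radical (K := AlgebraicClosure L),
      mem_vanishingIdeal_iff]
    intro b hb
    rw [zeroLocus_span] at hb
    rw [map_mul, aeval_map_algebraMap, aeval_aeval_paramPoly]
    by_cases h0 : aeval b (domainPoly k Φ ρ τ) = 0
    · rw [h0, mul_zero]
    · rw [hfv _ _ _ _ (isWitness_of_aeval_domainPoly (fun f hf => ?_) h0), zero_mul]
      have := hb _ ⟨f, hf, rfl⟩
      rwa [aeval_map_algebraMap] at this
  choose N hN using key
  refine ⟨∑ τ, N τ, ⟨_, hf.pow _⟩, fun A _ _ _ _ _ a x ys hw => ?_⟩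
  obtain ⟨τ, hu, hw'⟩ := exists_isUnit_aeval_domainPoly hw
  have h0 : aeval a (aeval (F.paramPoly Φ ρ τ.2.1) f) ^ N τ = 0 := by
    have h1 : aeval a ((aeval (F.paramPoly Φ ρ τ.2.1) f *
        map (algebraMap k L) (domainPoly k Φ ρ τ)) ^ N τ) = 0 := by
      have hle : Ideal.span (map (algebraMap k L) '' SY) ≤
          RingHom.ker (aeval a : MvPolynomial (Fin (m + 1)) L →ₐ[L] A) := by
        rw [Ideal.span_le]
        rintro _ ⟨f, hf, rfl⟩
        rw [SetLike.mem_coe, RingHom.mem_ker, aeval_map_algebraMap, ← eval_map_eq_aeval]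
        exact hw.1.2 f hf
      exact hle (hN τ)
    rw [map_pow, map_mul, aeval_map_algebraMap, mul_pow] at h1
    exact (hu.pow _).mul_left_eq_zero.1 h1
  obtain ⟨u, hu⟩ := F.unitEquiv_T_of_isWitness H hw' hw
  rw [hu, show (fun i => (u : A) * F.T (Φ.evalVec τ.2.1.1 a) (fun g => (ρ g).evalVec (τ.2.1.2 g) a) i)
    = (u : A) • F.T (Φ.evalVec τ.2.1.1 a) (fun g => (ρ g).evalVec (τ.2.1.2 g) a) from rfl, map_pow,
    hf.aeval_smul', mul_pow, ← aeval_aeval_paramPoly,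
    pow_eq_zero_of_le (Finset.single_le_sum (fun _ _ => Nat.zero_le _) (Finset.mem_univ τ)) h0,
    mul_zero]

/-- The set of geometric points of the twist is stable under conjugation. -/
lemma aeval_map_eq_zero (H : IsTwistSystem Φ ρ SY SX) {q : MvPolynomial (Fin (F.M + 1)) L}
    (hq : ∀ (Ω : Type) [Field Ω] [Algebra k Ω] [Algebra L Ω] [IsScalarTower k L Ω] (a x ys),
      IsWitness Φ ρ SY (A := Ω) a x ys → aeval (F.T x ys) q = 0) (h : L ≃ₐ[k] L)
    {Ω : Type} [Field Ω] [Algebra k Ω] [Algebra L Ω] [IsScalarTower k L Ω] {a x ys}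
    (hw : IsWitness Φ ρ SY (A := Ω) a x ys) : aeval (F.T x ys) (map (h : L →+* L) q) = 0 := by
  obtain ⟨Ω', _, _, _, _, f, hf⟩ : ∃ (Ω' : Type) (_ : Field Ω') (_ : Algebra k Ω') (_ : Algebra L Ω')
      (_ : IsScalarTower k L Ω') (f : Ω' ≃ₐ[k] Ω), ∀ a : L, f (algebraMap L Ω' a) =
        algebraMap L Ω (h a) := by
    refine ⟨Ω, ‹Field Ω›, ‹Algebra k Ω›, ((algebraMap L Ω).comp (h : L →+* L)).toAlgebra, ?_,
      AlgEquiv.refl, fun a => rfl⟩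
    refine @IsScalarTower.of_algebraMap_eq k L Ω _ _ _ _ ((algebraMap L Ω).comp (h : L →+* L)).toAlgebra _ fun c => ?_
    change _ = algebraMap L Ω (h (algebraMap k L c))
    rw [h.commutes, ← IsScalarTower.algebraMap_apply]
  obtain ⟨b, hb⟩ := (H.morρ h).exists_isImage hw.1
  have hbY := (H.morρ h).mem_of_isImage H.homY hw.1 hb
  have hw' : IsWitness Φ ρ SY b x (fun g => ys (h * g)) := by
    refine ⟨hbY, ?_, fun g => ?_⟩
    · obtain ⟨x', hx'⟩ := H.mor.exists_isImage hbY
      exact hx'.congr_right (H.mor.unitEquiv_of_isImage hw.1 (H.comm Ω a hw.1 h b x' hb hx') hw.2.1)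
    · obtain ⟨y, hy⟩ := (H.morρ g).exists_isImage hbY
      exact hy.congr_right ((H.morρ (h * g)).unitEquiv_of_isImage hw.1 (H.mul Ω a hw.1 g h b y hb hy)
        (hw.2.2 (h * g)))
  have hw'' : IsWitness Φ ρ SY (A := Ω') (f.symm ∘ b) (f.symm ∘ x)
      (fun g => f.symm ∘ ys (h * g)) :=
    ⟨ringPoints_algHom (f.symm : Ω →ₐ[k] Ω') hw'.1, hw'.2.1.map (f.symm : Ω →ₐ[k] Ω'),
      fun g => (hw'.2.2 g).map (f.symm : Ω →ₐ[k] Ω')⟩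
  have h1 := congrArg f (hq Ω' _ _ _ hw'')
  have hT := F.map_T h (f : Ω' →+* Ω) hf (f.symm ∘ x) (fun g => f.symm ∘ ys (h * g))
  have hT' : F.T ((f : Ω' →+* Ω) ∘ (f.symm ∘ x))
      (fun g => (f : Ω' →+* Ω) ∘ (f.symm ∘ ys (h * (h⁻¹ * g)))) = F.T x ys := by
    congr 1
    · ext i
      simp
    · ext g i
      simp
  rw [hT'] at hT
  rw [← hT, aeval_def, eval₂_map]
  rw [map_zero, aeval_def] at h1
  refine Eq.trans ?_ h1
  rw [show f (eval₂ (algebraMap L Ω') (F.T (f.symm ∘ x) fun g => f.symm ∘ ys (h * g)) q) =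
    (f : Ω' →+* Ω) (eval₂ (algebraMap L Ω') (F.T (f.symm ∘ x) fun g => f.symm ∘ ys (h * g)) q) from rfl,
    eval₂_comp_left]
  congr 1
  ext c
  exact (hf c).symm

/-- A form over the splitting field vanishing on the geometric points of the twist vanishes on all
points with values in reduced rings. -/
lemma aeval_eq_zero_of_forall_field [IsGalois k L] (H : IsTwistSystem Φ ρ SY SX)
    {q : MvPolynomial (Fin (F.M + 1)) L} {e : ℕ} (hqe : q.IsHomogeneous e)
    (hq : ∀ (Ω : Type) [Field Ω] [Algebra k Ω] [Algebra L Ω] [IsScalarTower k L Ω] (a x ys),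
      IsWitness Φ ρ SY (A := Ω) a x ys → aeval (F.T x ys) q = 0)
    {A : Type} [CommRing A] [IsReduced A] [Algebra k A] [Algebra L A] [IsScalarTower k L A]
    {z : Fin (F.M + 1) → A} (hz : ∀ f ∈ F.eqs Φ ρ SY, aeval z f = 0) : aeval z q = 0 := by
  rw [F.eq_sum_tracePoly q, map_sum]
  refine Finset.sum_eq_zero fun i _ => ?_
  rw [map_mul, aeval_map_algebraMap]
  obtain ⟨N, hN⟩ := F.exists_pow_mem_eqs H (f := tracePoly (k := k) (F.b i) q)
    (isHomogeneous_tracePoly _ hqe) (fun Ω _ _ _ _ a x ys hw => by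
      rw [← aeval_map_algebraMap (A := L), map_tracePoly, map_sum]
      refine Finset.sum_eq_zero fun h _ => ?_
      rw [map_mul, F.aeval_map_eq_zero H hq h hw, mul_zero])
  have h := hz _ hN
  rw [map_pow] at h
  rw [eq_zero_of_pow_eq_zero h, mul_zero]

/-- The geometric points of the twist are parametrized by those of the cover. -/
lemma IsProj.unitEquiv_T [IsGalois k L] (H : IsTwistSystem Φ ρ SY SX) {Ω : Type} [Field Ω]
    [Algebra k Ω] [Algebra L Ω] [IsScalarTower k L Ω] {z : Fin (F.M + 1) → Ω}
    (hz : z ∈ ringPoints k (F.eqs Φ ρ SY) Ω) {y : Fin (m + 1) → Ω} (h : F.IsProj z y) {x ys}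
    (hw : IsWitness Φ ρ SY y x ys) : _root_.unitEquiv (F.T x ys) z := by
  obtain ⟨d, hd, u, rfl⟩ := h
  set y := F.projVec 1 z d.1 d.2 with hy
  have hw : IsWitness Φ ρ SY y x ys := by
    have hu : _root_.unitEquiv (fun i => (u : Ω) * y i) y := .symm ⟨u, rfl⟩
    exact ⟨mem_ringPoints_of_unitEquiv H.homY hu hw.1, hw.2.1.congr_left hu,
      fun g => (hw.2.2 g).congr_left hu⟩
  obtain ⟨τ, -, hw'⟩ := exists_isUnit_aeval_domainPoly hw
  refine (F.unitEquiv_T_of_isWitness H hw hw').trans ?_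
  refine _root_.unitEquiv.symm (unitEquiv_of_mul_eq_mul (fun i j => ?_) hz.1
    (F.exists_isUnit_T hw'.2.1.exists_isUnit fun g => (hw'.2.2 g).exists_isUnit))
  have hpoly : ∀ (B : Type) [CommRing B] [Algebra k B] [Algebra L B] [IsScalarTower k L B]
      (t : Fin (F.M + 1) → B) (i), aeval t (aeval (F.projPoly 1 d.1 d.2) (F.paramPoly Φ ρ τ.2.1 i)) =
        F.T (Φ.evalVec τ.2.1.1 (F.projVec 1 t d.1 d.2))
          (fun g => (ρ g).evalVec (τ.2.1.2 g) (F.projVec 1 t d.1 d.2)) i := by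
    intro B _ _ _ _ t i
    rw [comp_aeval_apply]
    simp only [aeval_projPoly]
    exact congrFun (F.aeval_paramPoly τ.2.1 (F.projVec 1 t d.1 d.2)) i
  have := F.aeval_eq_zero_of_forall_field H
    (q := X i * aeval (F.projPoly 1 d.1 d.2) (F.paramPoly Φ ρ τ.2.1 j) -
      X j * aeval (F.projPoly 1 d.1 d.2) (F.paramPoly Φ ρ τ.2.1 i))
    (((isHomogeneous_X _ _).mul ((F.isHomogeneous_paramPoly _ _).aeval _
      fun _ => F.isHomogeneous_projPoly _ _ _ _)).sub ((isHomogeneous_X _ _).mul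
        ((F.isHomogeneous_paramPoly _ _).aeval _ fun _ => F.isHomogeneous_projPoly _ _ _ _)))
    (fun Ω' _ _ _ _ a x' ys' hw₁ => ?_) (z := z)
    (fun f hf => by rw [← eval_map_eq_aeval]; exact hz.2 f hf)
  · simp only [map_sub, map_mul, aeval_X, hpoly] at this
    rw [sub_eq_zero] at this
    exact this
  · simp only [map_sub, map_mul, aeval_X, hpoly, projVec_T]
    obtain ⟨v, hv⟩ := (H.morρ 1).unitEquiv_of_isImage hw₁.1 (H.one Ω' a hw₁.1) (hw₁.2.2 1)
    rw [show ys' 1 = (v : Ω') • a from hv, smul_smul, Φ.evalVec_smul]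
    simp only [ChartMap.evalVec_smul]
    rw [F.T_smul]
    obtain ⟨w, hw₂⟩ := F.exists_smul_T H hw₁ τ.2.1
    rw [hw₂]
    simp only [Pi.smul_apply, smul_eq_mul]
    ring

end TwistFrame

namespace TwistFrame

variable {k L : Type} [Field k] [Field L] [Algebra k L] [FiniteDimensional k L] [IsGalois k L]
  {m n : ℕ} {Φ : ChartMap k m n} {ρ : (L ≃ₐ[k] L) → ChartMap k m m}
  {SY : Set (MvPolynomial (Fin (m + 1)) k)} {SX : Set (MvPolynomial (Fin (n + 1)) k)}
  (F : TwistFrame k L m n)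

section OverField

variable {Ω : Type} [Field Ω] [Algebra k Ω] [Algebra L Ω] [IsScalarTower k L Ω]

/-- Every geometric point of the twist comes from a point of the cover. -/
lemma exists_isWitness_unitEquiv (H : IsTwistSystem Φ ρ SY SX) {z : Fin (F.M + 1) → Ω}
    (hz : z ∈ ringPoints k (F.eqs Φ ρ SY) Ω) :
    ∃ y x ys, F.IsProj z y ∧ IsWitness Φ ρ SY y x ys ∧ unitEquiv (F.T x ys) z := by
  obtain ⟨y, hy⟩ := F.exists_isProj hz
  obtain ⟨x, ys, hw⟩ := H.exists_isWitness (hy.mem F H hz)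
  exact ⟨y, x, ys, hy, hw, hy.unitEquiv_T F H hz hw⟩

lemma IsProj.isImage_toBase (H : IsTwistSystem Φ ρ SY SX) {z : Fin (F.M + 1) → Ω}
    (hz : z ∈ ringPoints k (F.eqs Φ ρ SY) Ω) {y : Fin (m + 1) → Ω} (h : F.IsProj z y)
    {x : Fin (n + 1) → Ω} (hx : IsImage Φ y x) : IsImage F.toBase z x := by
  have hy := h.mem F H hz
  choose ys hys using fun g => (H.morρ g).exists_isImage hy
  have hw : IsWitness Φ ρ SY y x ys := ⟨hy, hx, hys⟩
  exact (F.isImage_toBase_T (F.T_mem hw).1).congr_left (h.unitEquiv_T F H hz hw)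

end OverField

section Twist

variable (K : Type) [Field K] [Algebra k K] [Algebra L K] [IsScalarTower k L K]

/-- The twist becomes isomorphic to the cover over a splitting field. -/
lemma isChartIso_toCover (H : IsTwistSystem Φ ρ SY SX) :
    IsChartIso K (F.toCover K) (map (algebraMap k K) '' F.eqs Φ ρ SY)
      (map (algebraMap k K) '' SY) := by
  have h1 : IsLeftInverseOn (map (algebraMap k K) '' F.eqs Φ ρ SY) (F.fromCover Φ ρ K)
      (F.toCover K) := by
    intro A _ _ z hz y hy t ht
    letI : Algebra L A := Algebra.compHom A (algebraMap L K)
    letI : Algebra k A := Algebra.compHom A (algebraMap k K)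
    haveI : IsScalarTower L K A := .of_algebraMap_eq fun _ => rfl
    haveI : IsScalarTower k K A := .of_algebraMap_eq fun _ => rfl
    haveI : IsScalarTower k L A := .to₁₂₄ k L K A
    rw [isImage_toCover_iff] at hy
    rw [isImage_fromCover_iff] at ht
    rw [mem_ringPoints_image_map_iff] at hz
    obtain ⟨x, ys, hx, hys, h⟩ := ht
    exact (hy.unitEquiv_T F H hz ⟨hy.mem F H hz, hx, hys⟩).symm.trans h
  have h2 : IsLeftInverseOn (map (algebraMap k K) '' SY) (F.toCover K) (F.fromCover Φ ρ K) := by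
    intro A _ _ a ha t ht y hy
    letI : Algebra L A := Algebra.compHom A (algebraMap L K)
    letI : Algebra k A := Algebra.compHom A (algebraMap k K)
    haveI : IsScalarTower L K A := .of_algebraMap_eq fun _ => rfl
    haveI : IsScalarTower k K A := .of_algebraMap_eq fun _ => rfl
    haveI : IsScalarTower k L A := .to₁₂₄ k L K A
    rw [isImage_toCover_iff] at hy
    rw [isImage_fromCover_iff] at ht
    rw [mem_ringPoints_image_map_iff] at ha
    obtain ⟨x, ys, hx, hys, h⟩ := ht
    have hw : IsWitness Φ ρ SY a x ys := ⟨ha, hx, hys⟩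
    have hp := (F.isProj_T hx.exists_isUnit fun g => (hys g).exists_isUnit).congr_left F h
    exact ((H.morρ 1).unitEquiv_of_isImage ha (H.one A a ha) (hys 1)).trans
      (hp.unitEquiv F (mem_ringPoints_of_unitEquiv F.homogeneous_eqs h (F.T_mem hw)) hy)
  rw [isLeftInverseOn_iff (isHomogeneous_of_mem_image_map F.homogeneous_eqs)] at h1
  rw [isLeftInverseOn_iff (isHomogeneous_of_mem_image_map H.homY)] at h2
  exact ⟨F.isChartMorphism_toCover K H, F.fromCover Φ ρ K, F.isChartMorphism_fromCover H,
    fun Ω _ _ => ⟨h1 Ω, h2 Ω⟩⟩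

lemma chartImage_toBase_of_toCover (H : IsTwistSystem Φ ρ SY SX) (Ω : Type) [Field Ω] [Algebra K Ω]
    (z : Projectivization Ω (Fin (F.M + 1) → Ω))
    (hz : z ∈ projZeroLocus K (map (algebraMap k K) '' F.eqs Φ ρ SY) Ω) (y)
    (hy : chartImage (F.toCover K) z y) (x) (hx : chartImage (Φ.baseChange (K := K)) y x) :
    chartImage (F.toBase.baseChange (K := K)) z x := by
  letI : Algebra L Ω := Algebra.compHom Ω (algebraMap L K)
  letI : Algebra k Ω := Algebra.compHom Ω (algebraMap k K)
  haveI : IsScalarTower L K Ω := .of_algebraMap_eq fun _ => rfl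
  haveI : IsScalarTower k K Ω := .of_algebraMap_eq fun _ => rfl
  haveI : IsScalarTower k L Ω := .to₁₂₄ k L K Ω
  rw [mem_projZeroLocus_iff, mem_ringPoints_image_map_iff] at hz
  rw [chartImage_iff, isImage_toCover_iff] at hy
  rw [chartImage_iff, isImage_baseChange_iff] at hx ⊢
  exact hy.isImage_toBase F H hz hx

end Twist

/-- The projection from the twist to the base has finite fibres. -/
lemma finite_fiber_toBase (H : IsTwistSystem Φ ρ SY SX) (het : IsFiniteEtaleMor k Φ SY SX)
    (Ω : Type) [Field Ω] [Algebra k Ω] [IsAlgClosed Ω] (x : Projectivization Ω (Fin (n + 1) → Ω))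
    (hx : x ∈ projZeroLocus k SX Ω) :
    {z | z ∈ projZeroLocus k (F.eqs Φ ρ SY) Ω ∧ chartImage F.toBase z x}.Finite := by
  let i : L →ₐ[k] Ω := IsAlgClosed.lift
  letI : Algebra L Ω := i.toRingHom.toAlgebra
  haveI : IsScalarTower k L Ω := .of_algebraMap_eq fun c => (i.commutes c).symm
  obtain ⟨d, -, hd⟩ := het
  have hres : IsAlgClosed (IsLocalRing.ResidueField Ω) :=
    .of_ringEquiv Ω _ (RingEquiv.ofBijective (IsLocalRing.residue Ω)
      ⟨(IsLocalRing.residue Ω).injective, IsLocalRing.residue_surjective⟩)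
  obtain ⟨r, -, -, hr⟩ := hd Ω hres x.rep (mem_projZeroLocus_iff.1 hx)
  have key : ∀ z : {z | z ∈ projZeroLocus k (F.eqs Φ ρ SY) Ω ∧ chartImage F.toBase z x},
      ∃ j, F.IsProj z.1.rep (r j) := by
    rintro ⟨z, hz, hzx⟩
    rw [mem_projZeroLocus_iff] at hz
    rw [chartImage_iff] at hzx
    obtain ⟨y, hy⟩ := F.exists_isProj hz
    have hyY := hy.mem F H hz
    obtain ⟨x', hx'⟩ := H.mor.exists_isImage hyY
    have hyx := hx'.congr_right ((F.isChartMorphism_toBase H).unitEquiv_of_isImage hz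
      (hy.isImage_toBase F H hz hx') hzx)
    obtain ⟨j, hj⟩ := hr y ⟨hyY, hyx⟩
    exact ⟨j, hy.congr_right F hj⟩
  choose j hj using key
  haveI := Finite.of_injective j fun z z' hzz' => ?_
  · exact Set.toFinite _
  have hz := mem_projZeroLocus_iff.1 z.2.1
  have hz' := mem_projZeroLocus_iff.1 z'.2.1
  have h := hj z
  obtain ⟨x₁, ys, hw⟩ := H.exists_isWitness (h.mem F H hz)
  exact Subtype.ext (eq_of_unitEquiv_rep ((h.unitEquiv_T F H hz hw).symm.trans
    ((hzz' ▸ hj z').unitEquiv_T F H hz' hw)))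

end TwistFrame

lemma mem_radical_span_map_iff {k K : Type} [Field k] [Field K] [Algebra k K] [IsAlgClosed K] {n : ℕ}
    {S : Set (MvPolynomial (Fin (n + 1)) k)} {f : MvPolynomial (Fin (n + 1)) K} :
    f ∈ (Ideal.span (map (algebraMap k K) '' S)).radical ↔
      ∀ y : Fin (n + 1) → K, (∀ g ∈ S, aeval y g = 0) → aeval y f = 0 := by
  rw [← vanishingIdeal_zeroLocus_eq_radical (K := K), mem_vanishingIdeal_iff, zeroLocus_span]
  simp only [Set.forall_mem_image, Set.mem_setOf_eq, mem_zeroLocus_iff, aeval_map_algebraMap]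

namespace TwistFrame

variable {k L : Type} [Field k] [Field L] [Algebra k L] [FiniteDimensional k L] [IsGalois k L]
  {m n : ℕ} {Φ : ChartMap k m n} {ρ : (L ≃ₐ[k] L) → ChartMap k m m}
  {SY : Set (MvPolynomial (Fin (m + 1)) k)} {SX : Set (MvPolynomial (Fin (n + 1)) k)}
  (F : TwistFrame k L m n)

/-- Twists of geometrically integral covers are geometrically integral. -/
lemma geomIntegralOver_eqs (K : Type) [Field K] [IsAlgClosed K] [Algebra k K] [Algebra L K]
    [IsScalarTower k L K] (H : IsTwistSystem Φ ρ SY SX) (hY : GeomIntegralOver k K SY) :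
    GeomIntegralOver k K (F.eqs Φ ρ SY) := by
  obtain ⟨hP, y₀, hy₀, hy₀S⟩ := hY
  have hy₀Y : y₀ ∈ ringPoints k SY K := ⟨exists_isUnit_iff_ne_zero.2 hy₀, hy₀S⟩
  simp only [eval_map_eq_aeval] at hy₀S
  obtain ⟨x₀, ys₀, hw₀⟩ := H.exists_isWitness hy₀Y
  have hT₀ := F.T_mem hw₀
  obtain ⟨τ, hτ, -⟩ := exists_isUnit_aeval_domainPoly hw₀
  let Tv : (Fin Φ.numCharts × ∀ g, Fin (ρ g).numCharts) → (Fin (m + 1) → K) → Fin (F.M + 1) → K :=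
    fun c y => F.T (Φ.evalVec c.1 y) (fun g => (ρ g).evalVec (c.2 g) y)
  have hTv : ∀ c y, (fun i => aeval y (map (algebraMap L K) (F.paramPoly Φ ρ c i))) = Tv c y :=
    fun c y => by
      simp only [aeval_map_algebraMap]
      exact F.aeval_paramPoly c y
  have hTv_smul : ∀ c (s : K) y, Tv c (s • y) = s ^ (Φ.deg c.1 + ∑ g, (ρ g).deg (c.2 g)) • Tv c y := by
    intro c s y
    rw [← hTv, ← hTv]
    ext i
    exact ((F.isHomogeneous_paramPoly c i).map _).aeval_smul' s y
  let θ : MvPolynomial (Fin (F.M + 1)) K →ₐ[K] MvPolynomial (Fin (m + 1)) K :=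
    aeval fun i => X τ.1 * map (algebraMap L K) (F.paramPoly Φ ρ τ.2.1 i)
  have hθ : ∀ f y, aeval y (θ f) = aeval (y τ.1 • Tv τ.2.1 y) f := by
    intro f y
    rw [← hTv]
    refine (comp_aeval_apply _ (aeval y : MvPolynomial _ K →ₐ[K] K) f).trans ?_
    simp only [map_mul, aeval_X]
    rfl
  have hhom : ∀ (s : K) (y : Fin (m + 1) → K), (∀ g ∈ SY, aeval y g = 0) →
      ∀ g ∈ SY, aeval (s • y) g = 0 := fun s y hy g hg => by
    obtain ⟨e, he⟩ := H.homY g hg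
    rw [he.aeval_smul', hy g hg, mul_zero]
  refine ⟨?_, F.T x₀ ys₀, exists_isUnit_iff_ne_zero.1 hT₀.1, hT₀.2⟩
  suffices h : (Ideal.span (map (algebraMap k K) '' F.eqs Φ ρ SY)).radical =
      (Ideal.span (map (algebraMap k K) '' SY)).radical.comap θ by
    rw [h]
    exact hP.comap θ
  ext f
  rw [Ideal.mem_comap, mem_radical_span_map_iff, mem_radical_span_map_iff]
  simp only [hθ]
  constructor
  · intro h y hy
    refine h _ fun g hg => ?_
    obtain ⟨e, he⟩ := hg.1
    by_cases h0 : y = 0 ∨ Tv τ.2.1 y = 0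
    · have : y τ.1 • Tv τ.2.1 y = (0 : K) • F.T x₀ ys₀ := by
        rcases h0 with h0 | h0
        · rw [h0, Pi.zero_apply, zero_smul, zero_smul]
        · rw [h0, smul_zero, zero_smul]
      rw [this, he.aeval_smul', ← eval_map_eq_aeval, hT₀.2 g hg, mul_zero]
    · push Not at h0
      have hu := F.exists_isUnit_of_T (exists_isUnit_iff_ne_zero.2 h0.2)
      have hw : IsWitness Φ ρ SY y (Φ.evalVec τ.2.1.1 y) (fun g => (ρ g).evalVec (τ.2.1.2 g) y) :=
        ⟨⟨exists_isUnit_iff_ne_zero.2 h0.1, by simpa only [eval_map_eq_aeval] using hy⟩,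
          ⟨_, hu.1, .refl _⟩, fun g => ⟨_, hu.2 g, .refl _⟩⟩
      rw [he.aeval_smul', ← eval_map_eq_aeval, (F.T_mem hw).2 g hg, mul_zero]
  · intro h
    have h1 : ∀ (y : Fin (m + 1) → K), (∀ g ∈ SY, aeval y g = 0) → y τ.1 ≠ 0 → ∀ μ : K,
        aeval (μ • Tv τ.2.1 y) f = 0 := by
      intro y hy hyτ μ
      obtain ⟨s, hs⟩ := IsAlgClosed.exists_pow_nat_eq (μ / y τ.1)
        (Nat.succ_pos (Φ.deg τ.2.1.1 + ∑ g, (ρ g).deg (τ.2.1.2 g)))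
      have := h (s • y) (hhom s y hy)
      rwa [hTv_smul, Pi.smul_apply, smul_eq_mul, smul_smul, mul_right_comm, ← pow_succ', hs,
        div_mul_cancel₀ _ hyτ] at this
    have hne : ∀ τ (y : Fin (m + 1) → K), aeval y (domainPoly k Φ ρ τ) ≠ 0 → y τ.1 ≠ 0 := by
      intro τ y h h0
      rw [aeval_domainPoly, h0, zero_mul] at h
      exact h rfl
    intro z hz
    by_cases hz0 : z = 0
    · rw [hz0, ← zero_smul K (Tv τ.2.1 y₀)]
      exact h1 y₀ hy₀S (hne τ y₀ hτ.ne_zero) 0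
    obtain ⟨y, x, ys, -, hw, hu⟩ := F.exists_isWitness_unitEquiv H (z := z)
      ⟨exists_isUnit_iff_ne_zero.2 hz0, by simpa only [eval_map_eq_aeval] using hz⟩
    obtain ⟨τ', hτ', hw'⟩ := exists_isUnit_aeval_domainPoly hw
    obtain ⟨u, rfl⟩ := (F.unitEquiv_T_of_isWitness H hw' hw).trans hu
    let G : MvPolynomial (Fin (m + 1)) K :=
      aeval (fun i => C (u : K) * map (algebraMap L K) (F.paramPoly Φ ρ τ'.2.1 i)) f
    have hG : ∀ y, aeval y G = aeval ((u : K) • Tv τ'.2.1 y) f := by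
      intro y
      rw [← hTv]
      refine (comp_aeval_apply _ (aeval y : MvPolynomial _ K →ₐ[K] K) f).trans ?_
      simp only [map_mul, aeval_C]
      rfl
    have hyS : ∀ g ∈ SY, aeval y g = 0 := by simpa only [eval_map_eq_aeval] using hw.1.2
    have hmem : G * map (algebraMap k K) (domainPoly k Φ ρ τ) *
        map (algebraMap k K) (domainPoly k Φ ρ τ') ∈
          (Ideal.span (map (algebraMap k K) '' SY)).radical := by
      rw [mem_radical_span_map_iff]
      intro y' hy'
      rw [map_mul, map_mul, aeval_map_algebraMap, aeval_map_algebraMap, hG]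
      by_cases h₁ : aeval y' (domainPoly k Φ ρ τ) = 0
      · rw [h₁, mul_zero, zero_mul]
      by_cases h₂ : aeval y' (domainPoly k Φ ρ τ') = 0
      · rw [h₂, mul_zero]
      obtain ⟨v, hv⟩ := F.exists_smul_T H (isWitness_of_aeval_domainPoly hy' h₁) τ'.2.1
      have : Tv τ'.2.1 y' = v • Tv τ.2.1 y' := hv
      rw [this, smul_smul, h1 y' hy' (hne τ y' h₁), zero_mul, zero_mul]
    have h₃ : map (algebraMap k K) (domainPoly k Φ ρ τ) ∉
        (Ideal.span (map (algebraMap k K) '' SY)).radical := fun hmem => by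
      rw [mem_radical_span_map_iff] at hmem
      have := hmem y₀ hy₀S
      rw [aeval_map_algebraMap] at this
      exact hτ.ne_zero this
    have h₄ : map (algebraMap k K) (domainPoly k Φ ρ τ') ∉
        (Ideal.span (map (algebraMap k K) '' SY)).radical := fun hmem => by
      rw [mem_radical_span_map_iff] at hmem
      have := hmem y hyS
      rw [aeval_map_algebraMap] at this
      exact hτ'.ne_zero this
    have h₅ := ((hP.mem_or_mem hmem).resolve_right h₄ |> hP.mem_or_mem).resolve_right h₃
    rw [mem_radical_span_map_iff] at h₅
    exact (hG y).symm.trans (h₅ y hyS)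

end TwistFrame

section

variable {k L : Type} [Field k] [Field L] [Algebra k L] {m n : ℕ} {Φ : ChartMap k m n}
  {ρ : (L ≃ₐ[k] L) → ChartMap k m m}
  {SY : Set (MvPolynomial (Fin (m + 1)) k)} {SX : Set (MvPolynomial (Fin (n + 1)) k)}

/-- Deck transformations acting on a point as the Galois group does define a twist. -/
lemma IsTwistSystem.of_point (hSY : ∀ f ∈ SY, ∃ e, f.IsHomogeneous e)
    (hSX : ∀ f ∈ SX, ∃ e, f.IsHomogeneous e) (hmor : IsChartMorphism k Φ SY SX)
    (hgal : IsGaloisCover k Φ SY SX) {K : Type} [Field K] [Algebra k K] [IsAlgClosed K]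
    (ι : L →ₐ[k] K) (hρ : ∀ g, IsDeckAut k Φ SY SX (ρ g)) {y : Fin (m + 1) → L}
    (hy : y ∈ ringPoints k SY L) (h : ∀ g : L ≃ₐ[k] L, IsImage (ρ g) y (g ∘ y)) :
    IsTwistSystem Φ ρ SY SX where
  homY := hSY
  homX := hSX
  mor := hmor
  morρ g := (hρ g).1
  comm Ω _ _ y hy g z x hz hx := (commutesWith_iff hSY).1 (hρ g).2.1 Ω y hy z hz x hx
  one Ω _ _ z hz := hgal.isImage_self hSY hmor hSX (ringPoints_algHom ι hy) (hρ 1)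
    ((h 1).map ι) hz
  mul Ω _ _ z hz g g' w w' hw hw' := by
    refine hgal.isImage_of_agree hSY hmor hSX (ringPoints_algHom ι hy)
      ((hρ g').comp hSY (hρ g)) (hρ (g' * g)) (y' := ι ∘ (g' * g) ∘ y) ?_ ((h _).map ι) hz
      (isImage_comp_iff.2 ⟨w, hw, hw'⟩)
    exact isImage_comp_iff.2 ⟨ι ∘ g' ∘ y, (h g').map ι, ((h g).map (g' : L →ₐ[k] L)).map ι⟩

/-- A point over a rational point of the base on which deck transformations act as the Galois group
does gives a rational point on the twist. -/
lemma TwistFrame.exists_rational_point [FiniteDimensional k L] [IsGalois k L]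
    (F : TwistFrame k L m n) {y : Fin (m + 1) → L} (hy : y ∈ ringPoints k SY L)
    {x : Fin (n + 1) → k} (hx : IsImage Φ y (algebraMap k L ∘ x))
    (h : ∀ g : L ≃ₐ[k] L, IsImage (ρ g) y (g ∘ y)) :
    ∃ t ∈ ringPoints k (F.eqs Φ ρ SY) k, IsImage F.toBase t x := by
  have hw : IsWitness Φ ρ SY y (algebraMap k L ∘ x) fun g => g ∘ y := ⟨hy, hx, h⟩
  have hfix : ∀ a, ∃ t : k, algebraMap k L t = F.T (algebraMap k L ∘ x) (fun g => g ∘ y) a := by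
    intro a
    refine (IsGalois.mem_range_algebraMap_iff_fixed _).2 fun g => ?_
    have := F.map_T g (g : L →+* L) (fun _ => rfl) (algebraMap k L ∘ x) (fun g => g ∘ y)
    refine (congrFun this a).trans (congrFun (congrArg₂ F.T ?_ ?_) a)
    · ext j
      simp
    · ext g' l
      simp
  choose t ht using hfix
  have ht' : Algebra.ofId k L ∘ t = F.T (algebraMap k L ∘ x) (fun g => g ∘ y) := funext ht
  have hT := F.T_mem hw
  refine ⟨t, mem_ringPoints_of_map (Algebra.ofId k L) (ht' ▸ hT),
    .of_map (Algebra.ofId k L) ?_⟩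
  rw [ht']
  exact F.isImage_toBase_T hT.1

end

/-- Finite étale morphisms are surjective on geometric points. -/
lemma IsFiniteEtaleMor.exists_isImage {k : Type} [Field k] {m n : ℕ} {Φ : ChartMap k m n}
    {SY : Set (MvPolynomial (Fin (m + 1)) k)} {SX : Set (MvPolynomial (Fin (n + 1)) k)}
    (het : IsFiniteEtaleMor k Φ SY SX) (K : Type) [Field K] [Algebra k K] [IsAlgClosed K]
    {x : Fin (n + 1) → K} (hx : x ∈ ringPoints k SX K) :
    ∃ y ∈ ringPoints k SY K, IsImage Φ y x := by
  obtain ⟨d, hd0, hd⟩ := het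
  have hres : IsAlgClosed (IsLocalRing.ResidueField K) :=
    .of_ringEquiv K _ (RingEquiv.ofBijective (IsLocalRing.residue K)
      ⟨(IsLocalRing.residue K).injective, IsLocalRing.residue_surjective⟩)
  obtain ⟨r, hr, -⟩ := hd K hres x hx
  exact ⟨r ⟨0, hd0⟩, hr _⟩

/-- Let `f : Y → X` (chart data `Φ`) be a finite étale Galois morphism
of projective geometrically irreducible varieties over a number field `k`.  Then there
are finitely many projective geometrically irreducible varieties `Y₁, …, Y_N` over `k`
together with finite morphisms `f_j : Y_j → X` over `k` such that:
(i) each `f_j : Y_j → X` is a twist of `f : Y → X`, i.e. after base change to `ℚ̄` there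
is an isomorphism `(Y_j)_ℚ̄ ≅ Y_ℚ̄` commuting with the maps to `X_ℚ̄`; and
(ii) `X(k) = ⋃ⱼ f_j(Y_j(k))`. -/
theorem statement_7 (k : Type) [Field k] [NumberField k] (m n : ℕ)
    (SY : Set (MvPolynomial (Fin (m + 1)) k)) (SX : Set (MvPolynomial (Fin (n + 1)) k))
    (hSYhom : ∀ f ∈ SY, ∃ e, f.IsHomogeneous e)
    (hSXhom : ∀ f ∈ SX, ∃ e, f.IsHomogeneous e)
    (hYint : GeomIntegralOver k (AlgebraicClosure k) SY)
    (hXint : GeomIntegralOver k (AlgebraicClosure k) SX)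
    (Φ : ChartMap k m n) (hmor : IsChartMorphism k Φ SY SX)
    (hetale : IsFiniteEtaleMor k Φ SY SX)
    (hgalois : IsGaloisCover k Φ SY SX) :
    ∃ (N : ℕ) (mdim : Fin N → ℕ)
      (SYt : (j : Fin N) → Set (MvPolynomial (Fin (mdim j + 1)) k))
      (Φt : (j : Fin N) → ChartMap k (mdim j) n),
      (∀ j, GeomIntegralOver k (AlgebraicClosure k) (SYt j)) ∧
      (∀ j, IsChartMorphism k (Φt j) (SYt j) SX) ∧
      -- the `f_j` are finite morphisms
      (∀ j, ∀ (Ω : Type) [Field Ω] [Algebra k Ω] [IsAlgClosed Ω],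
        ∀ x ∈ projZeroLocus k SX Ω,
          {y | y ∈ projZeroLocus k (SYt j) Ω ∧ chartImage (Φt j) y x}.Finite) ∧
      -- (i) each `f_j` is a twist of `f`
      (∀ j, ∃ g : ChartMap (AlgebraicClosure k) (mdim j) m,
        IsChartIso (AlgebraicClosure k) g
          ((map (algebraMap k (AlgebraicClosure k))) '' SYt j)
          ((map (algebraMap k (AlgebraicClosure k))) '' SY) ∧
        ∀ (Ω : Type) [Field Ω] [Algebra (AlgebraicClosure k) Ω],
          ∀ y ∈ projZeroLocus (AlgebraicClosure k)
              ((map (algebraMap k (AlgebraicClosure k))) '' SYt j) Ω,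
            ∀ z, chartImage g y z →
              ∀ w, chartImage (ChartMap.baseChange (K := AlgebraicClosure k) Φ) z w →
                chartImage (ChartMap.baseChange (K := AlgebraicClosure k) (Φt j)) y w) ∧
      -- (ii) `X(k)` is the union of the images of the `Y_j(k)`
      projZeroLocus k SX k =
        ⋃ j, {x | ∃ y ∈ projZeroLocus k (SYt j) k, chartImage (Φt j) y x} := by
  obtain ⟨y₀, hy₀, hy₀S⟩ := hYint.2
  have hy₀Y : y₀ ∈ ringPoints k SY (AlgebraicClosure k) :=
    ⟨exists_isUnit_iff_ne_zero.2 hy₀, hy₀S⟩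
  obtain ⟨d, σ, hσ, hrep⟩ := hgalois.exists_reps hSYhom hmor hSXhom _ hy₀Y hetale
  obtain ⟨L, hLn, hLf, hL⟩ := exists_normal_field hSYhom hmor hSXhom hgalois (AlgebraicClosure k) σ
    hσ (hrep _)
  haveI : IsGalois k L := {}
  obtain ⟨F⟩ := TwistFrame.nonempty (k := k) (L := L) m n
  let R : Set ((L ≃ₐ[k] L) → Fin d) := {τ | ∃ y ∈ ringPoints k SY L,
    ∀ g : L ≃ₐ[k] L, IsImage (σ (τ g)) y (g ∘ y)}
  obtain ⟨N, ⟨e⟩⟩ := Finite.exists_equiv_fin R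
  let ρ : Fin N → (L ≃ₐ[k] L) → ChartMap k m m := fun j g => σ ((e.symm j).1 g)
  have H : ∀ j, IsTwistSystem Φ (ρ j) SY SX := fun j => by
    obtain ⟨y, hy, h⟩ := (e.symm j).2
    exact .of_point hSYhom hSXhom hmor hgalois L.val (fun g => hσ _) hy h
  refine ⟨N, fun _ => F.M, fun j => F.eqs Φ (ρ j) SY, fun _ => F.toBase,
    fun j => F.geomIntegralOver_eqs _ (H j) hYint, fun j => F.isChartMorphism_toBase (H j),
    fun j Ω _ _ _ x hx => F.finite_fiber_toBase (H j) hetale Ω x hx,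
    fun j => ⟨F.toCover _, F.isChartIso_toCover _ (H j), fun Ω _ _ z hz y hy x hx =>
      F.chartImage_toBase_of_toCover _ (H j) Ω z hz y hy x hx⟩, ?_⟩
  ext x
  simp only [Set.mem_iUnion, Set.mem_setOf_eq]
  constructor
  · intro hx
    rw [mem_projZeroLocus_iff] at hx
    obtain ⟨y, hy, hyx⟩ := hetale.exists_isImage (AlgebraicClosure k)
      (ringPoints_algHom (Algebra.ofId k (AlgebraicClosure k)) hx)
    obtain ⟨y', hy'⟩ := hL y hy x.rep hyx
    have hy'Y : L.val ∘ y' ∈ ringPoints k SY (AlgebraicClosure k) :=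
      mem_ringPoints_of_unitEquiv hSYhom hy' hy
    have hy'x : IsImage Φ y' (algebraMap k L ∘ x.rep) := .of_map L.val (hyx.congr_left hy')
    have hτ : ∀ g : L ≃ₐ[k] L, ∃ i, IsImage (σ i) y' (g ∘ y') := by
      intro g
      obtain ⟨i, hi⟩ := hrep _ (L.val ∘ y') (L.val ∘ g ∘ y') (algebraMap k _ ∘ x.rep) hy'Y
        (ringPoints_algHom L.val (ringPoints_algHom (g : L →ₐ[k] L) (mem_ringPoints_of_map L.val hy'Y)))
        (hy'x.map_rational L.val) ((hy'x.map_rational (g : L →ₐ[k] L)).map_rational L.val)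
      exact ⟨i, .of_map L.val hi⟩
    choose τ hτ using hτ
    have hy'L := mem_ringPoints_of_map L.val hy'Y
    have hτj : ∀ g : L ≃ₐ[k] L, IsImage (ρ (e ⟨τ, y', hy'L, hτ⟩) g) y' (g ∘ y') := by
      simpa [ρ] using hτ
    obtain ⟨t, ht, htx⟩ := F.exists_rational_point hy'L hy'x hτj
    have ht0 := ringPoints.ne_zero ht
    refine ⟨e ⟨τ, y', hy'L, hτ⟩, .mk k t ht0,
      (mk_mem_projZeroLocus_iff F.homogeneous_eqs ht0).2 ht, ?_⟩
    rw [chartImage_iff]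
    exact htx.congr_left (unitEquiv_rep_mk ht0)
  · rintro ⟨j, z, hz, hzx⟩
    rw [mem_projZeroLocus_iff] at hz ⊢
    exact (F.isChartMorphism_toBase (H j)).mem_of_isImage hSXhom hz (chartImage_iff.1 hzx)
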